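/- Assume the family {P^u}_{u∈(a,b)} satisfies P1–P3 and S1–S2. Then for each u ∈ (a,b), P^u[·|0 ∈ S_∞]-almost surely: inf_{k≥1} inf{ |∂_S A| / |A|^{(d−1)/d} : A ⊆ S_∞ ∩ B_S(0,2k), |A| ≥ k^{1/3} } > 0 (i.e., P^u satisfies assumption A5). -/

import Mathlib

open MeasureTheory Filter
open scoped ENNReal

namespace Perco

/-- A point of the lattice `ℤ^d`. -/
abbrev Pt (d : ℕ) := Fin d → ℤ

/-- A percolation configuration on `ℤ^d`. -/
abbrev Config (d : ℕ) := Pt d → Bool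

variable {d : ℕ}

/-- The `ℓ¹`-distance on `ℤ^d`. -/
def dist1 (x y : Pt d) : ℕ := ∑ i, (x i - y i).natAbs

/-- The `ℓ^∞`-distance on `ℤ^d`. -/
def distInf (x y : Pt d) : ℕ := Finset.univ.sup fun i => (x i - y i).natAbs

/-- The closed `ℓ^∞`-ball of radius `R` around `x`. -/
def ballZ (x : Pt d) (R : ℕ) : Set (Pt d) := {y | distInf x y ≤ R}

/-- Nearest-neighbour adjacency in `ℤ^d`. -/
def adj (x y : Pt d) : Prop := dist1 x y = 1

/-- The occupied set of a configuration. -/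
def SS (ω : Config d) : Set (Pt d) := {x | ω x = true}

/-- One step of a nearest-neighbour path staying inside `T`. -/
def stepRel (T : Set (Pt d)) (x y : Pt d) : Prop := adj x y ∧ x ∈ T ∧ y ∈ T

/-- `x` and `y` are connected by a nearest-neighbour path inside `T`. -/
def connIn (T : Set (Pt d)) (x y : Pt d) : Prop :=
  x ∈ T ∧ y ∈ T ∧ Relation.ReflTransGen (stepRel T) x y

/-- The connected component (cluster) of `x` in `T`. -/
def cluster (T : Set (Pt d)) (x : Pt d) : Set (Pt d) := {y | connIn T x y}

/-- `S_r`: vertices of `S(ω)` in connected components of `ℓ¹`-diameter at least `r`. -/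
def Sr (ω : Config d) (r : ℝ) : Set (Pt d) :=
  {x | x ∈ SS ω ∧ ∃ y ∈ cluster (SS ω) x, ∃ z ∈ cluster (SS ω) x, r ≤ (dist1 y z : ℝ)}

/-- `S_∞`: vertices of `S(ω)` in infinite connected components. -/
def Sinf (ω : Config d) : Set (Pt d) := {x | x ∈ SS ω ∧ (cluster (SS ω) x).Infinite}

/-- The shift of a configuration by `x`. -/
def shift (x : Pt d) (ω : Config d) : Config d := fun y => ω (x + y)

/-- An increasing event. -/
def IncreasingEvent (G : Set (Config d)) : Prop :=
  ∀ ω ω' : Config d, (∀ x, ω x = true → ω' x = true) → ω ∈ G → ω' ∈ G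

/-- A decreasing event. -/
def DecreasingEvent (G : Set (Config d)) : Prop :=
  ∀ ω ω' : Config d, (∀ x, ω' x = true → ω x = true) → ω ∈ G → ω' ∈ G

/-- The event `G` depends only on the coordinates in `B`. -/
def DependsOn (G : Set (Config d)) (B : Set (Pt d)) : Prop :=
  ∀ ω ω' : Config d, (∀ x ∈ B, ω x = ω' x) → (ω ∈ G ↔ ω' ∈ G)

/-- The edge boundary of `A` in `Sset`: (directed representatives of) edges of `ℤ^d`
with one endpoint in `A` and the other in `Sset \ A`. -/
def edgeBd (Sset A : Set (Pt d)) : Set (Pt d × Pt d) :=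
  {p | adj p.1 p.2 ∧ p.1 ∈ A ∧ p.2 ∈ Sset \ A}

/-- The density `η(u) = P[0 ∈ S_∞]` of the infinite cluster. -/
noncomputable def eta (d : ℕ) (P : Measure (Config d)) : ℝ :=
  (P {ω | (0 : Pt d) ∈ Sinf ω}).toReal

/-- The first local-uniqueness event of axiom S1. -/
def locUniq1 (d : ℕ) (R : ℕ) : Set (Config d) :=
  {ω | (Sr ω R ∩ ballZ (0 : Pt d) R).Nonempty}

/-- The second local-uniqueness event of axiom S1. -/
def locUniq2 (d : ℕ) (R : ℕ) : Set (Config d) :=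
  {ω | ∀ x ∈ Sr ω ((R : ℝ)/10) ∩ ballZ (0 : Pt d) R,
       ∀ y ∈ Sr ω ((R : ℝ)/10) ∩ ballZ (0 : Pt d) R,
       connIn (SS ω ∩ ballZ (0 : Pt d) (2*R)) x y}

/-- The axioms **P1**–**P3** and **S1**–**S2** of Drewitz–Ráth–Sapozhnikov for a
one-parameter family of probability measures on `{0,1}^{ℤ^d}`. -/
structure Axioms (d : ℕ) (a b : ℝ) (P : ℝ → Measure (Config d)) where
  /-- decoupling exponent -/
  εP : ℝ
  /-- sprinkling exponent -/
  χP : ℝ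
  RP : ℕ
  LP : ℕ
  fP : ℕ → ℝ
  fS : ℝ → ℕ → ℝ
  ΔS : ℝ → ℝ
  RS : ℝ → ℕ
  prob : ∀ u ∈ Set.Ioo a b, IsProbabilityMeasure (P u)
  /-- P1: every lattice shift is measure preserving and ergodic. -/
  ergodic : ∀ u ∈ Set.Ioo a b, ∀ x : Pt d, x ≠ 0 → Ergodic (shift x) (P u)
  /-- P2: monotonicity. -/
  mono : ∀ u ∈ Set.Ioo a b, ∀ u' ∈ Set.Ioo a b, u ≤ u' →
    ∀ G : Set (Config d), MeasurableSet G → IncreasingEvent G → P u G ≤ P u' G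
  εP_pos : 0 < εP
  χP_pos : 0 < χP
  fP_lb : ∀ L : ℕ, LP ≤ L → Real.exp ((Real.log L) ^ εP) ≤ fP L
  /-- P3, decoupling for decreasing events. -/
  decoupleDec : ∀ (R L : ℕ), RP ≤ R → 1 ≤ L → ∀ x₁ x₂ : Pt d, R * L ≤ distInf x₁ x₂ →
    ∀ u uh : ℝ, uh ∈ Set.Ioo a b → u ∈ Set.Ioo a b → uh < u →
    (1 + (R : ℝ) ^ (-χP)) * uh ≤ u →
    ∀ A₁ A₂ : Set (Config d), MeasurableSet A₁ → MeasurableSet A₂ →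
      DecreasingEvent A₁ → DecreasingEvent A₂ →
      DependsOn A₁ (ballZ x₁ (10*L)) → DependsOn A₂ (ballZ x₂ (10*L)) →
      (P u (A₁ ∩ A₂)).toReal ≤ (P uh A₁).toReal * (P uh A₂).toReal + Real.exp (-(fP L))
  /-- P3, decoupling for increasing events. -/
  decoupleInc : ∀ (R L : ℕ), RP ≤ R → 1 ≤ L → ∀ x₁ x₂ : Pt d, R * L ≤ distInf x₁ x₂ →
    ∀ u uh : ℝ, uh ∈ Set.Ioo a b → u ∈ Set.Ioo a b → uh < u →
    (1 + (R : ℝ) ^ (-χP)) * uh ≤ u →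
    ∀ B₁ B₂ : Set (Config d), MeasurableSet B₁ → MeasurableSet B₂ →
      IncreasingEvent B₁ → IncreasingEvent B₂ →
      DependsOn B₁ (ballZ x₁ (10*L)) → DependsOn B₂ (ballZ x₂ (10*L)) →
      (P uh (B₁ ∩ B₂)).toReal ≤ (P u B₁).toReal * (P u B₂).toReal + Real.exp (-(fP L))
  ΔS_pos : ∀ u ∈ Set.Ioo a b, 0 < ΔS u
  fS_lb : ∀ u ∈ Set.Ioo a b, ∀ R : ℕ, RS u ≤ R → (Real.log R) ^ (1 + ΔS u) ≤ fS u R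
  /-- S1, first part. -/
  S1a : ∀ u ∈ Set.Ioo a b, ∀ R : ℕ, 1 ≤ R →
    1 - Real.exp (-(fS u R)) ≤ (P u (locUniq1 d R)).toReal
  /-- S1, second part. -/
  S1b : ∀ u ∈ Set.Ioo a b, ∀ R : ℕ, 1 ≤ R →
    1 - Real.exp (-(fS u R)) ≤ (P u (locUniq2 d R)).toReal
  /-- S2: positivity of the density of the infinite cluster. -/
  S2pos : ∀ u ∈ Set.Ioo a b, 0 < eta d (P u)
  /-- S2: continuity of the density of the infinite cluster. -/
  S2cont : ContinuousOn (fun u => eta d (P u)) (Set.Ioo a b)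


/-- The chemical (graph) distance inside `T`, with value `⊤` if there is no path. -/
noncomputable def chemDist (T : Set (Pt d)) (x y : Pt d) : ℕ∞ :=
  sInf {n : ℕ∞ | ∃ m : ℕ, n = (m : ℕ∞) ∧ ∃ p : ℕ → Pt d, p 0 = x ∧ p m = y ∧
    (∀ k, k ≤ m → p k ∈ T) ∧ ∀ k, k < m → adj (p k) (p (k+1))}

/-- The chemical ball `B_S(x,R)` in the configuration `ω`. -/
noncomputable def chemBall (ω : Config d) (x : Pt d) (R : ℕ) : Set (Pt d) :=
  {y | chemDist (SS ω) x y ≤ (R : ℕ∞)}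


/-! ### Lattice basics -/

theorem distInf_le_iff {x y : Pt d} {R : ℕ} :
    distInf x y ≤ R ↔ ∀ i, (x i - y i).natAbs ≤ R := by
  simp [distInf, Finset.sup_le_iff]

theorem natAbs_le_distInf (x y : Pt d) (i : Fin d) : (x i - y i).natAbs ≤ distInf x y :=
  distInf_le_iff.1 le_rfl i

theorem distInf_comm (x y : Pt d) : distInf x y = distInf y x := by
  apply le_antisymm <;> rw [distInf_le_iff] <;> intro i
  · have := natAbs_le_distInf y x i; omega
  · have := natAbs_le_distInf x y i; omega

theorem distInf_triangle (x y z : Pt d) : distInf x z ≤ distInf x y + distInf y z := by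
  rw [distInf_le_iff]; intro i
  have := natAbs_le_distInf x y i
  have := natAbs_le_distInf y z i
  omega

@[simp] theorem distInf_self (x : Pt d) : distInf x x = 0 := by
  have : distInf x x ≤ 0 := distInf_le_iff.2 (by simp)
  omega

theorem distInf_eq_zero {x y : Pt d} (h : distInf x y = 0) : x = y := by
  funext i
  have := natAbs_le_distInf x y i
  omega

/-- Finset version of the ball. -/
noncomputable def ballF (c : Pt d) (R : ℕ) : Finset (Pt d) :=
  Finset.Icc (fun i => c i - (R : ℤ)) (fun i => c i + (R : ℤ))

theorem mem_ballF {c y : Pt d} {R : ℕ} : y ∈ ballF c R ↔ distInf c y ≤ R := by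
  rw [ballF, Finset.mem_Icc, distInf_le_iff]
  simp only [Pi.le_def]
  constructor
  · rintro ⟨h1, h2⟩ i
    have := h1 i; have := h2 i; omega
  · intro h
    exact ⟨fun i => by have := h i; omega, fun i => by have := h i; omega⟩

theorem card_ballF (c : Pt d) (R : ℕ) : (ballF c R).card = (2 * R + 1) ^ d := by
  rw [ballF, Pi.card_Icc]
  simp only [Int.card_Icc]
  rw [Finset.prod_congr rfl (g := fun _ => 2 * R + 1)]
  · simp
  · intro i _; omega

theorem mem_ballZ {c y : Pt d} {R : ℕ} : y ∈ ballZ c R ↔ distInf c y ≤ R := Iff.rfl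

theorem ballZ_eq (c : Pt d) (R : ℕ) : ballZ c R = (ballF c R : Set (Pt d)) := by
  ext y; simp [mem_ballF, mem_ballZ]

theorem ballZ_finite (c : Pt d) (R : ℕ) : (ballZ c R).Finite := by
  rw [ballZ_eq]; exact Finset.finite_toSet _

theorem ballZ_subset {c c' : Pt d} {R R' : ℕ} (h : distInf c c' + R' ≤ R) :
    ballZ c' R' ⊆ ballZ c R := by
  intro y hy
  have := distInf_triangle c c' y
  rw [mem_ballZ] at *
  omega

theorem distInf_le_dist1 (x y : Pt d) : distInf x y ≤ dist1 x y := by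
  rw [distInf_le_iff]; intro i
  exact Finset.single_le_sum (f := fun i => (x i - y i).natAbs) (fun _ _ => Nat.zero_le _)
    (Finset.mem_univ i)

theorem dist1_le (x y : Pt d) : dist1 x y ≤ d * distInf x y := by
  unfold dist1
  calc ∑ i, (x i - y i).natAbs ≤ ∑ _i : Fin d, distInf x y :=
        Finset.sum_le_sum fun i _ => natAbs_le_distInf x y i
    _ = d * distInf x y := by simp

theorem distInf_smul (l : ℕ) (x y : Pt d) :
    distInf (fun i => (l : ℤ) * x i) (fun i => (l : ℤ) * y i) = l * distInf x y := by
  unfold distInf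
  rw [Finset.apply_sup_eq_sup_comp (fun n => l * n)]
  · congr 1; funext i
    simp only [Function.comp]
    rw [← mul_sub, Int.natAbs_mul, Int.natAbs_natCast]
  · intro a b; exact Nat.mul_max_mul_left l a b |>.symm
  · simp

/-- unit vector -/
def ev (m : Fin d) : Pt d := Pi.single m 1

theorem ev_same (m : Fin d) : ev m m = 1 := by simp [ev]
theorem ev_ne {m i : Fin d} (h : i ≠ m) : ev m i = 0 := by simp [ev, h]

theorem distInf_add_ev (w : Pt d) (m : Fin d) : distInf w (w + ev m) ≤ 1 := by
  rw [distInf_le_iff]; intro i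
  by_cases h : i = m
  · subst h; simp [ev_same]
  · simp [ev_ne h]

/-- scaled lattice point -/
def sc (l : ℕ) (x : Pt d) : Pt d := fun i => (l : ℤ) * x i

theorem distInf_sc (l : ℕ) (x y : Pt d) : distInf (sc l x) (sc l y) = l * distInf x y :=
  distInf_smul l x y

theorem sc_sc (l k : ℕ) (x : Pt d) : sc l (sc k x) = sc (l * k) x := by
  funext i; simp [sc]; ring

theorem sc_one (x : Pt d) : sc 1 x = x := by
  funext i; simp [sc]

/-! ### Bichromatic edges and canonical paths -/

/-- The set of active bichromatic edges. -/
def EdgeSet (χ : Pt d → Bool) (V : Set (Pt d)) : Set (Pt d × Fin d) :=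
  {p | χ p.1 ≠ χ (p.1 + ev p.2) ∧ p.1 ∉ V ∧ p.1 + ev p.2 ∉ V}

/-- Edges with both endpoints in `W`. -/
def edgesIn (W : Set (Pt d)) : Set (Pt d × Fin d) := {p | p.1 ∈ W ∧ p.1 + ev p.2 ∈ W}

theorem line_edge_aux (χ : ℤ → Bool) (a : ℤ) (n : ℕ) (h : χ a ≠ χ (a + n)) :
    ∃ c, a ≤ c ∧ c + 1 ≤ a + n ∧ χ c ≠ χ (c + 1) := by
  induction n with
  | zero => simp at h
  | succ n ih =>
    by_cases h' : χ a = χ (a + n)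
    · refine ⟨a + n, by omega, by push_cast; omega, ?_⟩
      rw [← h']; push_cast at h; rw [add_assoc]; exact h
    · obtain ⟨c, h1, h2, h3⟩ := ih h'
      exact ⟨c, h1, by push_cast; omega, h3⟩

theorem line_edge_int (χ : ℤ → Bool) (a b : ℤ) (h : χ a ≠ χ b) :
    ∃ c, min a b ≤ c ∧ c + 1 ≤ max a b ∧ χ c ≠ χ (c + 1) := by
  rcases le_total a b with hab | hab
  · obtain ⟨n, rfl⟩ : ∃ n : ℕ, b = a + n := ⟨(b - a).toNat, by omega⟩
    obtain ⟨c, h1, h2, h3⟩ := line_edge_aux χ a n h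
    exact ⟨c, by omega, by omega, h3⟩
  · obtain ⟨n, rfl⟩ : ∃ n : ℕ, a = b + n := ⟨(a - b).toNat, by omega⟩
    obtain ⟨c, h1, h2, h3⟩ := line_edge_aux χ b n h.symm
    exact ⟨c, by omega, by omega, h3⟩

theorem line_edge (χ : Pt d → Bool) (m : Fin d) (p q : Pt d) (h : ∀ i, i ≠ m → p i = q i)
    (hne : χ p ≠ χ q) : ∃ w : Pt d, (∀ i, i ≠ m → w i = p i) ∧ min (p m) (q m) ≤ w m ∧
      w m + 1 ≤ max (p m) (q m) ∧ χ w ≠ χ (w + ev m) := by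
  have hp : p = Function.update p m (p m) := by simp
  have hq : q = Function.update p m (q m) := by
    funext i
    by_cases hi : i = m
    · subst hi; simp
    · simp [hi, h i hi]
  obtain ⟨c, h1, h2, h3⟩ := line_edge_int (fun a => χ (Function.update p m a)) (p m) (q m)
    (by rw [← hp, ← hq]; exact hne)
  refine ⟨Function.update p m c, fun i hi => by simp [hi], by simpa using h1, by simpa using h2, ?_⟩
  have : Function.update p m c + ev m = Function.update p m (c + 1) := by
    funext i
    by_cases hi : i = m
    · subst hi; simp [ev_same]
    · simp [hi, ev_ne hi]
  rw [this]; exact h3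

theorem path_edge (χ : Pt d → Bool) (W : Set (Pt d)) (x z : Pt d) (i : Fin d)
    (hW : ∀ w : Pt d, (∀ m, min (x m) (z m) ≤ w m ∧ w m ≤ max (x m) (z m)) →
      (w i = x i ∨ ∀ m, m ≠ i → w m = z m) → w ∈ W)
    (hne : χ x ≠ χ z) :
    ∃ e : Pt d × Fin d, χ e.1 ≠ χ (e.1 + ev e.2) ∧ e.1 ∈ W ∧ e.1 + ev e.2 ∈ W ∧
      (∀ m, m ≠ e.2 → e.1 m = x m ∨ e.1 m = z m) ∧
      min (x e.2) (z e.2) ≤ e.1 e.2 ∧ e.1 e.2 ≤ max (x e.2) (z e.2) := by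
  classical
  -- one step
  have step : ∀ (p q : Pt d) (m : Fin d), (∀ j, j ≠ m → p j = q j) →
      (∀ j, j ≠ m → p j = x j ∨ p j = z j) → (p m = x m) → (q m = z m) →
      ((m ≠ i ∧ p i = x i) ∨ (m = i ∧ ∀ j, j ≠ i → p j = z j)) → χ p ≠ χ q →
      ∃ e : Pt d × Fin d, χ e.1 ≠ χ (e.1 + ev e.2) ∧ e.1 ∈ W ∧ e.1 + ev e.2 ∈ W ∧
      (∀ m, m ≠ e.2 → e.1 m = x m ∨ e.1 m = z m) ∧
      min (x e.2) (z e.2) ≤ e.1 e.2 ∧ e.1 e.2 ≤ max (x e.2) (z e.2) := by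
    intro p q m hpq hp hpm hqm hc hχ
    obtain ⟨w, h1, h2, h3, h4⟩ := line_edge χ m p q hpq hχ
    rw [hpm, hqm] at h2 h3
    refine ⟨(w, m), h4, ?_, ?_, ?_, h2, by dsimp only; omega⟩
    · refine hW w ?_ ?_
      · intro j
        by_cases hj : j = m
        · subst hj; exact ⟨h2, by omega⟩
        · rw [h1 j hj]; rcases hp j hj with h | h <;> rw [h] <;> simp
      · rcases hc with ⟨hm, hh⟩ | ⟨hm, hh⟩
        · left; rw [h1 i (Ne.symm hm), hh]
        · right; intro j hj; rw [h1 j (by rw [hm]; exact hj), hh j hj]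
    · refine hW (w + ev m) ?_ ?_
      · intro j
        by_cases hj : j = m
        · subst hj; simp only [Pi.add_apply, ev_same]; omega
        · simp only [Pi.add_apply, ev_ne hj, add_zero]
          rw [h1 j hj]; rcases hp j hj with h | h <;> rw [h] <;> simp
      · rcases hc with ⟨hm, hh⟩ | ⟨hm, hh⟩
        · left; simp only [Pi.add_apply, ev_ne (Ne.symm hm), add_zero]
          rw [h1 i (Ne.symm hm), hh]
        · right; intro j hj
          have hj' : j ≠ m := by rw [hm]; exact hj
          simp only [Pi.add_apply, ev_ne hj', add_zero]
          rw [h1 j hj', hh j hj]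
    · intro j hj
      dsimp only at hj ⊢
      rw [h1 j hj]; exact hp j hj
  -- hybrids
  have key : ∀ S : Finset (Fin d), i ∉ S → χ x ≠ χ (fun m => if m ∈ S then z m else x m) →
      ∃ e : Pt d × Fin d, χ e.1 ≠ χ (e.1 + ev e.2) ∧ e.1 ∈ W ∧ e.1 + ev e.2 ∈ W ∧
      (∀ m, m ≠ e.2 → e.1 m = x m ∨ e.1 m = z m) ∧
      min (x e.2) (z e.2) ≤ e.1 e.2 ∧ e.1 e.2 ≤ max (x e.2) (z e.2) := by
    intro S
    induction S using Finset.induction_on with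
    | empty => intro _ h; simp at h
    | insert m S hm ih =>
      intro hi h
      by_cases h' : χ x = χ (fun m => if m ∈ S then z m else x m)
      · rw [h'] at h
        have hmi : m ≠ i := by rintro rfl; exact hi (Finset.mem_insert_self _ _)
        have hiS : i ∉ S := fun h => hi (Finset.mem_insert_of_mem h)
        refine step _ _ m ?_ ?_ ?_ ?_ (Or.inl ⟨hmi, ?_⟩) h
        · intro j hj; simp [hj]
        · intro j _; by_cases hjS : j ∈ S <;> simp [hjS]
        · simp [hm]
        · simp
        · simp [hiS]
      · exact ih (fun h => hi (Finset.mem_insert_of_mem h)) h'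
  by_cases h' : χ x = χ (fun m => if m ∈ Finset.univ.erase i then z m else x m)
  · rw [h'] at hne
    refine step _ _ i ?_ ?_ ?_ rfl (Or.inr ⟨rfl, ?_⟩) hne
    · intro j hj; simp [hj]
    · intro j hj; simp [hj]
    · simp
    · intro j hj; simp [hj]
  · exact key _ (by simp) h'

theorem count_pairs (Q : Finset (Pt d × Pt d)) (E : Finset (Pt d × Fin d)) (n : ℕ)
    (hQ : ∀ p ∈ Q, ∀ m, (p.1 m - p.2 m).natAbs ≤ n)
    (hE : ∀ p ∈ Q, ∃ e ∈ E, (∀ m, m ≠ e.2 → e.1 m = p.1 m ∨ e.1 m = p.2 m) ∧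
      min (p.1 e.2) (p.2 e.2) ≤ e.1 e.2 ∧ e.1 e.2 ≤ max (p.1 e.2) (p.2 e.2)) :
    Q.card ≤ 2 ^ d * (2 * n + 1) ^ (d + 1) * E.card := by
  classical
  rcases Q.eq_empty_or_nonempty with rfl | ⟨p0, hp0⟩
  · simp
  have : Nonempty (Pt d × Fin d) := ⟨(hE p0 hp0).choose⟩
  choose! f hfE hf using hE
  rw [Finset.card_eq_sum_card_fiberwise (f := f) (t := E) (fun p hp => hfE p hp)]
  have hb : ∀ e ∈ E, (Q.filter (fun p => f p = e)).card ≤ 2 ^ d * (2 * n + 1) ^ (d + 1) := by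
    intro e _
    let I : Fin d → Finset ℤ := fun m => Finset.Icc (e.1 m - n) (e.1 m + n)
    let T : Fin d → Finset (ℤ × ℤ) := fun m => if m = e.2 then I m ×ˢ I m else
      ({e.1 m} ×ˢ I m) ∪ (I m ×ˢ {e.1 m})
    have hI : ∀ m, (I m).card = 2 * n + 1 := by
      intro m; simp only [I, Int.card_Icc]; omega
    have hT : ∀ m, (T m).card ≤ 2 * (2 * n + 1) * (if m = e.2 then (2 * n + 1) else 1) := by
      intro m
      by_cases hm : m = e.2
      · simp only [T, hm, if_true, Finset.card_product, hI]
        nlinarith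
      · simp only [T, hm, if_false]
        refine (Finset.card_union_le _ _).trans ?_
        simp only [Finset.card_product, hI, Finset.card_singleton]
        omega
    calc (Q.filter (fun p => f p = e)).card ≤ (Fintype.piFinset T).card := by
          apply Finset.card_le_card_of_injOn (fun p m => (p.1 m, p.2 m))
          · intro p hp
            simp only [Finset.coe_filter, Set.mem_ofPred_eq] at hp
            obtain ⟨hpQ, rfl⟩ := hp
            simp only [Finset.mem_coe, Fintype.mem_piFinset]
            intro m
            have h1 := hQ p hpQ m
            obtain ⟨h2, h3, h4⟩ := hf p hpQ
            by_cases hm : m = (f p).2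
            · simp only [T, hm, if_true, I, Finset.mem_product, Finset.mem_Icc]
              rw [hm] at h1
              omega
            · simp only [T, hm, if_false, I, Finset.mem_product, Finset.mem_Icc, Finset.mem_union,
                Finset.mem_singleton]
              have := h2 m hm
              omega
          · intro p _ q _ h
            have h' : ∀ m, (p.1 m, p.2 m) = (q.1 m, q.2 m) := fun m => congrFun h m
            ext m
            · exact (Prod.ext_iff.1 (h' m)).1
            · exact (Prod.ext_iff.1 (h' m)).2
      _ = ∏ m, (T m).card := Fintype.card_piFinset T
      _ ≤ ∏ m, 2 * (2 * n + 1) * (if m = e.2 then (2 * n + 1) else 1) :=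
          Finset.prod_le_prod' fun m _ => hT m
      _ = 2 ^ d * (2 * n + 1) ^ (d + 1) := by
          rw [Finset.prod_mul_distrib, Finset.prod_ite_eq' Finset.univ e.2]
          simp only [Finset.prod_const, Finset.card_univ, Fintype.card_fin, Finset.mem_univ, if_true]
          rw [mul_pow, pow_succ, mul_assoc]
  calc _ ≤ ∑ e ∈ E, 2 ^ d * (2 * n + 1) ^ (d + 1) := Finset.sum_le_sum hb
    _ = _ := by simp; ring



/-! ### Cleaning one annulus -/

theorem edgesIn_finite {W : Set (Pt d)} (hW : W.Finite) : (edgesIn W).Finite := by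
  refine (hW.prod (Set.finite_univ (α := Fin d))).subset ?_
  rintro ⟨p, m⟩ h
  exact ⟨h.1, trivial⟩

theorem edgesIn_mono {W W' : Set (Pt d)} (h : W ⊆ W') : edgesIn W ⊆ edgesIn W' :=
  fun _ hp => ⟨h hp.1, h hp.2⟩

/-- The annulus. -/
def annu (c : Pt d) (s t : ℕ) : Set (Pt d) := {y | s < distInf c y ∧ distInf c y ≤ t}

theorem annu_subset (c : Pt d) (s t : ℕ) : annu c s t ⊆ ballZ c t := fun _ h => h.2

/-- Recolour a ball. -/
def recol (χ : Pt d → Bool) (c : Pt d) (s : ℕ) (b : Bool) : Pt d → Bool :=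
  fun y => if distInf c y ≤ s then b else χ y

/-- cleaning constant -/
def C1 (d : ℕ) : ℕ := 2 * d * (2 ^ d * 13 ^ (d + 1))

theorem pair_count_annu (hd : 2 ≤ d) (χ : Pt d → Bool) (V : Set (Pt d)) (c : Pt d) (t : ℕ)
    (ht : 1 ≤ t) (hV : ∀ y ∈ V, y ∉ annu c t (3 * t)) :
    ∃ z ∈ annu c t (3 * t),
      {x | x ∈ annu c t (3 * t) ∧ χ x ≠ χ z}.ncard ≤
        2 ^ d * 13 ^ (d + 1) * t * (EdgeSet χ V ∩ edgesIn (annu c t (3 * t))).ncard := by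
  classical
  set W := annu c t (3 * t) with hWdef
  have hWfin : W.Finite := (ballZ_finite c (3 * t)).subset (annu_subset _ _ _)
  have hEfin : (EdgeSet χ V ∩ edgesIn W).Finite := (edgesIn_finite hWfin).subset Set.inter_subset_right
  let Z : Finset (Pt d) := Finset.Icc (fun i => c i + t + 1) (fun i => c i + 2 * t)
  have hZ : ∀ z ∈ Z, ∀ i, c i + t + 1 ≤ z i ∧ z i ≤ c i + 2 * t := by
    intro z hz i
    rw [Finset.mem_Icc] at hz
    exact ⟨hz.1 i, hz.2 i⟩
  have hZc : Z.card = t ^ d := by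
    simp only [Z, Pi.card_Icc, Int.card_Icc]
    rw [Finset.prod_congr rfl (g := fun _ => t)]
    · simp
    · intro i _; omega
  have hdpos : 0 < d := by omega
  let i0 : Fin d := ⟨0, by omega⟩
  let i1 : Fin d := ⟨1, by omega⟩
  have h01 : i0 ≠ i1 := by simp [i0, i1]
  have hZW : ∀ z ∈ Z, z ∈ W := by
    intro z hz
    refine ⟨?_, ?_⟩
    · have := natAbs_le_distInf c z i0
      have := hZ z hz i0
      omega
    · rw [distInf_le_iff]; intro i
      have := hZ z hz i
      omega
  let WF := hWfin.toFinset
  let Q : Finset (Pt d × Pt d) := (WF ×ˢ Z).filter (fun p => χ p.1 ≠ χ p.2)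
  have hQ := count_pairs Q hEfin.toFinset (6 * t) (by
    rintro ⟨x, z⟩ hp m
    simp only [Q, Finset.mem_filter, Finset.mem_product] at hp
    have h1 : x ∈ W := by simpa [WF] using hp.1.1
    have h2 := (distInf_le_iff.1 h1.2) m
    have h3 := hZ z hp.1.2 m
    dsimp only
    omega) (by
    rintro ⟨x, z⟩ hp
    simp only [Q, Finset.mem_filter, Finset.mem_product] at hp
    have h1 : x ∈ W := by simpa [WF] using hp.1.1
    have h2 := hZ z hp.1.2
    have h4 := distInf_le_iff.1 h1.2
    obtain ⟨i, hi⟩ : ∃ i, t < (c i - x i).natAbs := by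
      by_contra hcon
      push Not at hcon
      have := distInf_le_iff.2 hcon
      have := h1.1
      omega
    obtain ⟨e, he1, he2, he3, he4⟩ := path_edge χ W x z i (by
      intro w hw1 hw2
      refine ⟨?_, ?_⟩
      · rcases hw2 with hw2 | hw2
        · have := natAbs_le_distInf c w i
          rw [hw2] at this
          omega
        · obtain ⟨j, hj⟩ : ∃ j : Fin d, j ≠ i := by
            by_cases hh : i0 = i
            · exact ⟨i1, fun h => h01 (by rw [hh, h])⟩
            · exact ⟨i0, hh⟩
          have h5 := natAbs_le_distInf c w j
          rw [hw2 j hj] at h5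
          have := h2 j
          omega
      · rw [distInf_le_iff]; intro m
        have := hw1 m
        have := h2 m
        have := h4 m
        omega) hp.2
    refine ⟨e, ?_, he4⟩
    rw [Set.Finite.mem_toFinset]
    exact ⟨⟨he1, fun h => hV _ h he2, fun h => hV _ h he3⟩, he2, he3⟩)
  have hZne : Z.Nonempty := by
    rw [← Finset.card_pos, hZc]; positivity
  obtain ⟨z, hz, hmin⟩ := Finset.exists_min_image Z (fun z => (WF.filter (fun x => χ x ≠ χ z)).card) hZne
  refine ⟨z, hZW z hz, ?_⟩
  have hset : {x | x ∈ W ∧ χ x ≠ χ z} = ((WF.filter (fun x => χ x ≠ χ z) : Finset (Pt d)) : Set (Pt d)) := by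
    ext x; simp [WF]
  rw [hset, Set.ncard_coe_finset, Set.ncard_eq_toFinset_card _ hEfin]
  set M := (WF.filter (fun x => χ x ≠ χ z)).card
  set E := hEfin.toFinset.card
  have hQc : Q.card = ∑ z ∈ Z, (WF.filter (fun x => χ x ≠ χ z)).card := by
    simp only [Q, Finset.card_filter, Finset.sum_product_right]
  have h1 : t ^ d * M ≤ Q.card := by
    rw [hQc, ← hZc, ← smul_eq_mul]
    exact Finset.card_nsmul_le_sum _ _ _ hmin
  have h2 : 2 ^ d * (2 * (6 * t) + 1) ^ (d + 1) * E ≤ 2 ^ d * (13 * t) ^ (d + 1) * E := by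
    gcongr
    omega
  have h3 : t ^ d * M ≤ t ^ d * (2 ^ d * 13 ^ (d + 1) * t * E) := by
    refine h1.trans (hQ.trans (h2.trans (le_of_eq ?_)))
    rw [mul_pow, pow_succ t d]; ring
  exact Nat.le_of_mul_le_mul_left h3 (by positivity)

theorem clean1 (hd : 2 ≤ d) (χ : Pt d → Bool) (V : Set (Pt d)) (c : Pt d) (t : ℕ)
    (ht : 1 ≤ t) (hV : ∀ y ∈ V, y ∉ annu c t (3 * t)) :
    ∃ (s : ℕ) (b : Bool) (N : Finset (Pt d × Fin d)), t ≤ s ∧ s < 3 * t ∧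
      (∃ z ∈ annu c t (3 * t), χ z = b) ∧
      (N : Set (Pt d × Fin d)) ⊆ edgesIn (ballZ c (3 * t)) ∧
      EdgeSet (recol χ c s b) (V \ ballZ c s) ⊆ EdgeSet χ V ∪ N ∧
      N.card ≤ C1 d * (EdgeSet χ V ∩ edgesIn (annu c t (3 * t))).ncard := by
  classical
  obtain ⟨z, hz, hcount⟩ := pair_count_annu hd χ V c t ht hV
  set E := (EdgeSet χ V ∩ edgesIn (annu c t (3 * t))).ncard
  let BF := (ballF c (3 * t)).filter (fun x => t < distInf c x ∧ χ x ≠ χ z)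
  have hset : {x | x ∈ annu c t (3 * t) ∧ χ x ≠ χ z} = (BF : Set (Pt d)) := by
    ext x; simp [BF, annu, mem_ballF]; tauto
  rw [hset, Set.ncard_coe_finset] at hcount
  let sh : ℕ → Finset (Pt d) := fun s => BF.filter (fun x => distInf c x = s + 1)
  have hsum : ∑ s ∈ Finset.Ico t (3 * t), (sh s).card = BF.card := by
    rw [Finset.card_eq_sum_card_fiberwise (f := fun x => distInf c x - 1) (t := Finset.Ico t (3 * t))]
    · refine Finset.sum_congr rfl fun s hs => ?_
      congr 1
      apply Finset.filter_congr
      intro x hx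
      simp only [BF, Finset.mem_filter, mem_ballF] at hx
      omega
    · intro x hx
      simp only [BF, Finset.coe_filter, mem_ballF, Set.mem_ofPred_eq] at hx
      simp only [Finset.coe_Ico, Set.mem_Ico]
      omega
  obtain ⟨s, hs, hmin⟩ := Finset.exists_min_image (Finset.Ico t (3 * t)) (fun s => (sh s).card)
    ⟨t, by simp; omega⟩
  rw [Finset.mem_Ico] at hs
  have hshell : (sh s).card ≤ 2 ^ d * 13 ^ (d + 1) * E := by
    have h1 : (2 * t) * (sh s).card ≤ BF.card := by
      rw [← hsum, ← smul_eq_mul]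
      have : 2 * t = (Finset.Ico t (3 * t)).card := by simp; omega
      rw [this]
      exact Finset.card_nsmul_le_sum _ _ _ hmin
    have h2 : t * (sh s).card ≤ t * (2 ^ d * 13 ^ (d + 1) * E) := by
      calc t * (sh s).card ≤ 2 * t * (sh s).card := by nlinarith [Nat.zero_le (t * (sh s).card)]
        _ ≤ _ := h1.trans hcount
        _ = _ := by ring
    exact Nat.le_of_mul_le_mul_left h2 ht
  let N : Finset (Pt d × Fin d) :=
    ((sh s ×ˢ Finset.univ).filter (fun p => distInf c (p.1 + ev p.2) ≤ s)) ∪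
    ((sh s ×ˢ Finset.univ).image (fun p => (p.1 - ev p.2, p.2))).filter (fun p => distInf c p.1 ≤ s)
  have hshmem : ∀ x, x ∈ sh s ↔ distInf c x = s + 1 ∧ χ x ≠ χ z := by
    intro x
    simp only [sh, BF, Finset.mem_filter, mem_ballF]
    constructor
    · tauto
    · rintro ⟨h1, h2⟩
      exact ⟨⟨by omega, by omega, h2⟩, h1⟩
  refine ⟨s, χ z, N, hs.1, hs.2, ⟨z, hz, rfl⟩, ?_, ?_, ?_⟩
  · rintro ⟨p, m⟩ hp
    simp only [N, Finset.coe_union, Set.mem_union, Finset.mem_coe, Finset.mem_filter,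
      Finset.mem_product, Finset.mem_univ, and_true, Finset.mem_image, Prod.exists, Prod.mk.injEq,
      hshmem] at hp
    rcases hp with ⟨⟨h1, _⟩, h2⟩ | ⟨⟨q, m', h1, rfl, rfl⟩, h2⟩
    · refine ⟨?_, ?_⟩ <;> rw [mem_ballZ] <;> dsimp only <;> omega
    · refine ⟨?_, ?_⟩ <;> rw [mem_ballZ] <;> dsimp only
      · omega
      · rw [sub_add_cancel]; omega
  · rintro ⟨p, m⟩ ⟨h1, h2, h3⟩
    dsimp only at h1 h2 h3
    have ha := distInf_triangle c p (p + ev m)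
    have hb := distInf_triangle c (p + ev m) p
    have hc := distInf_add_ev p m
    rw [distInf_comm (p + ev m) p] at hb
    have hnV : ∀ y, y ∉ V \ ballZ c s → ¬ distInf c y ≤ s → y ∉ V := by
      intro y hy hd hyV
      exact hy ⟨hyV, hd⟩
    by_cases hp : distInf c p ≤ s <;> by_cases hq : distInf c (p + ev m) ≤ s
    · simp [recol, hp, hq] at h1
    · right
      simp only [recol, hp, hq, if_true, if_false] at h1
      simp only [N, Finset.coe_union, Set.mem_union, Finset.mem_coe, Finset.mem_filter]
      right
      refine ⟨?_, hp⟩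
      rw [Finset.mem_image]
      refine ⟨(p + ev m, m), ?_, by simp⟩
      simp only [Finset.mem_product, Finset.mem_univ, and_true, hshmem]
      exact ⟨by omega, fun h => h1 h.symm⟩
    · right
      simp only [recol, hp, hq, if_true, if_false] at h1
      simp only [N, Finset.coe_union, Set.mem_union, Finset.mem_coe, Finset.mem_filter]
      left
      refine ⟨?_, hq⟩
      simp only [Finset.mem_product, Finset.mem_univ, and_true, hshmem]
      exact ⟨by omega, h1⟩
    · left
      simp only [recol, hp, hq, if_false] at h1
      exact ⟨h1, hnV _ h2 hp, hnV _ h3 hq⟩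
  · have hc1 : (sh s ×ˢ (Finset.univ : Finset (Fin d))).card = (sh s).card * d := by
      simp [Finset.card_product]
    calc N.card ≤ (sh s).card * d + (sh s).card * d := by
          refine (Finset.card_union_le _ _).trans (add_le_add ?_ ?_)
          · exact (Finset.card_filter_le _ _).trans hc1.le
          · exact (Finset.card_filter_le _ _).trans (Finset.card_image_le.trans hc1.le)
      _ = 2 * d * (sh s).card := by ring
      _ ≤ 2 * d * (2 ^ d * 13 ^ (d + 1) * E) := by gcongr
      _ = C1 d * E := by rw [C1]; ring



/-! ### Cleaning a tile -/

theorem clean2 (hd : 2 ≤ d) (χ : Pt d → Bool) (V : Set (Pt d)) (c c' : Pt d) (t m : ℕ)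
    (ht : 1 ≤ t) (hm : 4 ≤ m)
    (hV : ∀ y ∈ V, distInf c y ≤ 3 ^ m * t → distInf c y ≤ t ∨ distInf c' y ≤ t) :
    ∃ (s : ℕ) (b : Bool) (N : Finset (Pt d × Fin d)), t ≤ s ∧ s ≤ 3 ^ m * t ∧
      (∃ z, z ∉ V ∧ distInf c z ≤ 3 ^ m * t ∧ χ z = b) ∧
      (N : Set (Pt d × Fin d)) ⊆ edgesIn (ballZ c (3 ^ m * t)) ∧
      EdgeSet (recol χ c s b) (V \ ballZ c s) ⊆ EdgeSet χ V ∪ N ∧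
      (m - 3) * N.card ≤ C1 d * (EdgeSet χ V ∩ edgesIn (ballZ c (3 ^ m * t))).ncard := by
  classical
  have hpow : ∀ i j : ℕ, i ≤ j → 3 ^ i * t ≤ 3 ^ j * t := fun i j h =>
    Nat.mul_le_mul_right _ (Nat.pow_le_pow_right (by norm_num) h)
  have hself : ∀ i, t ≤ 3 ^ i * t := fun i => Nat.le_mul_of_pos_left _ (by positivity)
  let an : ℕ → Set (Pt d) := fun i => annu c (3 ^ i * t) (3 * (3 ^ i * t))
  have hsucc : ∀ i, 3 * (3 ^ i * t) = 3 ^ (i + 1) * t := fun i => by ring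
  let hit : ℕ → Prop := fun i => ∃ y ∈ an i, distInf c' y ≤ t
  have hhit : ∀ i j, hit i → hit j → j < i + 3 := by
    rintro i j ⟨y, hy, hy'⟩ ⟨z, hz, hz'⟩
    by_contra hcon
    push Not at hcon
    have h1 := hpow _ _ hcon
    have h2 := distInf_triangle c c' z
    have h3 := distInf_triangle c y c'
    rw [distInf_comm y c'] at h3
    have h4 := hy.2
    have h5 := hz.1
    have h6 : 3 ^ (i + 3) * t = 9 * (3 * (3 ^ i * t)) := by ring
    have := hself i
    omega
  let I := (Finset.range m).filter (fun i => ¬ hit i)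
  have hIcard : m - 3 ≤ I.card := by
    have h1 : ((Finset.range m).filter (fun i => hit i)).card ≤ 3 := by
      rcases ((Finset.range m).filter (fun i => hit i)).eq_empty_or_nonempty with h | h
      · rw [h]; simp
      · obtain ⟨i, hi, hmin⟩ := Finset.exists_min_image _ (fun i => i) h
        have hsub : ((Finset.range m).filter (fun i => hit i)) ⊆ Finset.Ico i (i + 3) := by
          intro j hj
          rw [Finset.mem_Ico]
          exact ⟨hmin j hj, hhit i j (Finset.mem_filter.1 hi).2 (Finset.mem_filter.1 hj).2⟩
        refine (Finset.card_le_card hsub).trans ?_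
        simp
    have h2 := Finset.card_filter_add_card_filter_not (s := Finset.range m) (fun i => hit i)
    rw [Finset.card_range] at h2
    change _ + I.card = m at h2
    omega
  have hballfin : (EdgeSet χ V ∩ edgesIn (ballZ c (3 ^ m * t))).Finite :=
    (edgesIn_finite (ballZ_finite _ _)).subset Set.inter_subset_right
  let ET := hballfin.toFinset
  let Ei : ℕ → Finset (Pt d × Fin d) := fun i => ET.filter (fun p => p ∈ edgesIn (an i))
  have hanball : ∀ i < m, an i ⊆ ballZ c (3 ^ m * t) := by
    intro i hi y hy
    have h1 := hy.2
    rw [hsucc] at h1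
    exact h1.trans (hpow _ _ hi)
  have hEi : ∀ i < m, (EdgeSet χ V ∩ edgesIn (an i)) = (Ei i : Set _) := by
    intro i hi
    ext p
    simp only [Ei, ET, Finset.coe_filter, Set.Finite.mem_toFinset, Set.mem_inter_iff,
      Set.mem_ofPred_eq]
    constructor
    · rintro ⟨h1, h2⟩; exact ⟨⟨h1, edgesIn_mono (hanball i hi) h2⟩, h2⟩
    · rintro ⟨⟨h1, _⟩, h2⟩; exact ⟨h1, h2⟩
  have hdisj : ∀ i ∈ I, ∀ j ∈ I, i ≠ j → Disjoint (Ei i) (Ei j) := by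
    have key : ∀ i j, i < j → Disjoint (Ei i) (Ei j) := by
      intro i j hij
      rw [Finset.disjoint_left]
      intro p hp hq
      have h1 := (Finset.mem_filter.1 hp).2.1.2
      have h2 := (Finset.mem_filter.1 hq).2.1.1
      rw [hsucc] at h1
      have := hpow (i + 1) j hij
      omega
    intro i _ j _ hij
    rcases lt_or_gt_of_ne hij with h | h
    · exact key i j h
    · exact (key j i h).symm
  have hsum : ∑ i ∈ I, (Ei i).card ≤ ET.card := by
    rw [← Finset.card_biUnion hdisj]
    apply Finset.card_le_card
    intro p hp
    rw [Finset.mem_biUnion] at hp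
    obtain ⟨i, _, hp⟩ := hp
    exact (Finset.mem_filter.1 hp).1
  have hIne : I.Nonempty := by rw [← Finset.card_pos]; omega
  obtain ⟨i, hi, hmin⟩ := Finset.exists_min_image I (fun i => (Ei i).card) hIne
  have him : i < m := Finset.mem_range.1 (Finset.mem_filter.1 hi).1
  have hnohit : ¬ hit i := (Finset.mem_filter.1 hi).2
  have hVan : ∀ y ∈ V, y ∉ an i := by
    intro y hy hya
    rcases hV y hy (hanball i him hya) with h | h
    · have := hya.1; have := hself i; omega
    · exact hnohit ⟨y, hya, h⟩
  obtain ⟨s, b, N, h1, h2, ⟨z, hz, hzb⟩, h4, h5, h6⟩ := clean1 hd χ V c (3 ^ i * t)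
    (ht.trans (hself i)) hVan
  rw [hsucc] at h2 h4
  have hle := hpow _ _ (show i + 1 ≤ m from him)
  refine ⟨s, b, N, (hself i).trans h1, by omega, ⟨z, fun h => hVan z h hz, hanball i him hz, hzb⟩,
    h4.trans (edgesIn_mono (ballZ_subset (by simpa using hle))), h5, ?_⟩
  rw [hEi i him, Set.ncard_coe_finset] at h6
  rw [Set.ncard_eq_toFinset_card _ hballfin]
  have h7 : (m - 3) * (Ei i).card ≤ ET.card := by
    refine le_trans ?_ hsum
    calc (m - 3) * (Ei i).card ≤ I.card * (Ei i).card := Nat.mul_le_mul_right _ hIcard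
      _ ≤ _ := by rw [← smul_eq_mul]; exact Finset.card_nsmul_le_sum _ _ _ hmin
  calc (m - 3) * N.card ≤ (m - 3) * (C1 d * (Ei i).card) := Nat.mul_le_mul_left _ h6
    _ = C1 d * ((m - 3) * (Ei i).card) := by ring
    _ ≤ C1 d * ET.card := Nat.mul_le_mul_left _ h7

/-- A local modification of a two-colouring inside `D`. -/
structure Trans (χ : Pt d → Bool) (V : Set (Pt d)) (χ' : Pt d → Bool) (V' : Set (Pt d))
    (D : Set (Pt d)) (N : Finset (Pt d × Fin d)) : Prop where
  sub : V' ⊆ V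
  newin : (N : Set (Pt d × Fin d)) ⊆ edgesIn D
  edge : EdgeSet χ' V' ⊆ EdgeSet χ V ∪ N
  loc : ∀ y, y ∉ V' → ∃ z, z ∉ V ∧ χ' y = χ z ∧ (z = y ∨ (y ∈ D ∧ z ∈ D))

theorem Trans.refl (χ : Pt d → Bool) (V : Set (Pt d)) (D : Set (Pt d)) : Trans χ V χ V D ∅ :=
  ⟨le_rfl, by simp, by simp, fun y hy => ⟨y, hy, rfl, Or.inl rfl⟩⟩

theorem Trans.comp [DecidableEq (Pt d × Fin d)] {χ χ₁ χ₂ : Pt d → Bool} {V V₁ V₂ D : Set (Pt d)}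
    {N N' : Finset (Pt d × Fin d)}
    (h : Trans χ V χ₁ V₁ D N) (h' : Trans χ₁ V₁ χ₂ V₂ D N') : Trans χ V χ₂ V₂ D (N ∪ N') := by
  refine ⟨h'.sub.trans h.sub, ?_, ?_, ?_⟩
  · rw [Finset.coe_union]; exact Set.union_subset h.newin h'.newin
  · rw [Finset.coe_union]
    intro p hp
    rcases h'.edge hp with hp | hp
    · rcases h.edge hp with hp | hp
      · exact Or.inl hp
      · exact Or.inr (Or.inl hp)
    · exact Or.inr (Or.inr hp)
  · intro y hy
    obtain ⟨z, hz, e, hc⟩ := h'.loc y hy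
    obtain ⟨w, hw, e', hc'⟩ := h.loc z hz
    refine ⟨w, hw, e.trans e', ?_⟩
    rcases hc with rfl | hc
    · exact hc'
    · rcases hc' with rfl | hc'
      · exact Or.inr hc
      · exact Or.inr ⟨hc.1, hc'.2⟩

theorem tstep (hd : 2 ≤ d) (χ : Pt d → Bool) (V : Set (Pt d)) (o c c' : Pt d) (t m ρ : ℕ)
    (ht : 1 ≤ t) (hm : 4 ≤ m) (hρ : 3 ^ m * t + t ≤ ρ)
    (hV : ∀ y ∈ V, distInf o y ≤ 2 * ρ → distInf c y ≤ t ∨ distInf c' y ≤ t) :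
    ∃ (χ' : Pt d → Bool) (V' : Set (Pt d)) (N : Finset (Pt d × Fin d)),
      Trans χ V χ' V' (ballZ o (2 * ρ)) N ∧
      (∀ y ∈ V', distInf o y ≤ ρ → ¬ distInf c y ≤ t) ∧
      (m - 3) * N.card ≤ C1 d * (EdgeSet χ V ∩ edgesIn (ballZ o (2 * ρ))).ncard := by
  by_cases hmeet : ∃ y, distInf o y ≤ ρ ∧ distInf c y ≤ t
  · obtain ⟨y0, h1, h2⟩ := hmeet
    have hoc : distInf o c ≤ ρ + t := by
      have := distInf_triangle o y0 c
      rw [distInf_comm y0 c] at this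
      omega
    have hsub : ballZ c (3 ^ m * t) ⊆ ballZ o (2 * ρ) := ballZ_subset (by omega)
    obtain ⟨s, b, N, hs1, hs2, ⟨z, hz, hz2, hzb⟩, h3, h4, h5⟩ := clean2 hd χ V c c' t m ht hm
      (fun y hy hyc => hV y hy (hsub hyc))
    refine ⟨recol χ c s b, V \ ballZ c s, N, ⟨Set.sdiff_subset, h3.trans (edgesIn_mono hsub), h4, ?_⟩,
      ?_, h5.trans ?_⟩
    · intro y hy
      by_cases hys : distInf c y ≤ s
      · refine ⟨z, hz, by simp [recol, hys, hzb], Or.inr ⟨hsub ?_, hsub hz2⟩⟩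
        exact le_trans hys hs2
      · refine ⟨y, fun h => hy ⟨h, hys⟩, by simp [recol, hys], Or.inl rfl⟩
    · intro y hy _ hyt
      exact hy.2 (le_trans hyt hs1)
    · refine Nat.mul_le_mul_left _ (Set.ncard_le_ncard ?_ ?_)
      · exact Set.inter_subset_inter_right _ (edgesIn_mono hsub)
      · exact (edgesIn_finite (ballZ_finite _ _)).subset Set.inter_subset_right
  · push Not at hmeet
    refine ⟨χ, V, ∅, Trans.refl _ _ _, fun y _ h => not_le.2 (hmeet y h), by simp⟩

/-- tile cleaning constant -/
def C2 (d : ℕ) : ℕ := C1 d + C1 d * (1 + C1 d)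

theorem tile_clean (hd : 2 ≤ d) (χ : Pt d → Bool) (V : Set (Pt d)) (o c c' : Pt d) (t m ρ : ℕ)
    (ht : 1 ≤ t) (hm : 4 ≤ m) (hρ : 3 ^ m * t + t ≤ ρ)
    (hV : ∀ y ∈ V, distInf o y ≤ 2 * ρ → distInf c y ≤ t ∨ distInf c' y ≤ t) :
    ∃ (χ' : Pt d → Bool) (V' : Set (Pt d)) (N : Finset (Pt d × Fin d)),
      Trans χ V χ' V' (ballZ o (2 * ρ)) N ∧
      (∀ y ∈ V', ¬ distInf o y ≤ ρ) ∧
      (m - 3) * N.card ≤ C2 d * (EdgeSet χ V ∩ edgesIn (ballZ o (2 * ρ))).ncard := by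
  classical
  obtain ⟨χ₁, V₁, N₁, T₁, h1, e1⟩ := tstep hd χ V o c c' t m ρ ht hm hρ hV
  obtain ⟨χ₂, V₂, N₂, T₂, h2, e2⟩ := tstep hd χ₁ V₁ o c' c t m ρ ht hm hρ
    (fun y hy ho => (hV y (T₁.sub hy) ho).symm)
  refine ⟨χ₂, V₂, N₁ ∪ N₂, T₁.comp T₂, ?_, ?_⟩
  · intro y hy ho
    rcases hV y (T₁.sub (T₂.sub hy)) (by omega) with h | h
    · exact h1 y (T₂.sub hy) ho h
    · exact h2 y hy ho h
  · set E := (EdgeSet χ V ∩ edgesIn (ballZ o (2 * ρ))).ncard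
    have hE1 : (EdgeSet χ₁ V₁ ∩ edgesIn (ballZ o (2 * ρ))).ncard ≤ E + N₁.card := by
      have : EdgeSet χ₁ V₁ ∩ edgesIn (ballZ o (2 * ρ)) ⊆
          (EdgeSet χ V ∩ edgesIn (ballZ o (2 * ρ))) ∪ N₁ := by
        rintro p ⟨hp, hp'⟩
        rcases T₁.edge hp with h | h
        · exact Or.inl ⟨h, hp'⟩
        · exact Or.inr h
      have hfin : (EdgeSet χ V ∩ edgesIn (ballZ o (2 * ρ))).Finite :=
        (edgesIn_finite (ballZ_finite _ _)).subset Set.inter_subset_right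
      refine (Set.ncard_le_ncard this (hfin.union N₁.finite_toSet)).trans ?_
      refine (Set.ncard_union_le _ _).trans ?_
      rw [Set.ncard_coe_finset]
    have hN1 : N₁.card ≤ C1 d * E := by
      refine le_trans ?_ e1
      exact Nat.le_mul_of_pos_left _ (by omega)
    calc (m - 3) * (N₁ ∪ N₂).card ≤ (m - 3) * (N₁.card + N₂.card) :=
          Nat.mul_le_mul_left _ (Finset.card_union_le _ _)
      _ = (m - 3) * N₁.card + (m - 3) * N₂.card := by ring
      _ ≤ C1 d * E + C1 d * (E + C1 d * E) := by
          refine add_le_add e1 (e2.trans (Nat.mul_le_mul_left _ (hE1.trans (by omega))))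
      _ = C2 d * E := by rw [C2]; ring

/-! ### Colour passes -/

theorem color_pass (hd : 2 ≤ d) (χ : Pt d → Bool) (V : Set (Pt d)) (t m ρ : ℕ)
    (ht : 1 ≤ t) (hm : 4 ≤ m) (hρ : 3 ^ m * t + t ≤ ρ) (𝒯 : Finset (Pt d))
    (hsep : ∀ o ∈ 𝒯, ∀ o' ∈ 𝒯, o ≠ o' → 4 * ρ < distInf o o')
    (hgood : ∀ o ∈ 𝒯, ∃ c c', ∀ y ∈ V, distInf o y ≤ 2 * ρ → distInf c y ≤ t ∨ distInf c' y ≤ t) :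
    ∃ (χ' : Pt d → Bool) (V' : Set (Pt d)) (N : Finset (Pt d × Fin d)),
      V' ⊆ V ∧ (∀ o ∈ 𝒯, ∀ y ∈ V', ¬ distInf o y ≤ ρ) ∧
      (N : Set (Pt d × Fin d)) ⊆ ⋃ o ∈ 𝒯, edgesIn (ballZ o (2 * ρ)) ∧
      EdgeSet χ' V' ⊆ EdgeSet χ V ∪ N ∧
      (m - 3) * N.card ≤ C2 d * (EdgeSet χ V ∩ ⋃ o ∈ 𝒯, edgesIn (ballZ o (2 * ρ))).ncard ∧
      (∀ y, y ∉ V' → ∃ z, z ∉ V ∧ χ' y = χ z ∧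
        (z = y ∨ ∃ o ∈ 𝒯, y ∈ ballZ o (2 * ρ) ∧ z ∈ ballZ o (2 * ρ))) := by
  classical
  induction 𝒯 using Finset.induction_on with
  | empty =>
    exact ⟨χ, V, ∅, le_rfl, by simp, by simp, by simp, by simp, fun y hy => ⟨y, hy, rfl, Or.inl rfl⟩⟩
  | insert o 𝒯 ho ih =>
    obtain ⟨χ₁, V₁, N₁, a1, a2, a3, a4, a5, a6⟩ := ih
      (fun p hp q hq => hsep p (Finset.mem_insert_of_mem hp) q (Finset.mem_insert_of_mem hq))
      (fun p hp => hgood p (Finset.mem_insert_of_mem hp))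
    obtain ⟨c, c', hcc⟩ := hgood o (Finset.mem_insert_self _ _)
    obtain ⟨χ₂, V₂, N₂, T, b2, b3⟩ := tile_clean hd χ₁ V₁ o c c' t m ρ ht hm hρ
      (fun y hy => hcc y (a1 hy))
    have hdis : ∀ o' ∈ 𝒯, ∀ y, y ∈ ballZ o (2 * ρ) → y ∈ ballZ o' (2 * ρ) → False := by
      intro o' ho' y h1 h2
      have h3 := hsep o (Finset.mem_insert_self _ _) o' (Finset.mem_insert_of_mem ho')
        (by rintro rfl; exact ho ho')
      have h4 := distInf_triangle o y o'
      rw [distInf_comm y o'] at h4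
      rw [mem_ballZ] at h1 h2
      omega
    have hfinU : ∀ S : Finset (Pt d), (⋃ o ∈ S, edgesIn (ballZ o (2 * ρ))).Finite := by
      intro S
      exact S.finite_toSet.biUnion (fun o _ => edgesIn_finite (ballZ_finite _ _))
    refine ⟨χ₂, V₂, N₁ ∪ N₂, T.sub.trans a1, ?_, ?_, ?_, ?_, ?_⟩
    · intro o' ho' y hy
      rw [Finset.mem_insert] at ho'
      rcases ho' with rfl | ho'
      · exact b2 y hy
      · exact a2 o' ho' y (T.sub hy)
    · rw [Finset.coe_union, Finset.set_biUnion_insert]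
      refine Set.union_subset (a3.trans Set.subset_union_right) (T.newin.trans Set.subset_union_left)
    · rw [Finset.coe_union]
      intro p hp
      rcases T.edge hp with hp | hp
      · rcases a4 hp with hp | hp
        · exact Or.inl hp
        · exact Or.inr (Or.inl hp)
      · exact Or.inr (Or.inr hp)
    · have hsub : EdgeSet χ₁ V₁ ∩ edgesIn (ballZ o (2 * ρ)) ⊆
          EdgeSet χ V ∩ edgesIn (ballZ o (2 * ρ)) := by
        rintro p ⟨hp, hp'⟩
        refine ⟨?_, hp'⟩
        rcases a4 hp with h | h
        · exact h
        · exfalso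
          have := a3 h
          simp only [Set.mem_iUnion] at this
          obtain ⟨o', ho', h'⟩ := this
          exact hdis o' ho' p.1 hp'.1 h'.1
      have hle := Set.ncard_le_ncard hsub
        ((edgesIn_finite (ballZ_finite _ _)).subset Set.inter_subset_right)
      have hdisj : Disjoint (EdgeSet χ V ∩ ⋃ o ∈ 𝒯, edgesIn (ballZ o (2 * ρ)))
          (EdgeSet χ V ∩ edgesIn (ballZ o (2 * ρ))) := by
        rw [Set.disjoint_left]
        rintro p ⟨_, hp⟩ ⟨_, hp'⟩
        simp only [Set.mem_iUnion] at hp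
        obtain ⟨o', ho', h'⟩ := hp
        exact hdis o' ho' p.1 hp'.1 h'.1
      have hun : (EdgeSet χ V ∩ ⋃ o' ∈ insert o 𝒯, edgesIn (ballZ o' (2 * ρ))) =
          (EdgeSet χ V ∩ ⋃ o ∈ 𝒯, edgesIn (ballZ o (2 * ρ))) ∪
          (EdgeSet χ V ∩ edgesIn (ballZ o (2 * ρ))) := by
        rw [Finset.set_biUnion_insert, Set.inter_union_distrib_left, Set.union_comm]
      rw [hun, Set.ncard_union_eq hdisj ((hfinU _).subset Set.inter_subset_right)
        ((edgesIn_finite (ballZ_finite _ _)).subset Set.inter_subset_right)]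
      calc (m - 3) * (N₁ ∪ N₂).card ≤ (m - 3) * (N₁.card + N₂.card) :=
            Nat.mul_le_mul_left _ (Finset.card_union_le _ _)
        _ = (m - 3) * N₁.card + (m - 3) * N₂.card := by ring
        _ ≤ _ := by
            rw [mul_add]
            exact add_le_add a5 (b3.trans (Nat.mul_le_mul_left _ hle))
    · intro y hy
      obtain ⟨z, hz, e, hc⟩ := T.loc y hy
      obtain ⟨w, hw, e', hc'⟩ := a6 z hz
      refine ⟨w, hw, e.trans e', ?_⟩
      rcases hc with rfl | hc
      · rcases hc' with h | ⟨o', ho', h⟩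
        · exact Or.inl h
        · exact Or.inr ⟨o', Finset.mem_insert_of_mem ho', h⟩
      · rcases hc' with rfl | ⟨o', ho', h⟩
        · exact Or.inr ⟨o, Finset.mem_insert_self _ _, hc⟩
        · exact (hdis o' ho' z hc.2 h.1).elim

theorem color_passes (hd : 2 ≤ d) (t m ρ : ℕ)
    (ht : 1 ≤ t) (hm : 4 ≤ m) (hρ : 3 ^ m * t + t ≤ ρ) (Ls : List (Finset (Pt d)))
    (χ : Pt d → Bool) (V : Set (Pt d)) (hfin : (EdgeSet χ V).Finite)
    (hsep : ∀ 𝒯 ∈ Ls, ∀ o ∈ 𝒯, ∀ o' ∈ 𝒯, o ≠ o' → 4 * ρ < distInf o o')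
    (hgood : ∀ 𝒯 ∈ Ls, ∀ o ∈ 𝒯, ∃ c c', ∀ y ∈ V, distInf o y ≤ 2 * ρ →
      distInf c y ≤ t ∨ distInf c' y ≤ t) :
    ∃ (χ' : Pt d → Bool) (V' : Set (Pt d)),
      V' ⊆ V ∧ (∀ 𝒯 ∈ Ls, ∀ o ∈ 𝒯, ∀ y ∈ V', ¬ distInf o y ≤ ρ) ∧
      (EdgeSet χ' V').Finite ∧
      (m - 3) ^ Ls.length * (EdgeSet χ' V').ncard ≤
        (m - 3 + C2 d) ^ Ls.length * (EdgeSet χ V).ncard ∧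
      (∀ y, y ∉ V' → ∃ z, z ∉ V ∧ χ' y = χ z ∧ distInf y z ≤ 4 * ρ * Ls.length) := by
  induction Ls generalizing χ V with
  | nil => exact ⟨χ, V, le_rfl, by simp, hfin, by simp, fun y hy => ⟨y, hy, rfl, by simp⟩⟩
  | cons 𝒯 Ls ih =>
    obtain ⟨χ₁, V₁, N₁, a1, a2, a3, a4, a5, a6⟩ := color_pass hd χ V t m ρ ht hm hρ 𝒯
      (hsep 𝒯 (by simp)) (hgood 𝒯 (by simp))
    have hfin1 : (EdgeSet χ₁ V₁).Finite := (hfin.union N₁.finite_toSet).subset a4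
    obtain ⟨χ₂, V₂, b1, b2, b3, b4, b5⟩ := ih χ₁ V₁ hfin1
      (fun T hT => hsep T (List.mem_cons_of_mem _ hT))
      (fun T hT o ho => by
        obtain ⟨c, c', h⟩ := hgood T (List.mem_cons_of_mem _ hT) o ho
        exact ⟨c, c', fun y hy => h y (a1 hy)⟩)
    refine ⟨χ₂, V₂, b1.trans a1, ?_, b3, ?_, ?_⟩
    · intro T hT o ho y hy
      rw [List.mem_cons] at hT
      rcases hT with rfl | hT
      · exact a2 o ho y (b1 hy)
      · exact b2 T hT o ho y hy
    · have h1 : (EdgeSet χ₁ V₁).ncard ≤ (EdgeSet χ V).ncard + N₁.card := by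
        refine (Set.ncard_le_ncard a4 (hfin.union N₁.finite_toSet)).trans ?_
        refine (Set.ncard_union_le _ _).trans ?_
        rw [Set.ncard_coe_finset]
      have h2 : (m - 3) * N₁.card ≤ C2 d * (EdgeSet χ V).ncard := by
        refine a5.trans (Nat.mul_le_mul_left _ (Set.ncard_le_ncard Set.inter_subset_left hfin))
      have h3 : (m - 3) * (EdgeSet χ₁ V₁).ncard ≤ (m - 3 + C2 d) * (EdgeSet χ V).ncard := by
        calc _ ≤ (m - 3) * ((EdgeSet χ V).ncard + N₁.card) := Nat.mul_le_mul_left _ h1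
          _ = (m - 3) * (EdgeSet χ V).ncard + (m - 3) * N₁.card := by ring
          _ ≤ (m - 3) * (EdgeSet χ V).ncard + C2 d * (EdgeSet χ V).ncard := by omega
          _ = _ := by ring
      rw [List.length_cons]
      calc (m - 3) ^ (Ls.length + 1) * (EdgeSet χ₂ V₂).ncard
          = (m - 3) * ((m - 3) ^ Ls.length * (EdgeSet χ₂ V₂).ncard) := by ring
        _ ≤ (m - 3) * ((m - 3 + C2 d) ^ Ls.length * (EdgeSet χ₁ V₁).ncard) :=
            Nat.mul_le_mul_left _ b4
        _ = (m - 3 + C2 d) ^ Ls.length * ((m - 3) * (EdgeSet χ₁ V₁).ncard) := by ring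
        _ ≤ (m - 3 + C2 d) ^ Ls.length * ((m - 3 + C2 d) * (EdgeSet χ V).ncard) :=
            Nat.mul_le_mul_left _ h3
        _ = _ := by ring
    · intro y hy
      obtain ⟨z, hz, e, hc⟩ := b5 y hy
      obtain ⟨w, hw, e', hc'⟩ := a6 z hz
      refine ⟨w, hw, e.trans e', ?_⟩
      have h1 : distInf z w ≤ 4 * ρ := by
        rcases hc' with rfl | ⟨o, _, h2, h3⟩
        · simp
        · have := distInf_triangle z o w
          rw [distInf_comm z o] at this
          rw [mem_ballZ] at h2 h3
          omega
      have h2 := distInf_triangle y z w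
      rw [List.length_cons, mul_add]
      omega



/-! ### The hierarchy of scales and bad boxes -/

/-- cumulated scale factor -/
def lam (q : ℕ → ℕ) : ℕ → ℕ
  | 0 => 1
  | n + 1 => 9 ^ q n * lam q n

theorem lam_pos (q : ℕ → ℕ) (n : ℕ) : 0 < lam q n := by
  induction n with
  | zero => simp [lam]
  | succ n ih => simp only [lam]; positivity

/-- Hierarchically bad boxes. -/
def BadH (q : ℕ → ℕ) (X : Set (Pt d)) : ℕ → Pt d → Prop
  | 0, x => x ∈ X
  | n + 1, x => ∃ x₁ x₂ : Pt d, distInf (sc (9 ^ q n) x) x₁ ≤ 3 * 9 ^ q n ∧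
      distInf (sc (9 ^ q n) x) x₂ ≤ 3 * 9 ^ q n ∧ 3 ^ q n ≤ distInf x₁ x₂ ∧
      BadH q X n x₁ ∧ BadH q X n x₂

theorem BadH_mono {q : ℕ → ℕ} {X X' : Set (Pt d)} (h : X ⊆ X') (n : ℕ) (x : Pt d) :
    BadH q X n x → BadH q X' n x := by
  induction n generalizing x with
  | zero => exact fun hx => h hx
  | succ n ih =>
    rintro ⟨x₁, x₂, h1, h2, h3, h4, h5⟩
    exact ⟨x₁, x₂, h1, h2, h3, ih _ h4, ih _ h5⟩

theorem BadH_near {q : ℕ → ℕ} (hq : ∀ n, 1 ≤ q n) {X : Set (Pt d)} (n : ℕ) (x : Pt d)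
    (h : BadH q X n x) : ∃ y ∈ X, distInf (sc (lam q n) x) y ≤ 6 * lam q n := by
  induction n generalizing x with
  | zero => exact ⟨x, h, by simp [lam, sc_one]⟩
  | succ n ih =>
    obtain ⟨x₁, x₂, h1, h2, h3, h4, h5⟩ := h
    obtain ⟨y, hy, hd⟩ := ih x₁ h4
    refine ⟨y, hy, ?_⟩
    have e1 : sc (lam q (n + 1)) x = sc (lam q n) (sc (9 ^ q n) x) := by
      rw [sc_sc, lam, mul_comm]
    have e2 := distInf_triangle (sc (lam q (n + 1)) x) (sc (lam q n) x₁) y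
    rw [e1, distInf_sc] at e2
    have e3 : lam q n * distInf (sc (9 ^ q n) x) x₁ ≤ lam q n * (3 * 9 ^ q n) :=
      Nat.mul_le_mul_left _ h1
    have e4 : 9 ≤ 9 ^ q n := by
      calc 9 = 9 ^ 1 := by norm_num
        _ ≤ 9 ^ q n := Nat.pow_le_pow_right (by norm_num) (hq n)
    rw [e1]
    have e5 : 6 * lam q (n + 1) = lam q n * (3 * 9 ^ q n) + 3 * 9 ^ q n * lam q n := by
      rw [lam]; ring
    have e6 : 9 * lam q n ≤ 9 ^ q n * lam q n := Nat.mul_le_mul_right _ e4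
    rw [e5]
    have e7 : 3 * 9 ^ q n * lam q n = 3 * (9 ^ q n * lam q n) := by ring
    rw [e7]
    omega

/-- rounding to the lattice of mesh `l` -/
def rd (l : ℕ) (y : Pt d) : Pt d := fun i => y i / (l : ℤ)

theorem rd_spec {l : ℕ} (hl : 0 < l) (y : Pt d) (i : Fin d) :
    0 ≤ y i - sc l (rd l y) i ∧ y i - sc l (rd l y) i < l := by
  have h1 := Int.emod_nonneg (y i) (show (l : ℤ) ≠ 0 by omega)
  have h2 := Int.emod_lt_of_pos (y i) (show (0 : ℤ) < l by omega)
  have h3 := Int.emod_add_mul_ediv (y i) l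
  simp only [sc, rd]
  constructor <;> linarith

theorem rd_dist {l : ℕ} (hl : 0 < l) (y : Pt d) : distInf (sc l (rd l y)) y ≤ l := by
  rw [distInf_le_iff]; intro i
  have := rd_spec hl y i
  omega

theorem level_pass (hd : 2 ≤ d) (q : ℕ → ℕ) (X₁ X₂ : Set (Pt d)) (n : ℕ) (hq : 5 ≤ q n)
    (χ : Pt d → Bool) (V : Set (Pt d)) (hfin : (EdgeSet χ V).Finite) (hVfin : V.Finite)
    (hV : ∀ y ∈ V, ∃ x, (BadH q X₁ n x ∨ BadH q X₂ n x) ∧ distInf (sc (lam q n) x) y ≤ lam q n) :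
    ∃ (χ' : Pt d → Bool) (V' : Set (Pt d)), V' ⊆ V ∧
      (EdgeSet χ' V').Finite ∧
      (∀ y ∈ V', ∃ x, (BadH q X₁ (n + 1) x ∨ BadH q X₂ (n + 1) x) ∧
        distInf (sc (lam q (n + 1)) x) y ≤ lam q (n + 1)) ∧
      (q n - 4) ^ (5 ^ d) * (EdgeSet χ' V').ncard ≤
        (q n - 4 + C2 d) ^ (5 ^ d) * (EdgeSet χ V).ncard ∧
      (∀ y, y ∉ V' → ∃ z, z ∉ V ∧ χ' y = χ z ∧ distInf y z ≤ 4 * lam q (n + 1) * 5 ^ d) := by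
  classical
  set l := 9 ^ q n with hl
  set r := 3 ^ q n with hr
  set ρ := lam q (n + 1) with hρ
  have hρe : ρ = l * lam q n := rfl
  have hlp := lam_pos q n
  have hρp : 0 < ρ := lam_pos q (n + 1)
  let bad : Pt d → Prop := fun x => BadH q X₁ (n + 1) x ∨ BadH q X₂ (n + 1) x
  let F : Finset (Pt d) := hVfin.toFinset.image (rd ρ)
  let fam : (Fin d → Fin 5) → Finset (Pt d) := fun κ =>
    (F.filter (fun x => ¬ bad x ∧ ∀ i, x i % 5 = ((κ i : ℕ) : ℤ))).image (sc ρ)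
  let Ls : List (Finset (Pt d)) := (Finset.univ : Finset (Fin d → Fin 5)).toList.map fam
  have hlen : Ls.length = 5 ^ d := by simp [Ls]
  have hr1 : 1 ≤ r := Nat.one_le_pow _ _ (by norm_num)
  have hlr : l = r * r := by
    rw [hl, hr, ← mul_pow]; norm_num
  have hρ3 : 3 ^ (q n - 1) * (r * lam q n) + r * lam q n ≤ ρ := by
    have h1 : 3 ^ (q n - 1) + 1 ≤ r := by
      have h2 : r = 3 * 3 ^ (q n - 1) := by
        rw [hr, ← pow_succ']; congr 1; omega
      have : 1 ≤ 3 ^ (q n - 1) := Nat.one_le_pow _ _ (by norm_num)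
      omega
    calc _ = (3 ^ (q n - 1) + 1) * (r * lam q n) := by ring
      _ ≤ r * (r * lam q n) := Nat.mul_le_mul_right _ h1
      _ = ρ := by rw [hρe, hlr]; ring
  -- bad boxes near a non-bad tile
  have hnear : ∀ (X : Set (Pt d)) (x : Pt d), ¬ BadH q X (n + 1) x →
      ∃ c, ∀ x' y, BadH q X n x' → distInf (sc (lam q n) x') y ≤ lam q n →
        distInf (sc ρ x) y ≤ 2 * ρ → distInf c y ≤ r * lam q n := by
    intro X x hx
    have hin : ∀ x' y, distInf (sc (lam q n) x') y ≤ lam q n →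
        distInf (sc ρ x) y ≤ 2 * ρ → distInf (sc l x) x' ≤ 3 * l := by
      intro x' y h1 h2
      have e1 : sc ρ x = sc (lam q n) (sc l x) := by rw [sc_sc, hρe, mul_comm]
      have e2 := distInf_triangle (sc ρ x) y (sc (lam q n) x')
      rw [distInf_comm y, e1, distInf_sc] at e2
      rw [e1] at h2
      have e3 : lam q n * distInf (sc l x) x' ≤ lam q n * (3 * l) := by
        have : lam q n * (3 * l) = 2 * ρ + l * lam q n := by rw [hρe]; ring
        have : lam q n ≤ l * lam q n := Nat.le_mul_of_pos_left _ (by positivity)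
        omega
      exact Nat.le_of_mul_le_mul_left e3 hlp
    by_cases hex : ∃ x', BadH q X n x' ∧ distInf (sc l x) x' ≤ 3 * l
    · obtain ⟨x₀, hb, hd0⟩ := hex
      refine ⟨sc (lam q n) x₀, ?_⟩
      intro x' y h1 h2 h3
      have h4 : ¬ r ≤ distInf x₀ x' := by
        intro h
        exact hx ⟨x₀, x', hd0, hin x' y h2 h3, h, hb, h1⟩
      have h5 := distInf_triangle (sc (lam q n) x₀) (sc (lam q n) x') y
      rw [distInf_sc] at h5
      have h6 : lam q n * distInf x₀ x' ≤ lam q n * (r - 1) := Nat.mul_le_mul_left _ (by omega)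
      have h7 : r * lam q n = lam q n * (r - 1) + lam q n := by
        obtain ⟨r', hr'⟩ : ∃ r', r = r' + 1 := ⟨r - 1, by omega⟩
        rw [hr']; simp; ring
      omega
    · push Not at hex
      refine ⟨0, ?_⟩
      intro x' y h1 h2 h3
      exact absurd (hin x' y h2 h3) (not_le.2 (hex x' h1))
  obtain ⟨χ', V', a1, a2, a3, a4, a5⟩ := color_passes hd (r * lam q n) (q n - 1) ρ
    (Nat.mul_pos hr1 hlp) (by omega) hρ3 Ls χ V hfin (by
      intro 𝒯 h𝒯 o ho o' ho' hne
      simp only [Ls, List.mem_map] at h𝒯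
      obtain ⟨κ, _, rfl⟩ := h𝒯
      simp only [fam, Finset.mem_image, Finset.mem_filter] at ho ho'
      obtain ⟨x, ⟨_, _, hx⟩, rfl⟩ := ho
      obtain ⟨x', ⟨_, _, hx'⟩, rfl⟩ := ho'
      rw [distInf_sc]
      have : 5 ≤ distInf x x' := by
        have hxx : x ≠ x' := fun h => hne (by rw [h])
        obtain ⟨i, hi⟩ := Function.ne_iff.1 hxx
        have h1 := natAbs_le_distInf x x' i
        have h2 := hx i
        have h3 := hx' i
        omega
      nlinarith) (by
      intro 𝒯 h𝒯 o ho
      simp only [Ls, List.mem_map] at h𝒯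
      obtain ⟨κ, _, rfl⟩ := h𝒯
      simp only [fam, Finset.mem_image, Finset.mem_filter] at ho
      obtain ⟨x, ⟨_, hb, _⟩, rfl⟩ := ho
      obtain ⟨c, hc⟩ := hnear X₁ x (fun h => hb (Or.inl h))
      obtain ⟨c', hc'⟩ := hnear X₂ x (fun h => hb (Or.inr h))
      refine ⟨c, c', ?_⟩
      intro y hy hyd
      obtain ⟨x', hx' | hx', hyx⟩ := hV y hy
      · exact Or.inl (hc x' y hx' hyx hyd)
      · exact Or.inr (hc' x' y hx' hyx hyd))
  rw [hlen] at a4 a5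
  refine ⟨χ', V', a1, a3, ?_, ?_, a5⟩
  · intro y hy
    refine ⟨rd ρ y, ?_, rd_dist hρp y⟩
    by_contra hb
    let κ : Fin d → Fin 5 := fun i => ⟨((rd ρ y i) % 5).toNat, by omega⟩
    refine a2 (fam κ) (by simp [Ls]) (sc ρ (rd ρ y)) ?_ y hy (rd_dist hρp y)
    simp only [fam, Finset.mem_image, Finset.mem_filter]
    refine ⟨rd ρ y, ⟨?_, hb, ?_⟩, rfl⟩
    · simp only [F, Finset.mem_image, Set.Finite.mem_toFinset]
      exact ⟨y, a1 hy, rfl⟩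
    · intro i
      simp only [κ]
      omega
  · have : q n - 1 - 3 = q n - 4 := by omega
    rwa [this] at a4

theorem DT (hd : 2 ≤ d) (q : ℕ → ℕ) (hq : ∀ n, 5 ≤ q n) (X₁ X₂ : Set (Pt d))
    (hX : (X₁ ∪ X₂).Finite) (χ : Pt d → Bool) (hfin : (EdgeSet χ (X₁ ∪ X₂)).Finite) (N : ℕ) :
    ∃ (χ' : Pt d → Bool) (V' : Set (Pt d)), V' ⊆ X₁ ∪ X₂ ∧ (EdgeSet χ' V').Finite ∧
      (∀ y ∈ V', ∃ x, (BadH q X₁ N x ∨ BadH q X₂ N x) ∧ distInf (sc (lam q N) x) y ≤ lam q N) ∧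
      ((EdgeSet χ' V').ncard : ℝ) ≤
        (∏ n ∈ Finset.range N, (1 + (C2 d : ℝ) / ((q n : ℝ) - 4)) ^ (5 ^ d)) *
          (EdgeSet χ (X₁ ∪ X₂)).ncard ∧
      (∀ y, y ∉ V' → ∃ z, z ∉ X₁ ∪ X₂ ∧ χ' y = χ z ∧ distInf y z ≤ 8 * 5 ^ d * lam q N) := by
  induction N with
  | zero =>
    refine ⟨χ, X₁ ∪ X₂, le_rfl, hfin, ?_, by simp, fun y hy => ⟨y, hy, rfl, by simp⟩⟩
    intro y hy
    exact ⟨y, hy, by simp [lam, sc_one]⟩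
  | succ N ih =>
    obtain ⟨χ₁, V₁, a1, a2, a3, a4, a5⟩ := ih
    obtain ⟨χ₂, V₂, b1, b2, b3, b4, b5⟩ := level_pass hd q X₁ X₂ N (hq N) χ₁ V₁ a2
      (hX.subset a1) a3
    refine ⟨χ₂, V₂, b1.trans a1, b2, b3, ?_, ?_⟩
    · rw [Finset.prod_range_succ]
      have hq' : (0 : ℝ) < (q N : ℝ) - 4 := by
        have : (5 : ℝ) ≤ q N := by exact_mod_cast hq N
        linarith
      have hc : ((q N - 4 : ℕ) : ℝ) = (q N : ℝ) - 4 := by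
        rw [Nat.cast_sub (by have := hq N; omega)]; norm_num
      have h1 : ((q N : ℝ) - 4) ^ (5 ^ d) * ((EdgeSet χ₂ V₂).ncard : ℝ) ≤
          ((q N : ℝ) - 4 + C2 d) ^ (5 ^ d) * ((EdgeSet χ₁ V₁).ncard : ℝ) := by
        rw [← hc]; exact_mod_cast b4
      have h2 : ((q N : ℝ) - 4 + C2 d) = ((q N : ℝ) - 4) * (1 + (C2 d : ℝ) / ((q N : ℝ) - 4)) := by
        field_simp
      rw [h2, mul_pow, mul_assoc] at h1
      have h3 := le_of_mul_le_mul_left h1 (by positivity)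
      refine h3.trans ?_
      calc _ ≤ (1 + (C2 d : ℝ) / ((q N : ℝ) - 4)) ^ 5 ^ d *
            ((∏ n ∈ Finset.range N, (1 + (C2 d : ℝ) / ((q n : ℝ) - 4)) ^ (5 ^ d)) *
          (EdgeSet χ (X₁ ∪ X₂)).ncard) := by
            apply mul_le_mul_of_nonneg_left a4
            positivity
        _ = _ := by ring
    · intro y hy
      obtain ⟨z, hz, e, hc⟩ := b5 y hy
      obtain ⟨w, hw, e', hc'⟩ := a5 z hz
      refine ⟨w, hw, e.trans e', ?_⟩
      have h1 := distInf_triangle y z w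
      have h2 : 2 * lam q N ≤ lam q (N + 1) := by
        rw [lam]
        refine Nat.mul_le_mul_right _ ?_
        calc 2 ≤ 9 ^ 1 := by norm_num
          _ ≤ _ := Nat.pow_le_pow_right (by norm_num) (by have := hq N; omega)
      have h3 : 5 ^ d * (2 * lam q N) ≤ 5 ^ d * lam q (N + 1) := Nat.mul_le_mul_left _ h2
      nlinarith

/-! ### Isoperimetry in the full lattice -/

theorem iso_Zd (hd : 2 ≤ d) (χ : Pt d → Bool) (hfin : {x | χ x = true}.Finite)
    (hE : (EdgeSet χ ∅).Finite) (t : ℕ) (ht : 1 ≤ t)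
    (htn : 2 * {x | χ x = true}.ncard ≤ t ^ d) :
    {x | χ x = true}.ncard ≤ 2 * 2 ^ d * 3 ^ (d + 1) * t * (EdgeSet χ ∅).ncard := by
  classical
  let A := hfin.toFinset
  let B : Finset (Pt d) := Finset.Icc (fun _ => 0) (fun _ => (t : ℤ) - 1)
  have hBc : B.card = t ^ d := by
    simp only [B, Pi.card_Icc, Int.card_Icc]
    rw [Finset.prod_congr rfl (g := fun _ => t)]
    · simp
    · intro i _; omega
  have hA : ∀ x, x ∈ A ↔ χ x = true := by simp [A]
  let Q : Finset (Pt d × Pt d) := ((A ×ˢ B).filter (fun p => χ (p.1 + p.2) = false)).image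
    (fun p => (p.1, p.1 + p.2))
  have i0 : Fin d := ⟨0, by omega⟩
  have hQ := count_pairs Q hE.toFinset t (by
    rintro p hp m
    simp only [Q, Finset.mem_image, Finset.mem_filter, Finset.mem_product, B, Finset.mem_Icc] at hp
    obtain ⟨⟨x, v⟩, ⟨⟨_, h1, h2⟩, _⟩, rfl⟩ := hp
    have := h1 m
    have := h2 m
    simp only [Pi.add_apply]
    dsimp only at *
    omega) (by
    rintro p hp
    simp only [Q, Finset.mem_image, Finset.mem_filter, Finset.mem_product, hA] at hp
    obtain ⟨⟨x, v⟩, ⟨⟨h0, _⟩, h1⟩, rfl⟩ := hp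
    dsimp only at h0 h1
    obtain ⟨e, he1, _, _, he4⟩ := path_edge χ Set.univ x (x + v) i0 (fun _ _ _ => trivial)
      (by rw [h0, h1]; simp)
    exact ⟨e, by simpa [EdgeSet] using he1, he4⟩)
  rw [Set.ncard_eq_toFinset_card _ hfin] at htn ⊢
  rw [Set.ncard_eq_toFinset_card _ hE]
  change 2 * A.card ≤ t ^ d at htn
  change A.card ≤ _
  have hQc : Q.card = ∑ x ∈ A, (B.filter (fun v => χ (x + v) = false)).card := by
    simp only [Q]
    rw [Finset.card_image_of_injective]
    · simp only [Finset.card_filter, Finset.sum_product]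
    · rintro ⟨x, v⟩ ⟨x', v'⟩ h
      simp only [Prod.mk.injEq] at h
      obtain ⟨rfl, h⟩ := h
      rw [add_right_inj] at h
      rw [h]
  have hx : ∀ x ∈ A, t ^ d ≤ 2 * (B.filter (fun v => χ (x + v) = false)).card := by
    intro x _
    have h1 := Finset.card_filter_add_card_filter_not (s := B) (fun v => χ (x + v) = false)
    have h2 : (B.filter (fun v => ¬ χ (x + v) = false)).card ≤ A.card := by
      apply Finset.card_le_card_of_injOn (fun v => x + v)
      · intro v hv
        simp only [Finset.coe_filter, Set.mem_ofPred_eq] at hv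
        rw [Finset.mem_coe, hA]
        simpa using hv.2
      · intro v _ v' _ h
        simpa using h
    rw [hBc] at h1
    omega
  have h1 : A.card * t ^ d ≤ 2 * Q.card := by
    rw [hQc, Finset.mul_sum, ← smul_eq_mul]
    exact Finset.card_nsmul_le_sum _ _ _ hx
  have h2 : 2 ^ d * (2 * t + 1) ^ (d + 1) * hE.toFinset.card ≤
      2 ^ d * (3 * t) ^ (d + 1) * hE.toFinset.card := by
    gcongr
    omega
  have h3 : t ^ d * A.card ≤ t ^ d * (2 * 2 ^ d * 3 ^ (d + 1) * t * hE.toFinset.card) := by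
    calc t ^ d * A.card = A.card * t ^ d := by ring
      _ ≤ 2 * (2 ^ d * (3 * t) ^ (d + 1) * hE.toFinset.card) := by omega
      _ = _ := by rw [mul_pow, pow_succ t d]; ring
  exact Nat.le_of_mul_le_mul_left h3 (by positivity)



/-! ### Connectivity -/

theorem adj_symm {x y : Pt d} (h : adj x y) : adj y x := by
  unfold adj dist1 at *
  rw [← h]
  refine Finset.sum_congr rfl fun i _ => by omega

theorem adj_distInf {x y : Pt d} (h : adj x y) : distInf x y ≤ 1 := by
  have := distInf_le_dist1 x y
  rw [adj] at h
  omega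

theorem stepRel_symm {T : Set (Pt d)} {x y : Pt d} (h : stepRel T x y) : stepRel T y x :=
  ⟨adj_symm h.1, h.2.2, h.2.1⟩

theorem connIn_refl {T : Set (Pt d)} {x : Pt d} (h : x ∈ T) : connIn T x x :=
  ⟨h, h, Relation.ReflTransGen.refl⟩

theorem connIn_symm {T : Set (Pt d)} {x y : Pt d} (h : connIn T x y) : connIn T y x := by
  refine ⟨h.2.1, h.1, ?_⟩
  have : Std.Symm (stepRel T) := ⟨fun _ _ => stepRel_symm⟩
  exact (Relation.ReflTransGen.stdSymm (r := stepRel T)).symm _ _ h.2.2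

theorem connIn_trans {T : Set (Pt d)} {x y z : Pt d} (h : connIn T x y) (h' : connIn T y z) :
    connIn T x z := ⟨h.1, h'.2.1, h.2.2.trans h'.2.2⟩

theorem connIn_mono {T T' : Set (Pt d)} (hT : T ⊆ T') {x y : Pt d} (h : connIn T x y) :
    connIn T' x y :=
  ⟨hT h.1, hT h.2.1, Relation.ReflTransGen.mono (fun _ _ hh => ⟨hh.1, hT hh.2.1, hT hh.2.2⟩) _ _ h.2.2⟩

theorem connIn_exit {T A : Set (Pt d)} {x y : Pt d} (h : connIn T x y) (hx : x ∈ A) (hy : y ∉ A) :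
    ∃ u v, adj u v ∧ u ∈ A ∧ v ∉ A ∧ u ∈ T ∧ v ∈ T := by
  by_contra hcon
  push Not at hcon
  have : ∀ z, Relation.ReflTransGen (stepRel T) x z → z ∈ A := by
    intro z hz
    induction hz with
    | refl => exact hx
    | tail _ hs ih =>
      by_contra hc
      exact hcon _ _ hs.1 ih hc hs.2.1 hs.2.2
  exact hy (this y h.2.2)

theorem Sinf_subset_Sr (ω : Config d) (r : ℝ) : Sinf ω ⊆ Sr ω r := by
  intro x hx
  refine ⟨hx.1, x, connIn_refl hx.1, ?_⟩
  by_contra hcon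
  push Not at hcon
  apply hx.2
  refine (ballZ_finite x ⌈r⌉₊).subset ?_
  intro y hy
  have h1 := hcon y hy
  have h2 := distInf_le_dist1 x y
  have h3 := Nat.le_ceil r
  have h4 : (dist1 x y : ℝ) ≤ (⌈r⌉₊ : ℝ) := by linarith
  have h5 : dist1 x y ≤ ⌈r⌉₊ := by exact_mod_cast h4
  exact h2.trans h5

theorem Sr_conn {ω : Config d} {r : ℝ} {x y : Pt d} (h : connIn (SS ω) x y) (hx : x ∈ Sr ω r) :
    y ∈ Sr ω r := by
  obtain ⟨_, u, hu, v, hv, hr⟩ := hx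
  exact ⟨h.2.1, u, connIn_trans (connIn_symm h) hu, v, connIn_trans (connIn_symm h) hv, hr⟩

/-! ### Seeds -/

/-- vertices connected to distance `L` -/
def Vs (ω : Config d) (L : ℕ) : Set (Pt d) :=
  {p | ∃ z, L ≤ distInf p z ∧ connIn (SS ω ∩ ballZ p L) p z}

/-- box of side `L` -/
noncomputable def box (L : ℕ) (y : Pt d) : Finset (Pt d) :=
  Finset.Icc (sc L y) (fun i => (L : ℤ) * y i + L - 1)

theorem mem_box {L : ℕ} {y p : Pt d} : p ∈ box L y ↔ ∀ i, (L : ℤ) * y i ≤ p i ∧ p i < (L : ℤ) * y i + L := by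
  rw [box, Finset.mem_Icc, Pi.le_def, Pi.le_def]
  constructor
  · rintro ⟨h1, h2⟩ i
    have := h1 i
    have := h2 i
    simp only [sc] at *
    omega
  · intro h
    refine ⟨fun i => (h i).1, fun i => ?_⟩
    have := (h i).2
    omega

theorem box_dist {L : ℕ} {y p : Pt d} (h : p ∈ box L y) : distInf (sc L y) p ≤ L := by
  rw [mem_box] at h
  rw [distInf_le_iff]; intro i
  have := h i
  simp only [sc]
  omega

theorem card_box (L : ℕ) (y : Pt d) : (box L y).card = L ^ d := by
  rw [box, Pi.card_Icc]
  simp only [Int.card_Icc, sc]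
  rw [Finset.prod_congr rfl (g := fun _ => L)]
  · simp
  · intro i _; omega

/-- the local cluster -/
def CC (ω : Config d) (L : ℕ) (x p : Pt d) : Set (Pt d) :=
  {v | connIn (SS ω ∩ ballZ (sc L x) (4 * L)) p v}

/-- increasing good event for a seed box -/
def GoodInc (ω : Config d) (L : ℕ) (h : ℝ) (x : Pt d) : Prop :=
  ∃ p, ∀ y, distInf x y ≤ 1 →
    3 * h ≤ 4 * ({v | v ∈ box L y ∧ v ∈ Vs ω L ∧ v ∈ CC ω L x p}.ncard : ℝ)

/-- decreasing good event for a seed box -/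
def GoodDec (ω : Config d) (L : ℕ) (h : ℝ) (x : Pt d) : Prop :=
  4 * ({v | v ∈ box L x ∧ v ∈ Vs ω L}.ncard : ℝ) ≤ 5 * h

theorem good_adj {ω : Config d} {L : ℕ} {h : ℝ} (hh : 0 < h) {x y p p' : Pt d}
    (hx : 3 * h ≤ 4 * ({v | v ∈ box L y ∧ v ∈ Vs ω L ∧ v ∈ CC ω L x p}.ncard : ℝ))
    (hy : 3 * h ≤ 4 * ({v | v ∈ box L y ∧ v ∈ Vs ω L ∧ v ∈ CC ω L y p'}.ncard : ℝ))
    (hdec : GoodDec ω L h y) : ∃ v, v ∈ CC ω L x p ∧ v ∈ CC ω L y p' := by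
  by_contra hcon
  push Not at hcon
  set A := {v | v ∈ box L y ∧ v ∈ Vs ω L ∧ v ∈ CC ω L x p}
  set B := {v | v ∈ box L y ∧ v ∈ Vs ω L ∧ v ∈ CC ω L y p'}
  have hf : ∀ P : Pt d → Prop, {v | v ∈ box L y ∧ P v}.Finite := fun P =>
    (box L y).finite_toSet.subset fun v hv => hv.1
  have hdis : Disjoint A B := by
    rw [Set.disjoint_left]
    intro v hv hv'
    exact hcon v hv.2.2 hv'.2.2
  have h1 := Set.ncard_union_eq hdis (hf _) (hf _)
  have h2 : (A ∪ B).ncard ≤ {v | v ∈ box L y ∧ v ∈ Vs ω L}.ncard := by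
    apply Set.ncard_le_ncard _ (hf _)
    rintro v (hv | hv)
    · exact ⟨hv.1, hv.2.1⟩
    · exact ⟨hv.1, hv.2.1⟩
  rw [h1] at h2
  have h3 : (A.ncard : ℝ) + B.ncard ≤ {v | v ∈ box L y ∧ v ∈ Vs ω L}.ncard := by exact_mod_cast h2
  unfold GoodDec at hdec
  linarith

theorem card_near {l c : ℕ} (hl : 0 < l) (p : Pt d) (F : Finset (Pt d))
    (hF : ∀ x ∈ F, distInf (sc l x) p ≤ c * l) : F.card ≤ (2 * (c + 1) + 1) ^ d := by
  rw [← card_ballF (rd l p) (c + 1)]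
  apply Finset.card_le_card
  intro x hx
  rw [mem_ballF]
  have h1 := hF x hx
  have h2 := rd_dist hl p
  have h3 := distInf_triangle (sc l (rd l p)) p (sc l x)
  rw [distInf_comm p, distInf_sc] at h3
  have h4 : l * distInf (rd l p) x ≤ l * (c + 1) := by
    have : l * (c + 1) = c * l + l := by ring
    omega
  exact Nat.le_of_mul_le_mul_left h4 hl

theorem edgeBd_finite (S : Set (Pt d)) {A : Set (Pt d)} (hA : A.Finite) : (edgeBd S A).Finite := by
  have : (⋃ a ∈ A, ballZ a 1).Finite := hA.biUnion fun a _ => ballZ_finite a 1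
  refine (hA.prod this).subset ?_
  rintro ⟨p, v⟩ ⟨h1, h2, _⟩
  refine ⟨h2, ?_⟩
  simp only [Set.mem_iUnion]
  exact ⟨p, h2, adj_distInf h1⟩



/-! ### Deterministic isoperimetry from well-behaved scales -/

theorem CC_conn {ω : Config d} {L : ℕ} {x p v v' : Pt d} (h : v ∈ CC ω L x p) (h' : v' ∈ CC ω L x p) :
    connIn (SS ω ∩ ballZ (sc L x) (4 * L)) v v' := connIn_trans (connIn_symm h) h'

theorem sc_mul_lam (L l : ℕ) (x : Pt d) : sc (L * l) x = sc L (sc l x) := (sc_sc L l x).symm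

theorem assembly (hd : 2 ≤ d) (ω : Config d) (L : ℕ) (h : ℝ) (hL : 1 ≤ L) (hh : 0 < h)
    (q : ℕ → ℕ) (hq : ∀ n, 5 ≤ q n) (N K R LN : ℕ) (hLN : LN = L * lam q N)
    (hR : R = (8 * 5 ^ d + 20) * LN) (A : Set (Pt d)) (hAS : A ⊆ Sinf ω)
    (hAK : A ⊆ ballZ 0 K) (Cp : ℝ)
    (hCp : ∏ n ∈ Finset.range N, (1 + (C2 d : ℝ) / ((q n : ℝ) - 4)) ^ (5 ^ d) ≤ Cp)
    (hbad : ∀ x : Pt d, distInf 0 (sc LN x) ≤ K + 5 * R →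
      ¬ BadH q {x | ¬ GoodInc ω L h x} N x ∧ ¬ BadH q {x | ¬ GoodDec ω L h x} N x)
    (huniq : ∀ x : Pt d, distInf 0 (sc LN x) ≤ K + 5 * R →
      ∀ v ∈ Sr ω ((R : ℝ) / 10) ∩ ballZ (sc LN x) R, ∀ v' ∈ Sr ω ((R : ℝ) / 10) ∩ ballZ (sc LN x) R,
        connIn (SS ω ∩ ballZ (sc LN x) (2 * R)) v v') :
    A.ncard ≤ 2 * (4 * (8 * 5 ^ d + 20) + 3) ^ d * LN ^ d * (edgeBd (SS ω) A).ncard ∨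
    ∃ n : ℕ, A.ncard ≤ 2 * L ^ d * n ∧ ∀ t : ℕ, 1 ≤ t → 2 * n ≤ t ^ d →
      (n : ℝ) ≤ 2 * 2 ^ d * 3 ^ (d + 1) * t * (Cp * (13 ^ d * d * (edgeBd (SS ω) A).ncard)) := by
  classical
  have hlp := lam_pos q N
  have hLLN : L ≤ LN := by rw [hLN]; exact Nat.le_mul_of_pos_right _ hlp
  have hLNp : 0 < LN := by omega
  have hRLN : 20 * LN + 8 * 5 ^ d * LN = R := by rw [hR]; ring
  have hAfin : A.Finite := (ballZ_finite 0 K).subset hAK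
  have hEfin := edgeBd_finite (SS ω) hAfin
  set Bd := edgeBd (SS ω) A with hBd
  let T : Finset (Pt d) := hAfin.toFinset.image (rd LN)
  have hTA : ∀ x ∈ T, ∃ a ∈ A, rd LN a = x := by
    intro x hx
    simpa [T] using hx
  have hT0 : ∀ x ∈ T, distInf 0 (sc LN x) ≤ K + LN := by
    intro x hx
    obtain ⟨a, ha, rfl⟩ := hTA x hx
    have h1 := distInf_triangle 0 a (sc LN (rd LN a))
    have h2 := rd_dist hLNp a
    rw [distInf_comm] at h2
    have h3 : distInf 0 a ≤ K := hAK ha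
    omega
  let part : Pt d → Prop := fun x => ∃ e ∈ Bd, distInf (sc LN x) e.1 ≤ 2 * R
  -- number of partial tiles
  have hpart : (T.filter part).card ≤ (4 * (8 * 5 ^ d + 20) + 3) ^ d * Bd.ncard := by
    have hsub : T.filter part ⊆ hEfin.toFinset.biUnion
        (fun e => T.filter (fun x => distInf (sc LN x) e.1 ≤ 2 * R)) := by
      intro x hx
      rw [Finset.mem_filter] at hx
      obtain ⟨hxT, e, he, hxe⟩ := hx
      rw [Finset.mem_biUnion]
      exact ⟨e, by simpa using he, by rw [Finset.mem_filter]; exact ⟨hxT, hxe⟩⟩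
    refine (Finset.card_le_card hsub).trans ?_
    rw [Set.ncard_eq_toFinset_card _ hEfin, mul_comm (_ ^ d)]
    apply Finset.card_biUnion_le_card_mul
    intro e _
    have := card_near (c := 2 * (8 * 5 ^ d + 20)) hLNp e.1
      (T.filter (fun x => distInf (sc LN x) e.1 ≤ 2 * R)) (by
        intro x hx
        rw [Finset.mem_filter] at hx
        refine hx.2.trans (le_of_eq ?_)
        rw [hR]; ring)
    refine this.trans (le_of_eq ?_)
    congr 1; ring
  -- cardinality of A
  have hAcard : A.ncard ≤ LN ^ d * T.card := by
    rw [Set.ncard_eq_toFinset_card _ hAfin, mul_comm]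
    have hsub : hAfin.toFinset ⊆ T.biUnion (fun x => box LN x) := by
      intro a ha
      rw [Finset.mem_biUnion]
      refine ⟨rd LN a, Finset.mem_image_of_mem _ ha, ?_⟩
      rw [mem_box]
      intro i
      have := rd_spec hLNp a i
      simp only [sc] at this
      omega
    refine (Finset.card_le_card hsub).trans ?_
    apply Finset.card_biUnion_le_card_mul
    intro x _
    rw [card_box]
  by_cases hcase : T.card ≤ 2 * (T.filter part).card
  · left
    calc A.ncard ≤ LN ^ d * T.card := hAcard
      _ ≤ LN ^ d * (2 * ((4 * (8 * 5 ^ d + 20) + 3) ^ d * Bd.ncard)) :=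
          Nat.mul_le_mul_left _ (hcase.trans (Nat.mul_le_mul_left _ hpart))
      _ = _ := by ring
  right
  push Not at hcase
  -- full tiles
  let full : Pt d → Prop := fun x => x ∈ T ∧ ¬ part x
  have hfull : ∀ x, full x → ∀ v ∈ Sr ω ((R : ℝ) / 10) ∩ ballZ (sc LN x) R, v ∈ A := by
    rintro x ⟨hxT, hnp⟩ v hv
    by_contra hvA
    obtain ⟨a, ha, hax⟩ := hTA x hxT
    have h0 := hT0 x hxT
    have h1 : a ∈ ballZ (sc LN x) R := by
      have h2 := rd_dist hLNp a
      rw [hax] at h2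
      rw [mem_ballZ]; omega
    have hc := huniq x (by omega) a ⟨Sinf_subset_Sr ω _ (hAS ha), h1⟩ v hv
    obtain ⟨u, w, e1, e2, e3, e4, e5⟩ := connIn_exit hc ha hvA
    exact hnp ⟨(u, w), ⟨e1, e2, e5.1, e3⟩, e4.2⟩
  set X₁ : Set (Pt d) := {x | ¬ GoodInc ω L h x} with hX₁
  set X₂ : Set (Pt d) := {x | ¬ GoodDec ω L h x} with hX₂
  have hgood : ∀ x, ∃ p, x ∉ X₁ → ∀ y, distInf x y ≤ 1 →
      3 * h ≤ 4 * ({v | v ∈ box L y ∧ v ∈ Vs ω L ∧ v ∈ CC ω L x p}.ncard : ℝ) := by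
    intro x
    by_cases hx : GoodInc ω L h x
    · obtain ⟨p, hp⟩ := hx
      exact ⟨p, fun _ => hp⟩
    · exact ⟨0, fun hx' => absurd hx hx'⟩
  choose p hp using hgood
  let C : Pt d → Set (Pt d) := fun x => CC ω L x (p x)
  have hCball : ∀ x v, v ∈ C x → distInf (sc L x) v ≤ 4 * L := fun x v hv => hv.2.1.2
  have hCne : ∀ x, x ∉ X₁ → (C x).Nonempty := by
    intro x hx
    by_contra hne
    rw [Set.not_nonempty_iff_eq_empty] at hne
    have h1 := hp x hx x (by simp)
    have h2 : {v | v ∈ box L x ∧ v ∈ Vs ω L ∧ v ∈ CC ω L x (p x)} = ∅ := by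
      rw [Set.eq_empty_iff_forall_notMem]
      rintro v ⟨_, _, hv⟩
      have : v ∈ C x := hv
      rw [hne] at this
      exact this
    rw [h2] at h1
    simp at h1
    linarith
  let P0 : Pt d → Prop := fun w => w ∉ X₁ ∪ X₂ ∧ ((∃ v ∈ C w, v ∈ A) ∨
    ∃ v ∈ C w, v ∉ Sr ω ((R : ℝ) / 10) ∧ ∃ x, full x ∧ ∃ v', connIn (SS ω) v v' ∧
      v' ∈ ballZ (sc LN x) R)
  let χ₀ : Pt d → Bool := fun w => decide (P0 w)
  have hχ : ∀ w, χ₀ w = true ↔ P0 w := fun w => by simp [χ₀]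
  -- support of χ₀
  have hsupp : ∀ w, P0 w → distInf 0 (sc L w) ≤ K + 3 * R := by
    rintro w ⟨_, ⟨v, hv, hvA⟩ | ⟨v, hv, hvS, x, hx, v', hvv', hv'⟩⟩
    · have h1 := hCball w v hv
      have h2 : distInf 0 v ≤ K := hAK hvA
      have h3 := distInf_triangle 0 v (sc L w)
      rw [distInf_comm v] at h3
      omega
    · have h1 := hCball w v hv
      have h2 := hT0 x hx.1
      have h3 := distInf_triangle 0 (sc LN x) v'
      have h4 := distInf_triangle 0 v' v
      have h5 := distInf_triangle 0 v (sc L w)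
      rw [distInf_comm v] at h5
      have h6 : distInf v' v ≤ R := by
        by_contra hcon
        push Not at hcon
        apply hvS
        refine ⟨hvv'.1, v', hvv', v, connIn_refl hvv'.1, ?_⟩
        have h7 := distInf_le_dist1 v' v
        have h8 : (R : ℝ) ≤ dist1 v' v := by exact_mod_cast (by omega : R ≤ dist1 v' v)
        have : (0 : ℝ) ≤ R := by positivity
        linarith
      have h7 : distInf (sc LN x) v' ≤ R := hv'
      omega
  -- truncated bad sets
  let M : Set (Pt d) := {w | distInf 0 (sc L w) ≤ K + 4 * R}
  have hMfin : M.Finite := by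
    refine (ballZ_finite 0 (K + 4 * R)).subset ?_
    intro w hw
    have h1 : distInf (sc L 0) (sc L w) ≤ K + 4 * R := by
      have : sc L (0 : Pt d) = 0 := by funext i; simp [sc]
      rw [this]; exact hw
    rw [distInf_sc] at h1
    rw [mem_ballZ]
    exact (Nat.le_mul_of_pos_left _ (by omega)).trans h1
  let Y₁ := X₁ ∩ M
  let Y₂ := X₂ ∩ M
  have hYfin : (Y₁ ∪ Y₂).Finite := hMfin.subset (Set.union_subset Set.inter_subset_right Set.inter_subset_right)
  -- bichromatic edges
  have hedge : ∀ w w', distInf w w' ≤ 1 → P0 w → ¬ P0 w' → w' ∉ Y₁ ∪ Y₂ →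
      ∃ e ∈ Bd, distInf (sc L w) e.1 ≤ 4 * L := by
    intro w w' hww hw hw' hwY
    have hw'M : w' ∈ M := by
      have h1 := hsupp w hw
      have h2 := distInf_triangle 0 (sc L w) (sc L w')
      rw [distInf_sc] at h2
      have h3 : L * distInf w w' ≤ L * 1 := Nat.mul_le_mul_left _ hww
      change distInf 0 (sc L w') ≤ K + 4 * R
      omega
    have hw'X : w' ∉ X₁ ∪ X₂ := by
      rintro (h | h)
      · exact hwY (Or.inl ⟨h, hw'M⟩)
      · exact hwY (Or.inr ⟨h, hw'M⟩)
    have hx1 : w ∉ X₁ := fun h => hw.1 (Or.inl h)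
    have hx1' : w' ∉ X₁ := fun h => hw'X (Or.inl h)
    have hdec : GoodDec ω L h w' := by
      by_contra hc
      exact hw'X (Or.inr hc)
    obtain ⟨v₀, hv₀, hv₀'⟩ := good_adj hh (hp w hx1 w' hww) (hp w' hx1' w' (by simp)) hdec
    rcases hw.2 with ⟨v, hv, hvA⟩ | ⟨v, hv, hvS, x, hx, v', hvv', hv'⟩
    · have hv₀A : v₀ ∉ A := fun hA => hw' ⟨hw'X, Or.inl ⟨v₀, hv₀', hA⟩⟩
      obtain ⟨a, b, e1, e2, e3, e4, e5⟩ := connIn_exit (CC_conn hv hv₀) hvA hv₀A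
      exact ⟨(a, b), ⟨e1, e2, e5.1, e3⟩, e4.2⟩
    · exfalso
      have hcc : connIn (SS ω) v v₀ := connIn_mono Set.inter_subset_left (CC_conn hv hv₀)
      refine hw' ⟨hw'X, Or.inr ⟨v₀, hv₀', ?_, x, hx, v', connIn_trans (connIn_symm hcc) hvv', hv'⟩⟩
      exact fun hS => hvS (Sr_conn (connIn_symm hcc) hS)
  have hEsub : ∀ e ∈ EdgeSet χ₀ (Y₁ ∪ Y₂), ∃ b ∈ Bd, distInf (sc L e.1) b.1 ≤ 5 * L := by
    rintro ⟨w, m⟩ ⟨h1, h2, h3⟩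
    dsimp only at h1 h2 h3 ⊢
    have hww := distInf_add_ev w m
    by_cases hw : P0 w
    · have hw' : ¬ P0 (w + ev m) := by
        intro hc; apply h1; rw [(hχ _).2 hw, (hχ _).2 hc]
      obtain ⟨b, hb, hbd⟩ := hedge w (w + ev m) hww hw hw' h3
      exact ⟨b, hb, by omega⟩
    · have hw' : P0 (w + ev m) := by
        by_contra hc
        apply h1
        simp only [χ₀, hw, hc]
      obtain ⟨b, hb, hbd⟩ := hedge (w + ev m) w (by rw [distInf_comm]; exact hww) hw' hw h2
      refine ⟨b, hb, ?_⟩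
      have h4 := distInf_triangle (sc L w) (sc L (w + ev m)) b.1
      rw [distInf_sc] at h4
      have h5 : L * distInf w (w + ev m) ≤ L * 1 := Nat.mul_le_mul_left _ hww
      omega
  have hE0 : (EdgeSet χ₀ (Y₁ ∪ Y₂)).Finite ∧
      (EdgeSet χ₀ (Y₁ ∪ Y₂)).ncard ≤ 13 ^ d * d * Bd.ncard := by
    let G : Pt d × Pt d → Finset (Pt d) := fun b =>
      (ballF (rd L b.1) 6).filter (fun w => distInf (sc L w) b.1 ≤ 5 * L)
    let Bf : Finset (Pt d × Fin d) := hEfin.toFinset.biUnion (fun b => G b ×ˢ Finset.univ)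
    have hsub : EdgeSet χ₀ (Y₁ ∪ Y₂) ⊆ (Bf : Set (Pt d × Fin d)) := by
      intro e he
      obtain ⟨b, hb, hbd⟩ := hEsub e he
      rw [Finset.mem_coe, Finset.mem_biUnion]
      refine ⟨b, by simpa using hb, ?_⟩
      rw [Finset.mem_product]
      refine ⟨?_, Finset.mem_univ _⟩
      rw [Finset.mem_filter, mem_ballF]
      refine ⟨?_, hbd⟩
      have h2 := rd_dist (show 0 < L from hL) b.1
      have h3 := distInf_triangle (sc L (rd L b.1)) b.1 (sc L e.1)
      rw [distInf_comm b.1, distInf_sc] at h3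
      have h4 : L * distInf (rd L b.1) e.1 ≤ L * 6 := by omega
      exact Nat.le_of_mul_le_mul_left h4 hL
    refine ⟨Bf.finite_toSet.subset hsub, ?_⟩
    refine (Set.ncard_le_ncard hsub Bf.finite_toSet).trans ?_
    rw [Set.ncard_coe_finset, Set.ncard_eq_toFinset_card _ hEfin, mul_comm]
    apply Finset.card_biUnion_le_card_mul
    intro b _
    rw [Finset.card_product, Finset.card_univ, Fintype.card_fin]
    refine Nat.mul_le_mul_right _ ?_
    have := card_near (c := 5) (show 0 < L from hL) b.1 (G b) (fun x hx => (Finset.mem_filter.1 hx).2)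
    exact this
  obtain ⟨χ', V', a1, a2, a3, a4, a5⟩ := DT hd q hq Y₁ Y₂ hYfin χ₀ hE0.1 N
  have hnear : ∀ x : Pt d, (∃ y ∈ M, distInf (sc (lam q N) x) y ≤ 6 * lam q N) →
      distInf 0 (sc LN x) ≤ K + 5 * R := by
    rintro x ⟨y, hy, hyd⟩
    have h1 := distInf_triangle 0 (sc L y) (sc LN x)
    rw [distInf_comm (sc L y), hLN, sc_mul_lam, distInf_sc] at h1
    have h2 : L * distInf (sc (lam q N) x) y ≤ L * (6 * lam q N) := Nat.mul_le_mul_left _ hyd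
    have h3 : L * (6 * lam q N) = 6 * LN := by rw [hLN]; ring
    have h4 : distInf 0 (sc L y) ≤ K + 4 * R := hy
    rw [hLN, sc_mul_lam]
    omega
  have hq1 : ∀ n, 1 ≤ q n := fun n => by have := hq n; omega
  have hV' : V' = ∅ := by
    rw [Set.eq_empty_iff_forall_notMem]
    intro y hy
    obtain ⟨x, hx | hx, _⟩ := a3 y hy
    · obtain ⟨y', hy', hd'⟩ := BadH_near hq1 N x hx
      exact (hbad x (hnear x ⟨y', hy'.2, hd'⟩)).1 (BadH_mono Set.inter_subset_left N x hx)
    · obtain ⟨y', hy', hd'⟩ := BadH_near hq1 N x hx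
      exact (hbad x (hnear x ⟨y', hy'.2, hd'⟩)).2 (BadH_mono Set.inter_subset_left N x hx)
  subst hV'
  -- support of χ' is finite
  have hfin' : {w | χ' w = true}.Finite := by
    have h1 : (⋃ z ∈ M, ballZ z (8 * 5 ^ d * lam q N)).Finite :=
      hMfin.biUnion fun z _ => ballZ_finite z _
    refine h1.subset ?_
    intro w hw
    obtain ⟨z, _, hz, hzd⟩ := a5 w (by simp)
    have hw' : χ' w = true := hw
    rw [hw'] at hz
    simp only [Set.mem_iUnion]
    refine ⟨z, ?_, ?_⟩
    · have := hsupp z ((hχ z).1 hz.symm)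
      change distInf 0 (sc L z) ≤ K + 4 * R
      omega
    · rw [mem_ballZ, distInf_comm]; exact hzd
  -- full tiles are coloured
  have hcol : ∀ x, full x → ∀ w ∈ box (lam q N) x, χ' w = true := by
    intro x hx w hw
    obtain ⟨z, hzY, hz, hzd⟩ := a5 w (by simp)
    rw [hz, hχ]
    have h1 := box_dist hw
    have h2 := distInf_triangle (sc (lam q N) x) w z
    have h3 : distInf (sc LN x) (sc L z) ≤ LN + 8 * 5 ^ d * LN := by
      rw [hLN, sc_mul_lam, distInf_sc]
      have : L * lam q N + 8 * 5 ^ d * (L * lam q N) = L * (lam q N + 8 * 5 ^ d * lam q N) := by ring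
      rw [this]
      exact Nat.mul_le_mul_left _ (by omega)
    have h0 := hT0 x hx.1
    have hzM : z ∈ M := by
      have := distInf_triangle 0 (sc LN x) (sc L z)
      change distInf 0 (sc L z) ≤ K + 4 * R
      omega
    have hzX : z ∉ X₁ ∪ X₂ := by
      rintro (h | h)
      · exact hzY (Or.inl ⟨h, hzM⟩)
      · exact hzY (Or.inr ⟨h, hzM⟩)
    obtain ⟨v, hv⟩ := hCne z (fun h => hzX (Or.inl h))
    have hvR : v ∈ ballZ (sc LN x) R := by
      have h4 := hCball z v hv
      have h5 := distInf_triangle (sc LN x) (sc L z) v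
      rw [mem_ballZ]
      omega
    refine ⟨hzX, ?_⟩
    by_cases hvS : v ∈ Sr ω ((R : ℝ) / 10)
    · exact Or.inl ⟨v, hv, hfull x hx v ⟨hvS, hvR⟩⟩
    · exact Or.inr ⟨v, hv, hvS, x, hx, v, connIn_refl hv.2.1.1, hvR⟩
  refine ⟨{w | χ' w = true}.ncard, ?_, ?_⟩
  · have hsub : (T.filter (fun x => ¬ part x)).biUnion (fun x => box (lam q N) x) ⊆ hfin'.toFinset := by
      intro w hw
      rw [Finset.mem_biUnion] at hw
      obtain ⟨x, hx, hw⟩ := hw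
      rw [Finset.mem_filter] at hx
      rw [Set.Finite.mem_toFinset]
      exact hcol x hx w hw
    have hcard := Finset.card_le_card hsub
    rw [Finset.card_biUnion, Finset.sum_congr rfl (fun x _ => card_box (lam q N) x),
      Finset.sum_const, smul_eq_mul, ← Set.ncard_eq_toFinset_card _ hfin'] at hcard
    · have h1 := Finset.card_filter_add_card_filter_not (s := T) part
      have h2 : T.card ≤ 2 * (T.filter (fun x => ¬ part x)).card := by omega
      calc A.ncard ≤ LN ^ d * T.card := hAcard
        _ ≤ LN ^ d * (2 * (T.filter (fun x => ¬ part x)).card) := Nat.mul_le_mul_left _ h2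
        _ = 2 * L ^ d * ((T.filter (fun x => ¬ part x)).card * lam q N ^ d) := by
            rw [hLN, mul_pow]; ring
        _ ≤ _ := Nat.mul_le_mul_left _ hcard
    · intro x _ x' _ hne
      rw [Function.onFun, Finset.disjoint_left]
      intro w hw hw'
      apply hne
      funext i
      rw [mem_box] at hw hw'
      have h1 := hw i
      have h2 := hw' i
      have hl : (0 : ℤ) < lam q N := by exact_mod_cast hlp
      have h3 : (lam q N : ℤ) * x i < lam q N * (x' i + 1) := by rw [mul_add]; omega
      have h4 : (lam q N : ℤ) * x' i < lam q N * (x i + 1) := by rw [mul_add]; omega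
      have h5 := lt_of_mul_lt_mul_left h3 hl.le
      have h6 := lt_of_mul_lt_mul_left h4 hl.le
      omega
  · intro t ht htn
    have hiso := iso_Zd hd χ' hfin' a2 t ht htn
    have h1 : ({w | χ' w = true}.ncard : ℝ) ≤
        2 * 2 ^ d * 3 ^ (d + 1) * t * ((EdgeSet χ' ∅).ncard : ℝ) := by exact_mod_cast hiso
    refine h1.trans ?_
    have h2 : ((EdgeSet χ' ∅).ncard : ℝ) ≤ Cp * (13 ^ d * d * Bd.ncard) := by
      have h3 : ((EdgeSet χ₀ (Y₁ ∪ Y₂)).ncard : ℝ) ≤ 13 ^ d * d * Bd.ncard := by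
        exact_mod_cast hE0.2
      have h4 : 0 ≤ ∏ n ∈ Finset.range N, (1 + (C2 d : ℝ) / ((q n : ℝ) - 4)) ^ (5 ^ d) := by
        apply Finset.prod_nonneg
        intro n _
        have : (5 : ℝ) ≤ q n := by exact_mod_cast hq n
        have : (0 : ℝ) ≤ (C2 d : ℝ) / ((q n : ℝ) - 4) := div_nonneg (by positivity) (by linarith)
        positivity
      refine a4.trans ?_
      exact mul_le_mul hCp h3 (by positivity) (h4.trans hCp)
    exact mul_le_mul_of_nonneg_left h2 (by positivity)



/-! ### Shifts -/

theorem distInf_add_left (c x y : Pt d) : distInf (c + x) (c + y) = distInf x y := by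
  unfold distInf; congr 1; funext i; simp

theorem dist1_add_left (c x y : Pt d) : dist1 (c + x) (c + y) = dist1 x y := by
  unfold dist1; congr 1; funext i; simp

theorem adj_add_left (c x y : Pt d) : adj (c + x) (c + y) ↔ adj x y := by
  unfold adj; rw [dist1_add_left]

theorem connIn_add (c : Pt d) (T : Set (Pt d)) {x y : Pt d}
    (h : connIn {z | c + z ∈ T} x y) : connIn T (c + x) (c + y) := by
  refine ⟨h.1, h.2.1, ?_⟩
  exact Relation.ReflTransGen.lift (fun z => c + z)
    (fun a b hab => ⟨(adj_add_left c a b).2 hab.1, hab.2.1, hab.2.2⟩) _ _ h.2.2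

theorem connIn_add_iff (c : Pt d) (T : Set (Pt d)) {x y : Pt d} :
    connIn {z | c + z ∈ T} x y ↔ connIn T (c + x) (c + y) := by
  refine ⟨connIn_add c T, fun h => ?_⟩
  have h1 : T = {z | -c + z ∈ {z | c + z ∈ T}} := by
    ext z; simp
  rw [h1] at h
  have := connIn_add (-c) _ h
  simpa using this

theorem SS_shift (c : Pt d) (ω : Config d) : SS (shift c ω) = {z | c + z ∈ SS ω} := rfl

theorem SS_shift_inter (c : Pt d) (ω : Config d) (o : Pt d) (R : ℕ) :
    SS (shift c ω) ∩ ballZ o R = {z | c + z ∈ SS ω ∩ ballZ (c + o) R} := by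
  ext z
  simp only [SS_shift, Set.mem_inter_iff, mem_ballZ, Set.mem_ofPred_eq, distInf_add_left]

theorem conn_shift (c : Pt d) (ω : Config d) {x y : Pt d} :
    connIn (SS (shift c ω)) x y ↔ connIn (SS ω) (c + x) (c + y) := by
  rw [SS_shift]; exact connIn_add_iff c _

theorem conn_shift_ball (c : Pt d) (ω : Config d) (o : Pt d) (R : ℕ) {x y : Pt d} :
    connIn (SS (shift c ω) ∩ ballZ o R) x y ↔ connIn (SS ω ∩ ballZ (c + o) R) (c + x) (c + y) := by
  rw [SS_shift_inter]; exact connIn_add_iff c _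

theorem Vs_shift (c : Pt d) (ω : Config d) (L : ℕ) (x : Pt d) :
    x ∈ Vs (shift c ω) L ↔ c + x ∈ Vs ω L := by
  constructor
  · rintro ⟨z, h1, h2⟩
    exact ⟨c + z, by rwa [distInf_add_left], (conn_shift_ball c ω _ _).1 h2⟩
  · rintro ⟨z, h1, h2⟩
    have e : z = c + (z - c) := by abel
    rw [e] at h1 h2
    exact ⟨z - c, by rwa [distInf_add_left] at h1, (conn_shift_ball c ω _ _).2 h2⟩

theorem Sinf_iff (ω : Config d) (x : Pt d) : x ∈ Sinf ω ↔ ∀ L, x ∈ Vs ω L := by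
  constructor
  · rintro ⟨hx, hinf⟩ L
    have hex : ∃ y ∈ cluster (SS ω) x, L ≤ distInf x y := by
      by_contra hcon
      push Not at hcon
      exact hinf ((ballZ_finite x L).subset fun y hy => (hcon y hy).le)
    obtain ⟨y, hy, hLy⟩ := hex
    have key : ∀ z, Relation.ReflTransGen (stepRel (SS ω)) x z →
        connIn (SS ω ∩ ballZ x L) x z ∨ x ∈ Vs ω L := by
      intro z hz
      induction hz with
      | refl => exact Or.inl (connIn_refl ⟨hx, by simp [mem_ballZ]⟩)
      | @tail b c _ hs ih =>
        rcases ih with ih | ih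
        · by_cases hb : L ≤ distInf x b
          · exact Or.inr ⟨b, hb, ih⟩
          · left
            have h1 := distInf_triangle x b c
            have h2 := adj_distInf hs.1
            have hc : c ∈ SS ω ∩ ballZ x L := ⟨hs.2.2, by rw [mem_ballZ]; omega⟩
            exact ⟨ih.1, hc, ih.2.2.tail ⟨hs.1, ih.2.1, hc⟩⟩
        · exact Or.inr ih
    rcases key y hy.2.2 with h | h
    · exact ⟨y, hLy, h⟩
    · exact h
  · intro h
    obtain ⟨z, _, hz⟩ := h 0
    refine ⟨hz.1.1, fun hfin => ?_⟩
    obtain ⟨M, hM⟩ := (hfin.image (fun y => distInf x y)).bddAbove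
    obtain ⟨z, hz1, hz2⟩ := h (M + 1)
    have := hM ⟨z, connIn_mono Set.inter_subset_left hz2, rfl⟩
    simp only at this
    omega

theorem Sinf_shift (c : Pt d) (ω : Config d) (x : Pt d) :
    x ∈ Sinf (shift c ω) ↔ c + x ∈ Sinf ω := by
  simp only [Sinf_iff, Vs_shift]

theorem Sr_shift (c : Pt d) (ω : Config d) (r : ℝ) (x : Pt d) :
    x ∈ Sr (shift c ω) r ↔ c + x ∈ Sr ω r := by
  constructor
  · rintro ⟨h0, y, hy, z, hz, hr⟩
    exact ⟨h0, c + y, (conn_shift c ω).1 hy, c + z, (conn_shift c ω).1 hz, by rwa [dist1_add_left]⟩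
  · rintro ⟨h0, y, hy, z, hz, hr⟩
    have e : y = c + (y - c) := by abel
    have e' : z = c + (z - c) := by abel
    rw [e] at hy hr
    rw [e'] at hz hr
    exact ⟨h0, y - c, (conn_shift c ω).2 hy, z - c, (conn_shift c ω).2 hz,
      by rwa [dist1_add_left] at hr⟩

theorem shift_shift (x y : Pt d) (ω : Config d) : shift x (shift y ω) = shift (y + x) ω := by
  funext z; simp [shift, add_assoc]

theorem shift_zero : shift (0 : Pt d) = id := by
  funext ω z; simp [shift]

theorem measurable_shift (x : Pt d) : Measurable (shift x : Config d → Config d) :=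
  measurable_pi_lambda _ fun y => measurable_pi_apply (x + y)

theorem locUniq2_shift {c : Pt d} {ω : Config d} {R : ℕ} (h : shift c ω ∈ locUniq2 d R) :
    ∀ v ∈ Sr ω ((R : ℝ) / 10) ∩ ballZ c R, ∀ v' ∈ Sr ω ((R : ℝ) / 10) ∩ ballZ c R,
        connIn (SS ω ∩ ballZ c (2 * R)) v v' := by
  intro v hv v' hv'
  have tr : ∀ v, v ∈ Sr ω ((R : ℝ) / 10) ∩ ballZ c R →
      v - c ∈ Sr (shift c ω) ((R : ℝ) / 10) ∩ ballZ 0 R := by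
    intro v hv
    refine ⟨?_, ?_⟩
    · rw [Sr_shift]; simpa using hv.1
    · rw [mem_ballZ, ← distInf_add_left c]
      have h2 := mem_ballZ.1 hv.2
      simpa using h2
  have := h _ (tr v hv) _ (tr v' hv')
  rw [conn_shift_ball] at this
  simpa using this

/-! ### Measurability -/

theorem DependsOn.mono {G : Set (Config d)} {B B' : Set (Pt d)} (h : DependsOn G B) (hB : B ⊆ B') :
    DependsOn G B' := fun ω ω' hω => h ω ω' fun x hx => hω x (hB hx)

theorem DependsOn.measurable {G : Set (Config d)} {B : Set (Pt d)} (h : DependsOn G B)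
    (hB : B.Finite) : MeasurableSet G := by
  have : Finite B := hB
  let res : Config d → (B → Bool) := fun ω b => ω b
  have hres : Measurable res := measurable_pi_lambda _ fun b => measurable_pi_apply (b : Pt d)
  have hG : G = res ⁻¹' (res '' G) := by
    apply Set.Subset.antisymm (Set.subset_preimage_image _ _)
    rintro ω ⟨ω', hω', he⟩
    refine (h ω' ω ?_).1 hω'
    intro x hx
    exact congrFun he ⟨x, hx⟩
  rw [hG]
  exact hres (Set.toFinite _).measurableSet

theorem SS_congr {B : Set (Pt d)} {ω ω' : Config d} (h : ∀ x ∈ B, ω x = ω' x) :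
    SS ω ∩ B = SS ω' ∩ B := by
  ext x
  simp only [SS, Set.mem_inter_iff, Set.mem_ofPred_eq]
  constructor
  · rintro ⟨h1, h2⟩; exact ⟨by rw [← h x h2]; exact h1, h2⟩
  · rintro ⟨h1, h2⟩; exact ⟨by rw [h x h2]; exact h1, h2⟩

theorem dep_conn (o : Pt d) (R : ℕ) (x y : Pt d) :
    DependsOn {ω : Config d | connIn (SS ω ∩ ballZ o R) x y} (ballZ o R) := by
  intro ω ω' h
  simp only [Set.mem_ofPred_eq, SS_congr h]

theorem dep_Vs (x : Pt d) (L : ℕ) : DependsOn {ω : Config d | x ∈ Vs ω L} (ballZ x L) := by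
  intro ω ω' h
  simp only [Set.mem_ofPred_eq, Vs, SS_congr h]

theorem meas_Vs (x : Pt d) (L : ℕ) : MeasurableSet {ω : Config d | x ∈ Vs ω L} :=
  (dep_Vs x L).measurable (ballZ_finite _ _)

theorem meas_Sinf (x : Pt d) : MeasurableSet {ω : Config d | x ∈ Sinf ω} := by
  have : {ω : Config d | x ∈ Sinf ω} = ⋂ L, {ω : Config d | x ∈ Vs ω L} := by
    ext ω; simp [Sinf_iff]
  rw [this]
  exact MeasurableSet.iInter fun L => meas_Vs x L

theorem connIn_ball {T : Set (Pt d)} {x y : Pt d} (h : connIn T x y) :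
    ∃ n, connIn (T ∩ ballZ x n) x y := by
  obtain ⟨hx, _, hp⟩ := h
  have key : ∀ z, Relation.ReflTransGen (stepRel T) x z → ∃ n, connIn (T ∩ ballZ x n) x z := by
    intro z hz
    induction hz with
    | refl => exact ⟨0, connIn_refl ⟨hx, by simp [mem_ballZ]⟩⟩
    | @tail b c _ hs ih =>
      obtain ⟨n, hn⟩ := ih
      refine ⟨n + 1, ?_⟩
      have hsub : T ∩ ballZ x n ⊆ T ∩ ballZ x (n + 1) :=
        Set.inter_subset_inter_right _ (ballZ_subset (by simp))
      have hn' := connIn_mono hsub hn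
      have h1 := distInf_triangle x b c
      have h2 := adj_distInf hs.1
      have h3 : distInf x b ≤ n := hn.2.1.2
      have hc : c ∈ T ∩ ballZ x (n + 1) := ⟨hs.2.2, by rw [mem_ballZ]; omega⟩
      exact ⟨hn'.1, hc, hn'.2.2.tail ⟨hs.1, hn'.2.1, hc⟩⟩
  exact key y hp

theorem meas_conn (x y : Pt d) : MeasurableSet {ω : Config d | connIn (SS ω) x y} := by
  have : {ω : Config d | connIn (SS ω) x y} =
      ⋃ n, {ω : Config d | connIn (SS ω ∩ ballZ x n) x y} := by
    ext ω
    simp only [Set.mem_ofPred_eq, Set.mem_iUnion]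
    exact ⟨connIn_ball, fun ⟨n, h⟩ => connIn_mono Set.inter_subset_left h⟩
  rw [this]
  exact MeasurableSet.iUnion fun n => (dep_conn x n x y).measurable (ballZ_finite _ _)

theorem meas_Sr (x : Pt d) (r : ℝ) : MeasurableSet {ω : Config d | x ∈ Sr ω r} := by
  have : {ω : Config d | x ∈ Sr ω r} =
      ⋃ y : Pt d, ⋃ z : Pt d, {ω : Config d | connIn (SS ω) x y} ∩
        ({ω : Config d | connIn (SS ω) x z} ∩ {_ω | r ≤ (dist1 y z : ℝ)}) := by
    ext ω
    simp only [Set.mem_ofPred_eq, Set.mem_iUnion, Set.mem_inter_iff, Sr, cluster]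
    constructor
    · rintro ⟨_, y, hy, z, hz, hr⟩; exact ⟨y, z, hy, hz, hr⟩
    · rintro ⟨y, z, hy, hz, hr⟩; exact ⟨hy.1, y, hy, z, hz, hr⟩
  rw [this]
  exact MeasurableSet.iUnion fun y => MeasurableSet.iUnion fun z =>
    (meas_conn x y).inter ((meas_conn x z).inter (MeasurableSet.const _))

theorem meas_locUniq2 (R : ℕ) : MeasurableSet (locUniq2 d R) := by
  have : locUniq2 d R = ⋂ x : Pt d, ⋂ y : Pt d,
      (({ω : Config d | x ∈ Sr ω ((R : ℝ) / 10)} ∩ {_ω | x ∈ ballZ (0 : Pt d) R}) ∩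
      ({ω : Config d | y ∈ Sr ω ((R : ℝ) / 10)} ∩ {_ω | y ∈ ballZ (0 : Pt d) R}))ᶜ ∪
      {ω : Config d | connIn (SS ω ∩ ballZ (0 : Pt d) (2 * R)) x y} := by
    ext ω
    simp only [locUniq2, Set.mem_ofPred_eq, Set.mem_iInter, Set.mem_union, Set.mem_compl_iff,
      Set.mem_inter_iff]
    constructor
    · intro h x y
      by_cases hc : (x ∈ Sr ω ((R : ℝ) / 10) ∧ x ∈ ballZ 0 R) ∧ (y ∈ Sr ω ((R : ℝ) / 10) ∧ y ∈ ballZ 0 R)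
      · exact Or.inr (h x hc.1 y hc.2)
      · exact Or.inl hc
    · intro h x hx y hy
      rcases h x y with h | h
      · exact absurd ⟨hx, hy⟩ h
      · exact h
  rw [this]
  refine MeasurableSet.iInter fun x => MeasurableSet.iInter fun y => MeasurableSet.union ?_ ?_
  · exact (((meas_Sr x _).inter (MeasurableSet.const _)).inter
      ((meas_Sr y _).inter (MeasurableSet.const _))).compl
  · exact (dep_conn _ _ _ _).measurable (ballZ_finite _ _)

/-! ### Monotonicity and locality of the seeds -/

theorem SS_mono {ω ω' : Config d} (h : ∀ x, ω x = true → ω' x = true) : SS ω ⊆ SS ω' :=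
  fun x hx => h x hx

theorem Vs_mono {ω ω' : Config d} (h : ∀ x, ω x = true → ω' x = true) (L : ℕ) : Vs ω L ⊆ Vs ω' L := by
  rintro x ⟨z, h1, h2⟩
  exact ⟨z, h1, connIn_mono (Set.inter_subset_inter_left _ (SS_mono h)) h2⟩

theorem GoodInc_mono {ω ω' : Config d} (h : ∀ x, ω x = true → ω' x = true) {L : ℕ} {t : ℝ} {x : Pt d}
    (hg : GoodInc ω L t x) : GoodInc ω' L t x := by
  obtain ⟨p, hp⟩ := hg
  refine ⟨p, fun y hy => (hp y hy).trans ?_⟩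
  refine mul_le_mul_of_nonneg_left (Nat.cast_le.2 (Set.ncard_le_ncard ?_ ?_)) (by norm_num)
  · rintro v ⟨h1, h2, h3⟩
    exact ⟨h1, Vs_mono h L h2, connIn_mono (Set.inter_subset_inter_left _ (SS_mono h)) h3⟩
  · exact (box L y).finite_toSet.subset fun v hv => hv.1

theorem GoodDec_anti {ω ω' : Config d} (h : ∀ x, ω x = true → ω' x = true) {L : ℕ} {t : ℝ} {x : Pt d}
    (hg : GoodDec ω' L t x) : GoodDec ω L t x := by
  unfold GoodDec at *
  refine le_trans ?_ hg
  gcongr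
  · exact (box L x).finite_toSet.subset fun v hv => hv.1
  · exact Vs_mono h L

theorem dep_Good (L : ℕ) (t : ℝ) (x : Pt d) :
    DependsOn {ω : Config d | ¬ GoodInc ω L t x} (ballZ (sc L x) (10 * L)) ∧
    DependsOn {ω : Config d | ¬ GoodDec ω L t x} (ballZ (sc L x) (10 * L)) := by
  have hV : ∀ (ω ω' : Config d), (∀ y ∈ ballZ (sc L x) (10 * L), ω y = ω' y) → ∀ y, distInf x y ≤ 1 →
      ∀ v ∈ box L y, (v ∈ Vs ω L ↔ v ∈ Vs ω' L) := by
    intro ω ω' h y hy v hv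
    refine (dep_Vs v L).mono (B' := ballZ (sc L x) (10 * L)) (ballZ_subset ?_) ω ω' h
    have h1 := box_dist hv
    have h2 := distInf_triangle (sc L x) (sc L y) v
    rw [distInf_sc] at h2
    have h3 : L * distInf x y ≤ L * 1 := Nat.mul_le_mul_left _ hy
    omega
  constructor
  · intro ω ω' h
    have hC : ∀ p v, v ∈ CC ω L x p ↔ v ∈ CC ω' L x p := fun p v =>
      ((dep_conn (sc L x) (4 * L) p v).mono (ballZ_subset (by simp; omega))) ω ω' h
    have hset : ∀ p y, distInf x y ≤ 1 → {v | v ∈ box L y ∧ v ∈ Vs ω L ∧ v ∈ CC ω L x p} =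
        {v | v ∈ box L y ∧ v ∈ Vs ω' L ∧ v ∈ CC ω' L x p} := by
      intro p y hy
      ext v
      simp only [Set.mem_ofPred_eq]
      constructor
      · rintro ⟨h1, h2, h3⟩; exact ⟨h1, (hV ω ω' h y hy v h1).1 h2, (hC p v).1 h3⟩
      · rintro ⟨h1, h2, h3⟩; exact ⟨h1, (hV ω ω' h y hy v h1).2 h2, (hC p v).2 h3⟩
    simp only [Set.mem_ofPred_eq, not_iff_not, GoodInc]
    constructor
    · rintro ⟨p, hp⟩; exact ⟨p, fun y hy => by rw [← hset p y hy]; exact hp y hy⟩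
    · rintro ⟨p, hp⟩; exact ⟨p, fun y hy => by rw [hset p y hy]; exact hp y hy⟩
  · intro ω ω' h
    have hset : {v | v ∈ box L x ∧ v ∈ Vs ω L} = {v | v ∈ box L x ∧ v ∈ Vs ω' L} := by
      ext v
      simp only [Set.mem_ofPred_eq]
      constructor
      · rintro ⟨h1, h2⟩; exact ⟨h1, (hV ω ω' h x (by simp) v h1).1 h2⟩
      · rintro ⟨h1, h2⟩; exact ⟨h1, (hV ω ω' h x (by simp) v h1).2 h2⟩
    simp only [Set.mem_ofPred_eq, GoodDec, hset]

theorem dep_BadH {q : ℕ → ℕ} (hq : ∀ n, 1 ≤ q n) {L : ℕ} (X : Config d → Set (Pt d))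
    (hX : ∀ x, DependsOn {ω | x ∈ X ω} (ballZ (sc L x) (10 * L))) (n : ℕ) (x : Pt d) :
    DependsOn {ω | BadH q (X ω) n x} (ballZ (sc (L * lam q n) x) (10 * (L * lam q n))) := by
  induction n generalizing x with
  | zero => simpa [lam, BadH] using hX x
  | succ n ih =>
    intro ω ω' h
    have hsub : ∀ x₁, distInf (sc (9 ^ q n) x) x₁ ≤ 3 * 9 ^ q n →
        (BadH q (X ω) n x₁ ↔ BadH q (X ω') n x₁) := by
      intro x₁ h1
      refine (ih x₁).mono (B' := ballZ (sc (L * lam q (n + 1)) x) (10 * (L * lam q (n + 1))))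
        (ballZ_subset ?_) ω ω' h
      have e1 : sc (L * lam q (n + 1)) x = sc (L * lam q n) (sc (9 ^ q n) x) := by
        rw [sc_sc, lam]; congr 1; ring
      rw [e1, distInf_sc]
      have e2 : L * lam q n * distInf (sc (9 ^ q n) x) x₁ ≤ L * lam q n * (3 * 9 ^ q n) :=
        Nat.mul_le_mul_left _ h1
      have e3 : 9 ≤ 9 ^ q n := by
        calc 9 = 9 ^ 1 := by norm_num
          _ ≤ 9 ^ q n := Nat.pow_le_pow_right (by norm_num) (hq n)
      have e4 : 9 * (L * lam q n) ≤ 9 ^ q n * (L * lam q n) := Nat.mul_le_mul_right _ e3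
      have e5 : L * lam q n * (3 * 9 ^ q n) = 3 * (9 ^ q n * (L * lam q n)) := by ring
      have e6 : 10 * (L * lam q (n + 1)) = 10 * (9 ^ q n * (L * lam q n)) := by rw [lam]; ring
      omega
    simp only [Set.mem_ofPred_eq, BadH]
    constructor
    · rintro ⟨x₁, x₂, h1, h2, h3, h4, h5⟩
      exact ⟨x₁, x₂, h1, h2, h3, (hsub x₁ h1).1 h4, (hsub x₂ h2).1 h5⟩
    · rintro ⟨x₁, x₂, h1, h2, h3, h4, h5⟩
      exact ⟨x₁, x₂, h1, h2, h3, (hsub x₁ h1).2 h4, (hsub x₂ h2).2 h5⟩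

theorem meas_BadH {q : ℕ → ℕ} (hq : ∀ n, 1 ≤ q n) {L : ℕ} (X : Config d → Set (Pt d))
    (hX : ∀ x, DependsOn {ω | x ∈ X ω} (ballZ (sc L x) (10 * L))) (n : ℕ) (x : Pt d) :
    MeasurableSet {ω | BadH q (X ω) n x} :=
  (dep_BadH hq X hX n x).measurable (ballZ_finite _ _)



/-! ### The multiscale recursion -/

theorem rec_bound (q : ℕ → ℕ) (Q : ℕ → Measure (Config d)) (hQ : ∀ n, IsProbabilityMeasure (Q n))
    (X : Config d → Set (Pt d)) (e p : ℕ → ℝ)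
    (h0 : ∀ x, (Q 0).real {ω | x ∈ X ω} ≤ p 0)
    (hstep : ∀ n x₁ x₂, 3 ^ q n ≤ distInf x₁ x₂ →
      (Q (n + 1)).real ({ω | BadH q (X ω) n x₁} ∩ {ω | BadH q (X ω) n x₂}) ≤
        (Q n).real {ω | BadH q (X ω) n x₁} * (Q n).real {ω | BadH q (X ω) n x₂} + e n)
    (he : ∀ n, 0 ≤ e n)
    (hnum : ∀ n, ((2 * (3 * 9 ^ q n) + 1 : ℕ) : ℝ) ^ (2 * d) * (p n * p n + e n) ≤ p (n + 1)) :
    ∀ n x, (Q n).real {ω | BadH q (X ω) n x} ≤ p n := by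
  intro n
  induction n with
  | zero => intro x; simpa [BadH] using h0 x
  | succ n ih =>
    intro x
    have hfin := hQ (n + 1)
    have hp : 0 ≤ p n := le_trans measureReal_nonneg (ih x)
    let F := ballF (sc (9 ^ q n) x) (3 * 9 ^ q n)
    let G : Finset (Pt d × Pt d) := (F ×ˢ F).filter fun z => 3 ^ q n ≤ distInf z.1 z.2
    have hsub : {ω | BadH q (X ω) (n + 1) x} ⊆
        ⋃ z ∈ G, ({ω | BadH q (X ω) n z.1} ∩ {ω | BadH q (X ω) n z.2}) := by
      rintro ω ⟨x₁, x₂, h1, h2, h3, h4, h5⟩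
      simp only [Set.mem_iUnion]
      refine ⟨(x₁, x₂), ?_, h4, h5⟩
      simp only [G, F, Finset.mem_filter, Finset.mem_product, mem_ballF]
      exact ⟨⟨h1, h2⟩, h3⟩
    have hcard : (G.card : ℝ) ≤ ((2 * (3 * 9 ^ q n) + 1 : ℕ) : ℝ) ^ (2 * d) := by
      have : G.card ≤ (2 * (3 * 9 ^ q n) + 1) ^ (2 * d) := by
        calc G.card ≤ (F ×ˢ F).card := Finset.card_filter_le _ _
          _ = (2 * (3 * 9 ^ q n) + 1) ^ (2 * d) := by
            rw [Finset.card_product, card_ballF]; ring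
      exact_mod_cast this
    calc (Q (n + 1)).real {ω | BadH q (X ω) (n + 1) x}
        ≤ (Q (n + 1)).real (⋃ z ∈ G, ({ω | BadH q (X ω) n z.1} ∩ {ω | BadH q (X ω) n z.2})) :=
          measureReal_mono hsub (measure_ne_top _ _)
      _ ≤ ∑ z ∈ G, (Q (n + 1)).real ({ω | BadH q (X ω) n z.1} ∩ {ω | BadH q (X ω) n z.2}) :=
          measureReal_biUnion_finset_le _ _
      _ ≤ ∑ z ∈ G, (p n * p n + e n) := by
          refine Finset.sum_le_sum fun z hz => ?_
          refine (hstep n z.1 z.2 (Finset.mem_filter.1 hz).2).trans ?_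
          have := mul_le_mul (ih z.1) (ih z.2) measureReal_nonneg hp
          linarith
      _ = (G.card : ℝ) * (p n * p n + e n) := by rw [Finset.sum_const, nsmul_eq_mul]
      _ ≤ ((2 * (3 * 9 ^ q n) + 1 : ℕ) : ℝ) ^ (2 * d) * (p n * p n + e n) :=
          mul_le_mul_of_nonneg_right hcard (add_nonneg (mul_nonneg hp hp) (he n))
      _ ≤ p (n + 1) := hnum n

theorem poly_exp (C₁ C₂ : ℝ) (κ : ℕ) {c : ℝ} (hc : 0 < c) :
    ∀ᶠ s : ℕ in atTop, C₁ + C₂ * (s : ℝ) ^ κ ≤ c * (3 / 2) ^ s := by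
  have h1 : Tendsto (fun s : ℕ => C₁ * (2 / 3 : ℝ) ^ s + C₂ * ((s : ℝ) ^ κ * (2 / 3 : ℝ) ^ s)) atTop
      (nhds (C₁ * 0 + C₂ * 0)) :=
    ((tendsto_pow_atTop_nhds_zero_of_lt_one (by norm_num) (by norm_num)).const_mul _).add
      ((tendsto_pow_const_mul_const_pow_of_abs_lt_one κ (by rw [abs_lt]; norm_num)).const_mul _)
  have h2 := h1.eventually (gt_mem_nhds (by simpa using hc))
  filter_upwards [h2] with s hs
  have e : (2 / 3 : ℝ) ^ s * (3 / 2) ^ s = 1 := by rw [← mul_pow]; norm_num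
  have h3 : 0 < (3 / 2 : ℝ) ^ s := by positivity
  calc C₁ + C₂ * (s : ℝ) ^ κ
      = (C₁ * (2 / 3 : ℝ) ^ s + C₂ * ((s : ℝ) ^ κ * (2 / 3 : ℝ) ^ s)) * (3 / 2) ^ s := by
        linear_combination (-C₁ - C₂ * (s : ℝ) ^ κ) * e
    _ ≤ c * (3 / 2) ^ s := mul_le_mul_of_nonneg_right hs.le h3.le

theorem numA (d κ : ℕ) : ∀ᶠ s : ℕ in atTop,
    2 * ((2 * (3 * 9 ^ (s ^ κ)) + 1 : ℕ) : ℝ) ^ (2 * d) ≤ Real.exp (1 / 2 * (3 / 2) ^ s) := by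
  filter_upwards [poly_exp (Real.log 2 + 2 * d * Real.log 7) (2 * d * Real.log 9) κ
    (c := 1 / 2) (by norm_num)] with s hs
  refine le_trans ?_ (Real.exp_le_exp.2 hs)
  have h1 : ((2 * (3 * 9 ^ (s ^ κ)) + 1 : ℕ) : ℝ) ≤ 7 * 9 ^ (s ^ κ) := by
    have : (1 : ℝ) ≤ 9 ^ (s ^ κ) := one_le_pow₀ (by norm_num)
    push_cast
    linarith
  have h2 : Real.exp (Real.log 2 + 2 * d * Real.log 7 + 2 * d * Real.log 9 * (s : ℝ) ^ κ) =
      2 * (7 * 9 ^ (s ^ κ)) ^ (2 * d) := by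
    have e1 : Real.log 2 + 2 * d * Real.log 7 + 2 * d * Real.log 9 * (s : ℝ) ^ κ =
        Real.log (2 * (7 * 9 ^ (s ^ κ)) ^ (2 * d)) := by
      rw [Real.log_mul (by norm_num) (by positivity), Real.log_pow,
        Real.log_mul (by norm_num) (by positivity), Real.log_pow]
      push_cast; ring
    rw [e1, Real.exp_log (by positivity)]
  rw [h2]
  gcongr

theorem numB (κ : ℕ) (hκ : 2 ≤ κ) {χ δ : ℝ} (hχ : 0 < χ) (hδ : 0 < δ) : ∀ᶠ s : ℕ in atTop,
    2 * (((3 ^ (s ^ κ) : ℕ) : ℝ)) ^ (-χ) ≤ δ * (1 / 2) ^ (s + 1) := by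
  have h1 : Tendsto (fun s : ℕ => ((3 : ℝ) ^ (-χ)) ^ s) atTop (nhds 0) :=
    tendsto_pow_atTop_nhds_zero_of_lt_one (by positivity)
      (Real.rpow_lt_one_of_one_lt_of_neg (by norm_num) (by linarith))
  have h2 : Tendsto (fun s : ℕ => (1 / 2 : ℝ) ^ s) atTop (nhds 0) :=
    tendsto_pow_atTop_nhds_zero_of_lt_one (by norm_num) (by norm_num)
  filter_upwards [h1.eventually (gt_mem_nhds (show (0 : ℝ) < 1 / 4 by norm_num)),
    h2.eventually (gt_mem_nhds (show (0 : ℝ) < δ / 4 by positivity)), eventually_ge_atTop 1]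
    with s hs1 hs2 hs3
  have e1 : (((3 ^ (s ^ κ) : ℕ) : ℝ)) ^ (-χ) = ((3 : ℝ) ^ (-χ)) ^ (s ^ κ) := by
    push_cast
    rw [← Real.rpow_natCast, ← Real.rpow_natCast, ← Real.rpow_mul (by norm_num),
      ← Real.rpow_mul (by norm_num)]
    congr 1; ring
  have h3 : ((3 : ℝ) ^ (-χ)) ^ (s ^ κ) ≤ (1 / 4) ^ s := by
    calc ((3 : ℝ) ^ (-χ)) ^ (s ^ κ) ≤ ((3 : ℝ) ^ (-χ)) ^ (s ^ 2) := by
          apply pow_le_pow_of_le_one (by positivity)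
            (Real.rpow_lt_one_of_one_lt_of_neg (by norm_num) (by linarith)).le
          exact Nat.pow_le_pow_right hs3 hκ
      _ = (((3 : ℝ) ^ (-χ)) ^ s) ^ s := by rw [← pow_mul, sq]
      _ ≤ (1 / 4) ^ s := by gcongr
  have e2 : (1 / 4 : ℝ) ^ s = (1 / 2) ^ s * (1 / 2) ^ s := by rw [← mul_pow]; norm_num
  rw [e1, pow_succ]
  have h4 : 0 < (1 / 2 : ℝ) ^ s := by positivity
  nlinarith [mul_le_mul_of_nonneg_right hs2.le h4.le]

theorem numC (κ : ℕ) : ∀ᶠ s : ℕ in atTop, (s + 1) ^ κ ≤ 2 * s ^ κ := by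
  have h1 : Tendsto (fun s : ℕ => (1 + 1 / (s : ℝ)) ^ κ) atTop (nhds ((1 + 0) ^ κ)) :=
    (tendsto_const_nhds.add tendsto_one_div_atTop_nhds_zero_nat).pow κ
  have h2 := h1.eventually (gt_mem_nhds (show ((1 : ℝ) + 0) ^ κ < 2 by simp))
  filter_upwards [h2, eventually_ge_atTop 1] with s hs hs1
  have hpos : (0 : ℝ) < s := by exact_mod_cast hs1
  have : ((s : ℝ) + 1) ^ κ ≤ 2 * (s : ℝ) ^ κ := by
    have e : (s : ℝ) + 1 = (1 + 1 / (s : ℝ)) * s := by field_simp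
    rw [e, mul_pow]
    gcongr
  exact_mod_cast this

theorem numD {s : ℕ} (hs : 2 ≤ s) : 2 * (3 / 2 : ℝ) ^ s ≤ Real.exp s := by
  have h1 : (5 / 2 : ℝ) ≤ Real.exp 1 := by have := Real.exp_one_gt_d9; linarith
  have h2 : (5 / 2 : ℝ) ^ s ≤ Real.exp s := by
    have := pow_le_pow_left₀ (by norm_num) h1 s
    rwa [← Real.exp_nat_mul, mul_one] at this
  have e : (5 / 2 : ℝ) ^ s = (5 / 3) ^ s * (3 / 2) ^ s := by rw [← mul_pow]; norm_num
  have h3 : (5 / 3 : ℝ) ^ 2 ≤ (5 / 3) ^ s := pow_le_pow_right₀ (by norm_num) hs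
  have h4 : (0 : ℝ) < (3 / 2) ^ s := by positivity
  nlinarith

/-- the exponents -/
def qq (κ n0 : ℕ) (n : ℕ) : ℕ := (n + n0) ^ κ

theorem log_lam_ge {κ n0 L : ℕ} (hL : Real.exp ((n0 : ℝ) ^ κ) ≤ L)
    (hC : ∀ s ≥ n0, (s + 1) ^ κ ≤ 2 * s ^ κ) (n : ℕ) :
    ((n + n0 : ℕ) : ℝ) ^ κ ≤ Real.log ((L * lam (qq κ n0) n : ℕ) : ℝ) := by
  have hLpos : (0 : ℝ) < L := lt_of_lt_of_le (Real.exp_pos _) hL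
  have hL1 : 0 ≤ Real.log L := by
    have := Real.log_le_log (Real.exp_pos _) hL
    rw [Real.log_exp] at this
    exact le_trans (by positivity) this
  cases n with
  | zero =>
    have := Real.log_le_log (Real.exp_pos _) hL
    rw [Real.log_exp] at this
    simpa [lam] using this
  | succ n =>
    have hl : (1 : ℝ) ≤ lam (qq κ n0) n := by exact_mod_cast lam_pos (qq κ n0) n
    have e : Real.log ((L * lam (qq κ n0) (n + 1) : ℕ) : ℝ) =
        Real.log L + (qq κ n0 n * Real.log 9 + Real.log (lam (qq κ n0) n)) := by
      rw [lam]
      push_cast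
      rw [Real.log_mul hLpos.ne' (by positivity), Real.log_mul (by positivity) (by positivity),
        Real.log_pow]
    rw [e]
    have h1 : 0 ≤ Real.log (lam (qq κ n0) n : ℝ) := Real.log_nonneg hl
    have h9 : (2 : ℝ) ≤ Real.log 9 := by
      have : Real.log 9 = 2 * Real.log 3 := by
        rw [show (9 : ℝ) = 3 ^ 2 by norm_num, Real.log_pow]; norm_num
      have h3 : 1 ≤ Real.log 3 := by
        rw [Real.le_log_iff_exp_le (by norm_num)]
        have := Real.exp_one_lt_d9; linarith
      linarith
    have h2 : ((n + 1 + n0 : ℕ) : ℝ) ^ κ ≤ 2 * (qq κ n0 n : ℝ) := by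
      have := hC (n + n0) (by omega)
      rw [show n + 1 + n0 = n + n0 + 1 by ring]
      unfold qq
      exact_mod_cast this
    have h3 : (0 : ℝ) ≤ qq κ n0 n := by positivity
    nlinarith

theorem exp_fP_le {a b : ℝ} {P : ℝ → Measure (Config d)} (Ax : Axioms d a b P) {κ n0 L : ℕ}
    (hκ : 1 ≤ κ * Ax.εP) (hn0 : 2 ≤ n0) (hL : Real.exp ((n0 : ℝ) ^ κ) ≤ L) (hLP : Ax.LP ≤ L)
    (hC : ∀ s ≥ n0, (s + 1) ^ κ ≤ 2 * s ^ κ) (n : ℕ) :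
    Real.exp (-(Ax.fP (L * lam (qq κ n0) n))) ≤ Real.exp (-(2 * (3 / 2) ^ (n + n0))) := by
  rw [Real.exp_le_exp, neg_le_neg_iff]
  have h1 := log_lam_ge hL hC n
  have h2 := Ax.fP_lb (L * lam (qq κ n0) n)
    (hLP.trans (Nat.le_mul_of_pos_right _ (lam_pos _ _)))
  refine le_trans ?_ h2
  refine (numD (s := n + n0) (by omega)).trans (Real.exp_le_exp.2 ?_)
  have h3 : (1 : ℝ) ≤ ((n + n0 : ℕ) : ℝ) := by exact_mod_cast (by omega : 1 ≤ n + n0)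
  calc ((n + n0 : ℕ) : ℝ) = ((n + n0 : ℕ) : ℝ) ^ (1 : ℝ) := by simp
    _ ≤ ((n + n0 : ℕ) : ℝ) ^ (κ * Ax.εP) := Real.rpow_le_rpow_of_exponent_le h3 hκ
    _ = (((n + n0 : ℕ) : ℝ) ^ κ) ^ Ax.εP := by
        rw [Real.rpow_mul (by positivity), Real.rpow_natCast]
    _ ≤ _ := Real.rpow_le_rpow (by positivity) h1 Ax.εP_pos.le

theorem num_final {κ n0 : ℕ} {e : ℕ → ℝ}
    (hA : ∀ s ≥ n0, 2 * ((2 * (3 * 9 ^ (s ^ κ)) + 1 : ℕ) : ℝ) ^ (2 * d) ≤ Real.exp (1 / 2 * (3 / 2) ^ s))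
    (he : ∀ n, e n ≤ Real.exp (-(2 * (3 / 2) ^ (n + n0)))) (n : ℕ) :
    ((2 * (3 * 9 ^ qq κ n0 n) + 1 : ℕ) : ℝ) ^ (2 * d) *
      (Real.exp (-(3 / 2) ^ (n + n0)) * Real.exp (-(3 / 2) ^ (n + n0)) + e n) ≤
      Real.exp (-(3 / 2) ^ (n + 1 + n0)) := by
  have h1 := hA (n + n0) (by omega)
  have h2 : Real.exp (-(3 / 2) ^ (n + n0)) * Real.exp (-(3 / 2) ^ (n + n0)) + e n ≤
      2 * Real.exp (-(2 * (3 / 2) ^ (n + n0))) := by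
    rw [← Real.exp_add]
    have := he n
    have e1 : (-(3 / 2 : ℝ) ^ (n + n0) + -(3 / 2) ^ (n + n0)) = (-(2 * (3 / 2) ^ (n + n0))) := by ring
    rw [e1]; linarith
  have e3 : Real.exp (-(3 / 2 : ℝ) ^ (n + 1 + n0)) =
      Real.exp (1 / 2 * (3 / 2) ^ (n + n0)) * Real.exp (-(2 * (3 / 2) ^ (n + n0))) := by
    rw [← Real.exp_add]; congr 1
    rw [show n + 1 + n0 = n + n0 + 1 by ring, pow_succ]; ring
  rw [e3]
  unfold qq
  calc ((2 * (3 * 9 ^ (n + n0) ^ κ) + 1 : ℕ) : ℝ) ^ (2 * d) *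
      (Real.exp (-(3 / 2) ^ (n + n0)) * Real.exp (-(3 / 2) ^ (n + n0)) + e n)
      ≤ ((2 * (3 * 9 ^ (n + n0) ^ κ) + 1 : ℕ) : ℝ) ^ (2 * d) *
        (2 * Real.exp (-(2 * (3 / 2) ^ (n + n0)))) := by gcongr
    _ = (2 * ((2 * (3 * 9 ^ (n + n0) ^ κ) + 1 : ℕ) : ℝ) ^ (2 * d)) *
        Real.exp (-(2 * (3 / 2) ^ (n + n0))) := by ring
    _ ≤ _ := by gcongr



theorem half_pow_bounds {δ : ℝ} (hδ : 0 < δ) (n : ℕ) :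
    0 < δ * (1 / 2 : ℝ) ^ n ∧ δ * (1 / 2 : ℝ) ^ n ≤ δ := by
  have h1 : (1 / 2 : ℝ) ^ n ≤ 1 := pow_le_one₀ (by norm_num) (by norm_num)
  constructor
  · positivity
  · nlinarith

theorem hier_dec {a b : ℝ} {P : ℝ → Measure (Config d)} (Ax : Axioms d a b P) {κ n0 L : ℕ}
    (hκ : 1 ≤ κ * Ax.εP) (hn0 : 2 ≤ n0) (hL : Real.exp ((n0 : ℝ) ^ κ) ≤ L) (hLP : Ax.LP ≤ L)
    (hC : ∀ s ≥ n0, (s + 1) ^ κ ≤ 2 * s ^ κ)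
    (hA : ∀ s ≥ n0, 2 * ((2 * (3 * 9 ^ (s ^ κ)) + 1 : ℕ) : ℝ) ^ (2 * d) ≤ Real.exp (1 / 2 * (3 / 2) ^ s))
    {δ : ℝ} (hδ : 0 < δ) (hδ1 : δ < 1)
    (hB : ∀ s ≥ n0, 2 * (((3 ^ (s ^ κ) : ℕ) : ℝ)) ^ (-Ax.χP) ≤ δ * (1 / 2) ^ (s + 1))
    (hRP : ∀ s ≥ n0, Ax.RP ≤ 3 ^ (s ^ κ))
    (h : ℝ) {u : ℝ} (hu0 : 0 < u) (hu : u ∈ Set.Ioo a b) (hu' : u * (1 - δ) ∈ Set.Ioo a b)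
    (hseed : ∀ x, (P (u * (1 - δ))).real {ω | ¬ GoodInc ω L h x} ≤ Real.exp (-(3 / 2) ^ n0))
    (n : ℕ) (x : Pt d) :
    (P u).real {ω | BadH (qq κ n0) {x | ¬ GoodInc ω L h x} n x} ≤ Real.exp (-(3 / 2) ^ (n + n0)) := by
  let v : ℕ → ℝ := fun n => u * (1 - δ * (1 / 2) ^ n)
  have hvlt : ∀ n, v n < u := fun n => by
    have := (half_pow_bounds hδ n).1
    simp only [v]; nlinarith
  have hvge : ∀ n, u * (1 - δ) ≤ v n := fun n => by
    have := (half_pow_bounds hδ n).2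
    simp only [v]; nlinarith
  have hv : ∀ n, v n ∈ Set.Ioo a b := fun n =>
    ⟨lt_of_lt_of_le hu'.1 (hvge n), (hvlt n).trans hu.2⟩
  have hq1 : ∀ n, 1 ≤ qq κ n0 n := fun n => Nat.one_le_pow _ _ (by omega)
  have hL1 : 1 ≤ L := by
    have : (0 : ℝ) < L := lt_of_lt_of_le (Real.exp_pos _) hL
    exact_mod_cast this
  have hdep := dep_BadH hq1 (L := L) (fun ω : Config d => {x | ¬ GoodInc ω L h x})
    (fun x => (dep_Good L h x).1)
  have hmeas := meas_BadH hq1 (L := L) (fun ω : Config d => {x | ¬ GoodInc ω L h x})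
    (fun x => (dep_Good L h x).1)
  have hdecr : ∀ n x, DecreasingEvent {ω : Config d | BadH (qq κ n0) {x | ¬ GoodInc ω L h x} n x} := by
    intro n x ω ω' hle hω
    have hsub : {x | ¬ GoodInc ω L h x} ⊆ {x | ¬ GoodInc ω' L h x} := by
      intro y (hy : ¬ GoodInc ω L h y) (hg : GoodInc ω' L h y)
      exact hy (GoodInc_mono hle hg)
    exact BadH_mono hsub n x hω
  have key := rec_bound (qq κ n0) (fun n => P (v n)) (fun n => Ax.prob _ (hv n))
    (fun ω : Config d => {x | ¬ GoodInc ω L h x})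
    (fun n => Real.exp (-(Ax.fP (L * lam (qq κ n0) n))))
    (fun n => Real.exp (-(3 / 2) ^ (n + n0)))
    (fun x => by simpa [v] using hseed x)
    (fun n x₁ x₂ h12 => by
      refine Ax.decoupleDec (3 ^ qq κ n0 n) (L * lam (qq κ n0) n) (hRP _ (by omega))
        (Nat.mul_pos hL1 (lam_pos _ _)) (sc (L * lam (qq κ n0) n) x₁) (sc (L * lam (qq κ n0) n) x₂)
        ?_ (v (n + 1)) (v n) (hv n) (hv (n + 1)) ?_ ?_ _ _ (hmeas n x₁) (hmeas n x₂)
        (hdecr n x₁) (hdecr n x₂) (hdep n x₁) (hdep n x₂)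
      · rw [distInf_sc, mul_comm]; exact Nat.mul_le_mul_left _ h12
      · have := (half_pow_bounds hδ n).1
        simp only [v, pow_succ]; nlinarith
      · have h1 := hB (n + n0) (by omega)
        have h2 : δ * (1 / 2 : ℝ) ^ (n + n0 + 1) ≤ δ * (1 / 2) ^ (n + 1) := by
          refine mul_le_mul_of_nonneg_left (pow_le_pow_of_le_one (by norm_num) (by norm_num) ?_) hδ.le
          omega
        have h3 : 0 ≤ (((3 ^ ((n + n0) ^ κ) : ℕ) : ℝ)) ^ (-Ax.χP) := by positivity
        have h4 := hvlt n
        have e : v (n + 1) = v n + u * (δ * (1 / 2) ^ (n + 1)) := by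
          simp only [v, pow_succ]; ring
        rw [e]
        have h5 : (((3 ^ ((n + n0) ^ κ) : ℕ) : ℝ)) ^ (-Ax.χP) * v n ≤ u * (δ * (1 / 2) ^ (n + 1)) := by
          calc (((3 ^ ((n + n0) ^ κ) : ℕ) : ℝ)) ^ (-Ax.χP) * v n
              ≤ (((3 ^ ((n + n0) ^ κ) : ℕ) : ℝ)) ^ (-Ax.χP) * u := by gcongr
            _ ≤ (δ * (1 / 2) ^ (n + 1)) * u := by
                refine mul_le_mul_of_nonneg_right ?_ hu0.le
                linarith
            _ = _ := by ring
        have e2 : (1 + (((3 ^ ((n + n0) ^ κ) : ℕ) : ℝ)) ^ (-Ax.χP)) * v n =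
          v n + (((3 ^ ((n + n0) ^ κ) : ℕ) : ℝ)) ^ (-Ax.χP) * v n := by ring
        unfold qq
        linarith)
    (fun n => (Real.exp_pos _).le)
    (fun n => num_final hA (exp_fP_le Ax hκ hn0 hL hLP hC) n) n x
  refine le_trans ?_ key
  have hpu := Ax.prob u hu
  have hpv := Ax.prob _ (hv n)
  -- monotonicity for decreasing events through complements
  have hm := Ax.mono (v n) (hv n) u hu (hvlt n).le _ (hmeas n x).compl (fun ω ω' hle hω hc =>
    hω (hdecr n x ω' ω hle hc))
  have h1 : (P (v n)).real {ω | BadH (qq κ n0) {x | ¬ GoodInc ω L h x} n x}ᶜ ≤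
      (P u).real {ω | BadH (qq κ n0) {x | ¬ GoodInc ω L h x} n x}ᶜ :=
    ENNReal.toReal_mono (measure_ne_top _ _) hm
  rw [probReal_compl_eq_one_sub (hmeas n x), probReal_compl_eq_one_sub (hmeas n x)] at h1
  linarith

theorem hier_inc {a b : ℝ} {P : ℝ → Measure (Config d)} (Ax : Axioms d a b P) {κ n0 L : ℕ}
    (hκ : 1 ≤ κ * Ax.εP) (hn0 : 2 ≤ n0) (hL : Real.exp ((n0 : ℝ) ^ κ) ≤ L) (hLP : Ax.LP ≤ L)
    (hC : ∀ s ≥ n0, (s + 1) ^ κ ≤ 2 * s ^ κ)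
    (hA : ∀ s ≥ n0, 2 * ((2 * (3 * 9 ^ (s ^ κ)) + 1 : ℕ) : ℝ) ^ (2 * d) ≤ Real.exp (1 / 2 * (3 / 2) ^ s))
    {δ : ℝ} (hδ : 0 < δ) (hδ1 : δ < 1)
    (hB : ∀ s ≥ n0, 2 * (((3 ^ (s ^ κ) : ℕ) : ℝ)) ^ (-Ax.χP) ≤ δ * (1 / 2) ^ (s + 1))
    (hRP : ∀ s ≥ n0, Ax.RP ≤ 3 ^ (s ^ κ))
    (h : ℝ) {u : ℝ} (hu0 : 0 < u) (hu : u ∈ Set.Ioo a b) (hu' : u * (1 + δ) ∈ Set.Ioo a b)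
    (hseed : ∀ x, (P (u * (1 + δ))).real {ω | ¬ GoodDec ω L h x} ≤ Real.exp (-(3 / 2) ^ n0))
    (n : ℕ) (x : Pt d) :
    (P u).real {ω | BadH (qq κ n0) {x | ¬ GoodDec ω L h x} n x} ≤ Real.exp (-(3 / 2) ^ (n + n0)) := by
  let v : ℕ → ℝ := fun n => u * (1 + δ * (1 / 2) ^ n)
  have hvlt : ∀ n, u < v n := fun n => by
    have := (half_pow_bounds hδ n).1
    simp only [v]; nlinarith
  have hvge : ∀ n, v n ≤ u * (1 + δ) := fun n => by
    have := (half_pow_bounds hδ n).2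
    simp only [v]; nlinarith
  have hv : ∀ n, v n ∈ Set.Ioo a b := fun n =>
    ⟨hu.1.trans (hvlt n), lt_of_le_of_lt (hvge n) hu'.2⟩
  have hq1 : ∀ n, 1 ≤ qq κ n0 n := fun n => Nat.one_le_pow _ _ (by omega)
  have hL1 : 1 ≤ L := by
    have : (0 : ℝ) < L := lt_of_lt_of_le (Real.exp_pos _) hL
    exact_mod_cast this
  have hdep := dep_BadH hq1 (L := L) (fun ω : Config d => {x | ¬ GoodDec ω L h x})
    (fun x => (dep_Good L h x).2)
  have hmeas := meas_BadH hq1 (L := L) (fun ω : Config d => {x | ¬ GoodDec ω L h x})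
    (fun x => (dep_Good L h x).2)
  have hincr : ∀ n x, IncreasingEvent {ω : Config d | BadH (qq κ n0) {x | ¬ GoodDec ω L h x} n x} := by
    intro n x ω ω' hle hω
    have hsub : {x | ¬ GoodDec ω L h x} ⊆ {x | ¬ GoodDec ω' L h x} := by
      intro y (hy : ¬ GoodDec ω L h y) (hg : GoodDec ω' L h y)
      exact hy (GoodDec_anti hle hg)
    exact BadH_mono hsub n x hω
  have key := rec_bound (qq κ n0) (fun n => P (v n)) (fun n => Ax.prob _ (hv n))
    (fun ω : Config d => {x | ¬ GoodDec ω L h x})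
    (fun n => Real.exp (-(Ax.fP (L * lam (qq κ n0) n))))
    (fun n => Real.exp (-(3 / 2) ^ (n + n0)))
    (fun x => by simpa [v] using hseed x)
    (fun n x₁ x₂ h12 => by
      refine Ax.decoupleInc (3 ^ qq κ n0 n) (L * lam (qq κ n0) n) (hRP _ (by omega))
        (Nat.mul_pos hL1 (lam_pos _ _)) (sc (L * lam (qq κ n0) n) x₁) (sc (L * lam (qq κ n0) n) x₂)
        ?_ (v n) (v (n + 1)) (hv (n + 1)) (hv n) ?_ ?_ _ _ (hmeas n x₁) (hmeas n x₂)
        (hincr n x₁) (hincr n x₂) (hdep n x₁) (hdep n x₂)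
      · rw [distInf_sc, mul_comm]; exact Nat.mul_le_mul_left _ h12
      · have := (half_pow_bounds hδ n).1
        simp only [v, pow_succ]; nlinarith
      · have h1 := hB (n + n0) (by omega)
        have h2 : δ * (1 / 2 : ℝ) ^ (n + n0 + 1) ≤ δ * (1 / 2) ^ (n + 1) := by
          refine mul_le_mul_of_nonneg_left (pow_le_pow_of_le_one (by norm_num) (by norm_num) ?_) hδ.le
          omega
        have h3 : 0 ≤ (((3 ^ ((n + n0) ^ κ) : ℕ) : ℝ)) ^ (-Ax.χP) := by positivity
        have h4 : v (n + 1) ≤ 2 * u := by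
          have := hvge (n + 1)
          nlinarith
        have e : v n = v (n + 1) + u * (δ * (1 / 2) ^ (n + 1)) := by
          simp only [v, pow_succ]; ring
        rw [e]
        have h5 : (((3 ^ ((n + n0) ^ κ) : ℕ) : ℝ)) ^ (-Ax.χP) * v (n + 1) ≤ u * (δ * (1 / 2) ^ (n + 1)) := by
          calc (((3 ^ ((n + n0) ^ κ) : ℕ) : ℝ)) ^ (-Ax.χP) * v (n + 1)
              ≤ (((3 ^ ((n + n0) ^ κ) : ℕ) : ℝ)) ^ (-Ax.χP) * (2 * u) := by gcongr
            _ = (2 * (((3 ^ ((n + n0) ^ κ) : ℕ) : ℝ)) ^ (-Ax.χP)) * u := by ring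
            _ ≤ (δ * (1 / 2) ^ (n + 1)) * u := by
                refine mul_le_mul_of_nonneg_right ?_ hu0.le
                linarith
            _ = _ := by ring
        have e2 : (1 + (((3 ^ ((n + n0) ^ κ) : ℕ) : ℝ)) ^ (-Ax.χP)) * v (n + 1) =
          v (n + 1) + (((3 ^ ((n + n0) ^ κ) : ℕ) : ℝ)) ^ (-Ax.χP) * v (n + 1) := by ring
        unfold qq
        linarith)
    (fun n => (Real.exp_pos _).le)
    (fun n => num_final hA (exp_fP_le Ax hκ hn0 hL hLP hC) n) n x
  refine le_trans ?_ key
  have hpu := Ax.prob u hu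
  have hpv := Ax.prob _ (hv n)
  exact ENNReal.toReal_mono (measure_ne_top _ _)
    (Ax.mono u hu (v n) (hv n) (hvlt n).le _ (hmeas n x) (hincr n x))



/-! ### Mean ergodic theorem and densities -/

theorem birk_coe {α : Type*} [MeasurableSpace α] {μ : Measure α} [IsProbabilityMeasure μ] {T : α → α}
    (hT : MeasurePreserving T μ μ) {f : α → ℝ} (hf : MemLp f 2 μ) (n : ℕ) :
    (birkhoffAverage ℝ (Lp.compMeasurePreserving T hT : Lp ℝ 2 μ → Lp ℝ 2 μ) id n (hf.toLp f) : Lp ℝ 2 μ) =ᵐ[μ]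
      fun x => (n : ℝ)⁻¹ * ∑ i ∈ Finset.range n, f (T^[i] x) := by
  unfold birkhoffAverage birkhoffSum
  refine (Lp.coeFn_smul _ _).trans ?_
  have h2 : (∑ k ∈ Finset.range n, id ((Lp.compMeasurePreserving T hT)^[k] (hf.toLp f)) : Lp ℝ 2 μ)
      =ᵐ[μ] fun x => ∑ i ∈ Finset.range n, f (T^[i] x) := by
    induction n with
    | zero => simp only [Finset.range_zero, Finset.sum_empty]; exact Lp.coeFn_zero _ _ _
    | succ n ih =>
      rw [Finset.sum_range_succ]
      refine (Lp.coeFn_add _ _).trans ?_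
      have h3 : (id ((Lp.compMeasurePreserving T hT)^[n] (hf.toLp f)) : Lp ℝ 2 μ) =ᵐ[μ]
          fun x => f (T^[n] x) := by
        rw [Lp.compMeasurePreserving_iterate, id, Lp.toLp_compMeasurePreserving]
        exact MemLp.coeFn_toLp _
      filter_upwards [ih, h3] with x hx1 hx2
      simp only [Pi.add_apply, hx1, hx2, Finset.sum_range_succ]
  filter_upwards [h2] with x hx
  simp only [Pi.smul_apply, smul_eq_mul, hx]

theorem meanErg {α : Type*} [MeasurableSpace α] {μ : Measure α} [IsProbabilityMeasure μ] {T : α → α}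
    (hT : Ergodic T μ) {f : α → ℝ} (hf : MemLp f 2 μ) :
    Tendsto (fun n : ℕ => ∫ x, |(n : ℝ)⁻¹ * ∑ i ∈ Finset.range n, f (T^[i] x) - ∫ y, f y ∂μ| ∂μ)
      atTop (nhds 0) := by
  let U : Lp ℝ 2 μ →L[ℝ] Lp ℝ 2 μ :=
    (Lp.compMeasurePreservingₗᵢ ℝ T hT.toMeasurePreserving).toContinuousLinearMap
  have hU : ‖U‖ ≤ 1 := LinearIsometry.norm_toContinuousLinearMap_le _
  have h1 := ContinuousLinearMap.tendsto_birkhoffAverage_orthogonalProjection U hU (hf.toLp f)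
  obtain ⟨G, hG, hGU⟩ : ∃ G : Lp ℝ 2 μ, U G = G ∧ Tendsto (birkhoffAverage ℝ U id · (hf.toLp f)) atTop (nhds G) :=
    ⟨_, ((U.eqLocus (1 : Lp ℝ 2 μ →L[ℝ] Lp ℝ 2 μ)).orthogonalProjectionOnto (hf.toLp f)).2, h1⟩
  have hcomp : (G : α → ℝ) ∘ T =ᵐ[μ] G := by
    have := Lp.coeFn_compMeasurePreserving G hT.toMeasurePreserving
    refine this.symm.trans ?_
    have e : Lp.compMeasurePreserving T hT.toMeasurePreserving G = G := hG
    rw [e]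
  obtain ⟨c, hc⟩ := hT.ae_eq_const_of_ae_eq_comp_ae (Lp.aestronglyMeasurable G) hcomp
  have hmem : ∀ n : ℕ, MemLp (fun x => (n : ℝ)⁻¹ * ∑ i ∈ Finset.range n, f (T^[i] x)) 2 μ := fun n =>
    (memLp_finsetSum _ fun i _ => hf.comp_measurePreserving (hT.toMeasurePreserving.iterate i)).const_mul _
  have hlim : Tendsto (fun n : ℕ => ∫ x, |(n : ℝ)⁻¹ * ∑ i ∈ Finset.range n, f (T^[i] x) - c| ∂μ)
      atTop (nhds 0) := by
    have h2 := (tendsto_iff_norm_sub_tendsto_zero.1 hGU)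
    refine squeeze_zero (fun n => integral_nonneg fun x => abs_nonneg _) (fun n => ?_) h2
    have hb := birk_coe hT.toMeasurePreserving hf n
    have hm2 : MemLp (fun x => (n : ℝ)⁻¹ * ∑ i ∈ Finset.range n, f (T^[i] x) - c) 2 μ :=
      (hmem n).sub (memLp_const c)
    have e1 : ‖birkhoffAverage ℝ U id n (hf.toLp f) - G‖ =
        (eLpNorm (fun x => (n : ℝ)⁻¹ * ∑ i ∈ Finset.range n, f (T^[i] x) - c) 2 μ).toReal := by
      rw [Lp.norm_def]
      congr 1
      refine eLpNorm_congr_ae ?_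
      refine (Lp.coeFn_sub _ _).trans ?_
      have hb' : (birkhoffAverage ℝ U id n (hf.toLp f) : Lp ℝ 2 μ) =ᵐ[μ]
        fun x => (n : ℝ)⁻¹ * ∑ i ∈ Finset.range n, f (T^[i] x) := hb
      filter_upwards [hb', hc] with x hx hx2
      simp [hx, hx2]
    rw [e1]
    have e2 : ∫ x, |(n : ℝ)⁻¹ * ∑ i ∈ Finset.range n, f (T^[i] x) - c| ∂μ =
        (eLpNorm (fun x => (n : ℝ)⁻¹ * ∑ i ∈ Finset.range n, f (T^[i] x) - c) 1 μ).toReal := by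
      rw [eLpNorm_one_eq_lintegral_enorm, ← integral_norm_eq_lintegral_enorm hm2.1]
      rfl
    rw [e2]
    exact ENNReal.toReal_mono hm2.2.ne (eLpNorm_le_eLpNorm_of_exponent_le (by norm_num) hm2.1)
  have hIntegr : ∀ n : ℕ, 1 ≤ n → ∫ x, (n : ℝ)⁻¹ * ∑ i ∈ Finset.range n, f (T^[i] x) ∂μ = ∫ y, f y ∂μ := by
    intro n hn
    rw [integral_const_mul, integral_finsetSum]
    · have : ∀ i ∈ Finset.range n, ∫ x, f (T^[i] x) ∂μ = ∫ y, f y ∂μ := by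
        intro i _
        have hi := hT.toMeasurePreserving.iterate i
        have := integral_map (μ := μ) (φ := T^[i]) hi.measurable.aemeasurable (f := f)
          (by rw [hi.map_eq]; exact hf.1)
        rw [hi.map_eq] at this
        exact this.symm
      rw [Finset.sum_congr rfl this]
      have : (n : ℝ) ≠ 0 := by positivity
      simp; field_simp
    · intro i _
      exact (hf.comp_measurePreserving (hT.toMeasurePreserving.iterate i)).integrable (by norm_num)
  have hceq : ∫ y, f y ∂μ = c := by
    have h3 : Tendsto (fun _ : ℕ => |∫ y, f y ∂μ - c|) atTop (nhds 0) := by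
      refine squeeze_zero' (Eventually.of_forall fun n => abs_nonneg _) ?_ hlim
      filter_upwards [eventually_ge_atTop 1] with n hn
      have hi := (hmem n).integrable (q := 2) (by norm_num)
      have e3 : ∫ y, f y ∂μ - c = ∫ x, ((n : ℝ)⁻¹ * ∑ i ∈ Finset.range n, f (T^[i] x) - c) ∂μ := by
        rw [integral_sub hi (integrable_const c), hIntegr n hn]; simp
      rw [e3]
      exact abs_integral_le_integral_abs
    have h4 := tendsto_nhds_unique h3 tendsto_const_nhds
    have := abs_eq_zero.1 h4.symm
    linarith
  rw [hceq]
  exact hlim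

theorem shift_iterate (e : Pt d) (j : ℕ) (ω : Config d) : (shift e)^[j] ω = shift (j • e) ω := by
  induction j with
  | zero => simp [shift_zero]
  | succ j ih => rw [Function.iterate_succ_apply', ih, shift_shift, succ_nsmul]

theorem box_sum (i0 : Fin d) (L : ℕ) (y : Pt d) (g : Pt d → ℝ) :
    ∑ p ∈ box L y, g p = ∑ p ∈ (box L y).filter (fun p => p i0 = L * y i0),
      ∑ j ∈ Finset.range L, g (p + j • Pi.single i0 1) := by
  classical
  rw [← Finset.sum_product']
  symm
  have hval : ∀ (p : Pt d) (j : ℕ) (i : Fin d),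
      (p + j • (Pi.single i0 1 : Pt d)) i = if i = i0 then p i + j else p i := by
    intro p j i
    by_cases h : i = i0
    · subst h; simp
    · simp [h]
  refine Finset.sum_nbij' (fun z => z.1 + z.2 • Pi.single i0 1)
    (fun v => (Function.update v i0 (L * y i0), (v i0 - L * y i0).toNat)) ?_ ?_ ?_ ?_ ?_
  · rintro ⟨p, j⟩ hz
    simp only [Finset.mem_product, Finset.mem_filter, Finset.mem_range] at hz
    obtain ⟨⟨hp, hp0⟩, hj⟩ := hz
    rw [mem_box] at hp ⊢
    intro i
    have := hp i
    rw [hval]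
    dsimp only
    split_ifs with h
    · subst h; omega
    · exact this
  · intro v hv
    rw [mem_box] at hv
    simp only [Finset.mem_product, Finset.mem_filter, Finset.mem_range, mem_box]
    refine ⟨⟨fun i => ?_, by simp⟩, ?_⟩
    · by_cases h : i = i0
      · subst h
        have := hv i
        simp only [Function.update_self]; omega
      · simpa [h] using hv i
    · have := hv i0; omega
  · rintro ⟨p, j⟩ hz
    simp only [Finset.mem_product, Finset.mem_filter, Finset.mem_range] at hz
    obtain ⟨⟨hp, hp0⟩, hj⟩ := hz
    ext1
    · funext i
      by_cases h : i = i0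
      · subst h; simp [hp0]
      · simp [h]
    · simp only [hval, if_true]; omega
  · intro v hv
    rw [mem_box] at hv
    funext i
    simp only [hval]
    split_ifs with h
    · subst h
      have := hv i
      simp only [Function.update_self]; omega
    · simp [h]
  · intro z _; rfl

/-- stationary and ergodic measures -/
structure Stat (μ : Measure (Config d)) : Prop where
  prob : IsProbabilityMeasure μ
  mp : ∀ x, MeasurePreserving (shift x) μ μ
  erg : ∀ x, x ≠ 0 → Ergodic (shift x) μ

theorem Axioms.stat {a b : ℝ} {P : ℝ → Measure (Config d)} (Ax : Axioms d a b P) {u : ℝ}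
    (hu : u ∈ Set.Ioo a b) : Stat (P u) := by
  refine ⟨Ax.prob u hu, fun x => ?_, fun x hx => Ax.ergodic u hu x hx⟩
  by_cases h : x = 0
  · subst h; rw [shift_zero]; exact MeasurePreserving.id _
  · exact (Ax.ergodic u hu x h).toMeasurePreserving

/-- indicator that `p ∈ S_∞` -/
noncomputable def iS (p : Pt d) (ω : Config d) : ℝ := Set.indicator {ω | p ∈ Sinf ω} 1 ω

theorem iS_shift (c p : Pt d) (ω : Config d) : iS p (shift c ω) = iS (c + p) ω := by
  unfold iS
  by_cases h : c + p ∈ Sinf ω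
  · have h' := (Sinf_shift c ω p).2 h
    simp [Set.indicator, h, h']
  · have h' := (Sinf_shift c ω p).not.2 h
    simp [Set.indicator, h, h']

theorem meas_iS (p : Pt d) : Measurable (iS p : Config d → ℝ) :=
  measurable_one.indicator (meas_Sinf p)

theorem iS_mem (p : Pt d) (ω : Config d) : 0 ≤ iS p ω ∧ iS p ω ≤ 1 := by
  unfold iS Set.indicator
  split_ifs <;> simp

theorem memLp_iS {μ : Measure (Config d)} [IsProbabilityMeasure μ] (p : Pt d) (r : ℝ≥0∞) :
    MemLp (iS p) r μ :=
  MemLp.of_bound (meas_iS p).aestronglyMeasurable 1 (Eventually.of_forall fun ω => by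
    have := iS_mem p ω
    rw [Real.norm_eq_abs, abs_le]; constructor <;> linarith)

theorem sum_iS (F : Finset (Pt d)) (ω : Config d) :
    ∑ p ∈ F, iS p ω = ({v | v ∈ F ∧ v ∈ Sinf ω}.ncard : ℝ) := by
  classical
  have : {v | v ∈ F ∧ v ∈ Sinf ω} = ((F.filter fun v => v ∈ Sinf ω : Finset (Pt d)) : Set (Pt d)) := by
    ext v; simp
  rw [this, Set.ncard_coe_finset, Finset.card_filter]
  push_cast
  refine Finset.sum_congr rfl fun p _ => ?_
  simp only [iS, Set.indicator, Set.mem_ofPred_eq, Pi.one_apply]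

theorem integral_iS {μ : Measure (Config d)} : ∫ ω, iS 0 ω ∂μ = eta d μ := by
  unfold iS
  rw [integral_indicator (meas_Sinf 0)]
  simp [eta, Measure.real]

theorem density (hd : 2 ≤ d) {μ : Measure (Config d)} (hμ : Stat μ) :
    ∃ e : ℕ → ℝ, Tendsto e atTop (nhds 0) ∧ ∀ L : ℕ, 1 ≤ L → ∀ y : Pt d,
      ∫ ω, |({v | v ∈ box L y ∧ v ∈ Sinf ω}.ncard : ℝ) - (L : ℝ) ^ d * eta d μ| ∂μ ≤ e L * (L : ℝ) ^ d := by
  have := hμ.prob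
  let i0 : Fin d := ⟨0, by omega⟩
  let e1 : Pt d := Pi.single i0 1
  have he1 : e1 ≠ 0 := by
    intro h
    have := congrFun h i0
    simp [e1] at this
  refine ⟨_, meanErg (hμ.erg e1 he1) (memLp_iS (μ := μ) 0 2), fun L hL y => ?_⟩
  have hLr : (0 : ℝ) < L := by exact_mod_cast hL
  set face := (box L y).filter (fun p => p i0 = L * y i0) with hface
  have hcard : (face.card : ℝ) * L = (L : ℝ) ^ d := by
    have h := box_sum i0 L y (fun _ => 1)
    simp only [Finset.sum_const, Finset.card_range, nsmul_eq_mul, mul_one, card_box] at h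
    push_cast at h
    linarith
  rw [integral_iS]
  simp_rw [shift_iterate, iS_shift, ← sum_iS]
  simp only [add_zero]
  set H : Config d → ℝ := fun ω => |(L : ℝ)⁻¹ * ∑ i ∈ Finset.range L, iS (i • e1) ω - eta d μ| with hH
  have hHm : MemLp H 1 μ := by
    have : MemLp (fun ω => (L : ℝ)⁻¹ * ∑ i ∈ Finset.range L, iS (i • e1) ω - eta d μ) 1 μ :=
      ((memLp_finsetSum _ fun i _ => memLp_iS _ _).const_mul _).sub (memLp_const _)
    exact this.abs
  have hHint : ∀ p : Pt d, ∫ ω, H (shift p ω) ∂μ = ∫ ω, H ω ∂μ := by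
    intro p
    have h := integral_map (μ := μ) (φ := shift p) (hμ.mp p).measurable.aemeasurable (f := H)
      (by rw [(hμ.mp p).map_eq]; exact hHm.1)
    rw [(hμ.mp p).map_eq] at h
    exact h.symm
  have hpt : ∀ ω, |∑ p ∈ box L y, iS p ω - (L : ℝ) ^ d * eta d μ| ≤ ∑ p ∈ face, (L : ℝ) * H (shift p ω) := by
    intro ω
    have e : ∑ p ∈ box L y, iS p ω - (L : ℝ) ^ d * eta d μ =
        ∑ p ∈ face, (L : ℝ) * ((L : ℝ)⁻¹ * ∑ i ∈ Finset.range L, iS (i • e1) (shift p ω) - eta d μ) := by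
      have e0 : (L : ℝ) ^ d * eta d μ = ∑ p ∈ face, (L : ℝ) * eta d μ := by
        rw [Finset.sum_const, nsmul_eq_mul, ← hcard]; ring
      rw [box_sum i0 L y, e0, ← hface, ← Finset.sum_sub_distrib]
      refine Finset.sum_congr rfl fun p _ => ?_
      simp_rw [iS_shift]
      field_simp
      rfl
    rw [e]
    refine (Finset.abs_sum_le_sum_abs _ _).trans (Finset.sum_le_sum fun p _ => ?_)
    rw [abs_mul, abs_of_pos hLr]
  have hI : ∀ p : Pt d, Integrable (fun ω => (L : ℝ) * H (shift p ω)) μ := fun p =>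
    ((hHm.comp_measurePreserving (hμ.mp p)).integrable le_rfl).const_mul _
  calc ∫ ω, |∑ p ∈ box L y, iS p ω - (L : ℝ) ^ d * eta d μ| ∂μ
      ≤ ∫ ω, ∑ p ∈ face, (L : ℝ) * H (shift p ω) ∂μ := by
        refine integral_mono ?_ (integrable_finsetSum _ fun p _ => hI p) hpt
        exact (((memLp_finsetSum _ fun i _ => memLp_iS _ 1).sub (memLp_const _)).abs).integrable le_rfl
    _ = ∑ p ∈ face, ∫ ω, (L : ℝ) * H (shift p ω) ∂μ := integral_finsetSum _ fun p _ => hI p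
    _ = ∑ p ∈ face, (L : ℝ) * ∫ ω, H ω ∂μ := by
        refine Finset.sum_congr rfl fun p _ => ?_
        rw [integral_const_mul, hHint]
    _ = (∫ ω, H ω ∂μ) * (L : ℝ) ^ d := by
        rw [Finset.sum_const, nsmul_eq_mul, ← hcard]; ring
    _ ≤ _ := le_rfl



/-! ### Seed estimates -/

theorem density_prob (hd : 2 ≤ d) {μ : Measure (Config d)} (hμ : Stat μ) {c : ℝ} (hc : 0 < c) :
    ∃ e : ℕ → ℝ, Tendsto e atTop (nhds 0) ∧ ∀ L : ℕ, 1 ≤ L → ∀ y : Pt d,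
      μ.real {ω | c * (L : ℝ) ^ d ≤
        |({v | v ∈ box L y ∧ v ∈ Sinf ω}.ncard : ℝ) - (L : ℝ) ^ d * eta d μ|} ≤ e L := by
  have := hμ.prob
  obtain ⟨e, he, hb⟩ := density hd hμ
  refine ⟨fun L => e L / c, by simpa using he.div_const c, fun L hL y => ?_⟩
  have hLp : (0 : ℝ) < (L : ℝ) ^ d := by
    have : (0 : ℝ) < L := by exact_mod_cast hL
    positivity
  have hIntegr : Integrable (fun ω : Config d =>
      |({v | v ∈ box L y ∧ v ∈ Sinf ω}.ncard : ℝ) - (L : ℝ) ^ d * eta d μ|) μ := by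
    simp_rw [← sum_iS]
    exact (((memLp_finsetSum _ fun i _ => memLp_iS _ 1).sub (memLp_const _)).abs).integrable le_rfl
  have h1 := mul_meas_ge_le_integral_of_nonneg (μ := μ)
    (Eventually.of_forall fun ω => abs_nonneg _) hIntegr (c * (L : ℝ) ^ d)
  have h2 := h1.trans (hb L hL y)
  rw [le_div_iff₀ hc]
  have h3 : (L : ℝ) ^ d * (μ.real {ω | c * (L : ℝ) ^ d ≤
        |({v | v ∈ box L y ∧ v ∈ Sinf ω}.ncard : ℝ) - (L : ℝ) ^ d * eta d μ|} * c) ≤ (L : ℝ) ^ d * e L := by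
    linarith
  exact le_of_mul_le_mul_left h3 hLp

theorem Stat.real_preimage {μ : Measure (Config d)} (hμ : Stat μ) (c : Pt d) {E : Set (Config d)}
    (hE : MeasurableSet E) : μ.real (shift c ⁻¹' E) = μ.real E := by
  unfold Measure.real
  rw [(hμ.mp c).measure_preimage hE.nullMeasurableSet]

theorem seedInc (hd : 2 ≤ d) {μ : Measure (Config d)} (hμ : Stat μ) {η₀ : ℝ} (hη : 0 < η₀)
    (hημ : 9 * η₀ ≤ 10 * eta d μ) (g : ℕ → ℝ) (hg : Tendsto g atTop atTop)
    (hU : ∀ R : ℕ, 1 ≤ R → 1 - Real.exp (-(g R)) ≤ μ.real (locUniq2 d R)) {ε : ℝ} (hε : 0 < ε) :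
    ∀ᶠ L : ℕ in atTop, ∀ x : Pt d, μ.real {ω | ¬ GoodInc ω L (η₀ * (L : ℝ) ^ d) x} ≤ ε := by
  have := hμ.prob
  obtain ⟨e, he, hb⟩ := density_prob hd hμ (c := 3 / 20 * η₀) (by positivity)
  have hlim : Tendsto (fun L : ℕ => Real.exp (-(g (2 * L))) + ((2 * 1 + 1) ^ d : ℕ) * e L) atTop
      (nhds (0 + ((2 * 1 + 1) ^ d : ℕ) * 0)) := by
    refine Tendsto.add ?_ (he.const_mul _)
    refine Real.tendsto_exp_neg_atTop_nhds_zero.comp (hg.comp ?_)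
    exact tendsto_id.const_mul_atTop' (by norm_num)
  have hev := hlim.eventually (gt_mem_nhds (show _ < ε by simpa using hε))
  filter_upwards [hev, eventually_ge_atTop 1] with L hL hL1 x
  refine le_trans ?_ hL.le
  have hLp : (0 : ℝ) < (L : ℝ) ^ d := by
    have : (0 : ℝ) < L := by exact_mod_cast hL1
    positivity
  have hsub : {ω | ¬ GoodInc ω L (η₀ * (L : ℝ) ^ d) x} ⊆
      shift (sc L x) ⁻¹' (locUniq2 d (2 * L))ᶜ ∪ ⋃ y ∈ ballF x 1, {ω | 3 / 20 * η₀ * (L : ℝ) ^ d ≤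
        |({v | v ∈ box L y ∧ v ∈ Sinf ω}.ncard : ℝ) - (L : ℝ) ^ d * eta d μ|} := by
    intro ω hω
    by_contra hcon
    simp only [Set.mem_union, Set.mem_preimage, Set.mem_compl_iff, not_or, not_not, Set.mem_iUnion,
      Set.mem_ofPred_eq, not_exists, not_le, mem_ballF] at hcon
    obtain ⟨hu, hy⟩ := hcon
    have hlu := locUniq2_shift hu
    have hlow : ∀ y, distInf x y ≤ 1 →
        3 * (η₀ * (L : ℝ) ^ d) ≤ 4 * ({v | v ∈ box L y ∧ v ∈ Sinf ω}.ncard : ℝ) := by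
      intro y hxy
      have h1 := (abs_lt.1 (hy y hxy)).1
      have h2 : (L : ℝ) ^ d * (9 * η₀) ≤ (L : ℝ) ^ d * (10 * eta d μ) :=
        mul_le_mul_of_nonneg_left hημ hLp.le
      nlinarith
    have hne : {v | v ∈ box L x ∧ v ∈ Sinf ω}.Nonempty := by
      rw [Set.nonempty_iff_ne_empty]
      intro h0
      have := hlow x (by simp)
      rw [h0] at this
      simp at this
      nlinarith [mul_pos hη hLp]
    obtain ⟨p, hpb, hpS⟩ := hne
    have hin : ∀ y, distInf x y ≤ 1 → ∀ v ∈ box L y, v ∈ Sinf ω →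
        v ∈ Sr ω (((2 * L : ℕ) : ℝ) / 10) ∩ ballZ (sc L x) (2 * L) := by
      intro y hxy v hv hvS
      refine ⟨Sinf_subset_Sr ω _ hvS, ?_⟩
      rw [mem_ballZ]
      have h1 := box_dist hv
      have h2 := distInf_triangle (sc L x) (sc L y) v
      rw [distInf_sc] at h2
      have h3 : L * distInf x y ≤ L * 1 := Nat.mul_le_mul_left _ hxy
      omega
    refine hω ⟨p, fun y hxy => (hlow y hxy).trans ?_⟩
    refine mul_le_mul_of_nonneg_left (Nat.cast_le.2 (Set.ncard_le_ncard ?_ ?_)) (by norm_num)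
    · rintro v ⟨h1, h2⟩
      refine ⟨h1, (Sinf_iff ω v).1 h2 L, ?_⟩
      have := hlu p (hin x (by simp) p hpb hpS) v (hin y hxy v h1 h2)
      rw [show 2 * (2 * L) = 4 * L by ring] at this
      exact this
    · exact (box L y).finite_toSet.subset fun v hv => hv.1
  calc μ.real {ω | ¬ GoodInc ω L (η₀ * (L : ℝ) ^ d) x}
      ≤ μ.real (shift (sc L x) ⁻¹' (locUniq2 d (2 * L))ᶜ ∪ ⋃ y ∈ ballF x 1, {ω | 3 / 20 * η₀ * (L : ℝ) ^ d ≤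
        |({v | v ∈ box L y ∧ v ∈ Sinf ω}.ncard : ℝ) - (L : ℝ) ^ d * eta d μ|}) :=
        measureReal_mono hsub (measure_ne_top _ _)
    _ ≤ _ := measureReal_union_le _ _
    _ ≤ _ := by
      refine add_le_add ?_ ?_
      · rw [hμ.real_preimage _ (meas_locUniq2 _).compl, probReal_compl_eq_one_sub (meas_locUniq2 _)]
        have := hU (2 * L) (by omega)
        linarith
      · refine (measureReal_biUnion_finset_le _ _).trans ?_
        refine (Finset.sum_le_sum fun y _ => hb L hL1 y).trans ?_
        rw [Finset.sum_const, card_ballF, nsmul_eq_mul]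

theorem Vs_diff_prob {μ : Measure (Config d)} [IsProbabilityMeasure μ] :
    Tendsto (fun L : ℕ => μ.real {ω : Config d | (0 : Pt d) ∈ Vs ω L \ Sinf ω}) atTop (nhds 0) := by
  have h1 : Tendsto (fun L : ℕ => μ {ω : Config d | (0 : Pt d) ∈ Vs ω L \ Sinf ω}) atTop (nhds (μ ∅)) := by
    refine tendsto_measure_of_tendsto_indicator_of_isFiniteMeasure atTop μ
      (fun L => (meas_Vs 0 L).diff (meas_Sinf 0)) fun ω => ?_
    by_cases hS : (0 : Pt d) ∈ Sinf ω
    · exact Eventually.of_forall fun L => by simp [hS]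
    · have hfin : (cluster (SS ω) (0 : Pt d)).Finite := by
        by_contra hinf
        have hinf : (cluster (SS ω) (0 : Pt d)).Infinite := hinf
        obtain ⟨z, hz⟩ := hinf.nonempty
        exact hS ⟨hz.1, hinf⟩
      obtain ⟨M, hM⟩ := (hfin.image (fun y => distInf 0 y)).bddAbove
      filter_upwards [eventually_gt_atTop M] with L hL
      simp only [Set.mem_sdiff, Set.mem_ofPred_eq, Set.mem_empty_iff_false, iff_false, not_and, not_not]
      rintro ⟨z, hz1, hz2⟩
      have := hM ⟨z, connIn_mono Set.inter_subset_left hz2, rfl⟩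
      simp only at this
      omega
  have h2 := (ENNReal.tendsto_toReal (measure_ne_top μ ∅)).comp h1
  rw [measure_empty, ENNReal.toReal_zero] at h2
  exact h2

/-- indicator of `Vs \ Sinf` -/
noncomputable def iV (L : ℕ) (p : Pt d) (ω : Config d) : ℝ := Set.indicator {ω | p ∈ Vs ω L \ Sinf ω} 1 ω

theorem seedDec (hd : 2 ≤ d) {μ : Measure (Config d)} (hμ : Stat μ) {η₀ : ℝ} (hη : 0 < η₀)
    (hημ : 10 * eta d μ ≤ 11 * η₀) {ε : ℝ} (hε : 0 < ε) :
    ∀ᶠ L : ℕ in atTop, ∀ x : Pt d, μ.real {ω | ¬ GoodDec ω L (η₀ * (L : ℝ) ^ d) x} ≤ ε := by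
  classical
  have := hμ.prob
  obtain ⟨e, he, hb⟩ := density_prob hd hμ (c := 1 / 20 * η₀) (by positivity)
  have hlim : Tendsto (fun L : ℕ => e L + μ.real {ω : Config d | (0 : Pt d) ∈ Vs ω L \ Sinf ω} / (1 / 20 * η₀))
      atTop (nhds (0 + 0 / (1 / 20 * η₀))) := he.add (Vs_diff_prob.div_const _)
  have hev := hlim.eventually (gt_mem_nhds (show _ < ε by simpa using hε))
  filter_upwards [hev, eventually_ge_atTop 1] with L hL hL1 x
  refine le_trans ?_ hL.le
  have hLp : (0 : ℝ) < (L : ℝ) ^ d := by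
    have : (0 : ℝ) < L := by exact_mod_cast hL1
    positivity
  have hVm : ∀ p : Pt d, MeasurableSet {ω : Config d | p ∈ Vs ω L \ Sinf ω} := fun p =>
    (meas_Vs p L).diff (meas_Sinf p)
  have hcount : ∀ ω, ({v | v ∈ box L x ∧ v ∈ Vs ω L}.ncard : ℝ) ≤
      ({v | v ∈ box L x ∧ v ∈ Sinf ω}.ncard : ℝ) + ∑ p ∈ box L x, iV L p ω := by
    intro ω
    have h1 : ∑ p ∈ box L x, iV L p ω = ({v | v ∈ box L x ∧ v ∈ Vs ω L \ Sinf ω}.ncard : ℝ) := by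
      have : {v | v ∈ box L x ∧ v ∈ Vs ω L \ Sinf ω} =
          (((box L x).filter fun v => v ∈ Vs ω L \ Sinf ω : Finset (Pt d)) : Set (Pt d)) := by
        ext v; simp
      rw [this, Set.ncard_coe_finset, Finset.card_filter]
      push_cast
      refine Finset.sum_congr rfl fun p _ => ?_
      simp only [iV, Set.indicator, Set.mem_ofPred_eq, Pi.one_apply]
    rw [h1]
    have hfin : ∀ Q : Pt d → Prop, {v | v ∈ box L x ∧ Q v}.Finite := fun Q =>
      (box L x).finite_toSet.subset fun v hv => hv.1
    have h2 : {v | v ∈ box L x ∧ v ∈ Vs ω L} ⊆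
        {v | v ∈ box L x ∧ v ∈ Sinf ω} ∪ {v | v ∈ box L x ∧ v ∈ Vs ω L \ Sinf ω} := by
      rintro v ⟨h1, h2⟩
      by_cases hv : v ∈ Sinf ω
      · exact Or.inl ⟨h1, hv⟩
      · exact Or.inr ⟨h1, h2, hv⟩
    have h3 := (Set.ncard_le_ncard h2 ((hfin _).union (hfin _))).trans (Set.ncard_union_le _ _)
    exact_mod_cast h3
  have hsub : {ω | ¬ GoodDec ω L (η₀ * (L : ℝ) ^ d) x} ⊆
      {ω | 1 / 20 * η₀ * (L : ℝ) ^ d ≤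
        |({v | v ∈ box L x ∧ v ∈ Sinf ω}.ncard : ℝ) - (L : ℝ) ^ d * eta d μ|} ∪
      {ω | 1 / 20 * η₀ * (L : ℝ) ^ d ≤ ∑ p ∈ box L x, iV L p ω} := by
    intro ω hω
    by_contra hcon
    simp only [Set.mem_union, not_or, Set.mem_ofPred_eq, not_le] at hcon
    obtain ⟨h1, h2⟩ := hcon
    have h3 := (abs_lt.1 h1).2
    have h4 := hcount ω
    have h5 : (L : ℝ) ^ d * (10 * eta d μ) ≤ (L : ℝ) ^ d * (11 * η₀) :=
        mul_le_mul_of_nonneg_left hημ hLp.le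
    have h6 := mul_pos hη hLp
    refine hω ?_
    unfold GoodDec
    nlinarith
  have hiV : ∀ p : Pt d, Integrable (iV L p) μ := fun p =>
    (integrable_const (1 : ℝ)).indicator (hVm p)
  have hV : μ.real {ω | 1 / 20 * η₀ * (L : ℝ) ^ d ≤ ∑ p ∈ box L x, iV L p ω} ≤
      μ.real {ω : Config d | (0 : Pt d) ∈ Vs ω L \ Sinf ω} / (1 / 20 * η₀) := by
    have h1 := mul_meas_ge_le_integral_of_nonneg (μ := μ) (f := fun ω => ∑ p ∈ box L x, iV L p ω)
      (Eventually.of_forall fun ω => Finset.sum_nonneg fun p _ =>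
        Set.indicator_nonneg (fun _ _ => zero_le_one) _)
      (integrable_finsetSum _ fun p _ => hiV p) (1 / 20 * η₀ * (L : ℝ) ^ d)
    have h2 : ∫ ω, ∑ p ∈ box L x, iV L p ω ∂μ =
        (L : ℝ) ^ d * μ.real {ω : Config d | (0 : Pt d) ∈ Vs ω L \ Sinf ω} := by
      rw [integral_finsetSum _ fun p _ => hiV p]
      have : ∀ p ∈ box L x, ∫ ω, iV L p ω ∂μ = μ.real {ω : Config d | (0 : Pt d) ∈ Vs ω L \ Sinf ω} := by
        intro p _
        unfold iV
        rw [integral_indicator (hVm p)]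
        have e : {ω : Config d | p ∈ Vs ω L \ Sinf ω} =
            shift p ⁻¹' {ω : Config d | (0 : Pt d) ∈ Vs ω L \ Sinf ω} := by
          ext ω
          simp only [Set.mem_ofPred_eq, Set.mem_preimage, Set.mem_sdiff, Vs_shift, Sinf_shift, add_zero]
        rw [← hμ.real_preimage p (hVm 0), ← e]
        simp
      rw [Finset.sum_congr rfl this, Finset.sum_const, card_box, nsmul_eq_mul]
      push_cast; rfl
    rw [h2] at h1
    rw [le_div_iff₀ (by positivity)]
    refine le_of_mul_le_mul_left ?_ hLp
    linarith
  calc _ ≤ _ := measureReal_mono hsub (measure_ne_top _ _)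
    _ ≤ _ := measureReal_union_le _ _
    _ ≤ _ := add_le_add (hb L hL1 x) hV



/-! ### Choice of parameters -/

theorem fS_tendsto {a b : ℝ} {P : ℝ → Measure (Config d)} (Ax : Axioms d a b P) {u : ℝ}
    (hu : u ∈ Set.Ioo a b) : Tendsto (Ax.fS u) atTop atTop := by
  have h1 : Tendsto (fun R : ℕ => (Real.log R) ^ (1 + Ax.ΔS u)) atTop atTop :=
    (tendsto_rpow_atTop (by have := Ax.ΔS_pos u hu; linarith)).comp
      (Real.tendsto_log_atTop.comp tendsto_natCast_atTop_atTop)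
  refine tendsto_atTop_mono' _ ?_ h1
  filter_upwards [eventually_ge_atTop (Ax.RS u)] with R hR
  exact Ax.fS_lb u hu R hR

theorem setup (hd : 2 ≤ d) {a b : ℝ} (ha : 0 ≤ a)
    {P : ℝ → Measure (Config d)} (Ax : Axioms d a b P) {u : ℝ} (hu : u ∈ Set.Ioo a b) :
    ∃ κ n0 L : ℕ, ∃ h : ℝ, 2 ≤ κ ∧ 5 ≤ n0 ∧ 1 ≤ L ∧ 0 < h ∧
      (∀ n : ℕ, ((n + n0 : ℕ) : ℝ) ^ κ ≤ Real.log ((L * lam (qq κ n0) n : ℕ) : ℝ)) ∧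
      (∀ (n : ℕ) (x : Pt d), (P u).real {ω | BadH (qq κ n0) {x | ¬ GoodInc ω L h x} n x} ≤
        Real.exp (-(3 / 2) ^ (n + n0))) ∧
      (∀ (n : ℕ) (x : Pt d), (P u).real {ω | BadH (qq κ n0) {x | ¬ GoodDec ω L h x} n x} ≤
        Real.exp (-(3 / 2) ^ (n + n0))) := by
  have hu0 : 0 < u := lt_of_le_of_lt ha hu.1
  -- κ
  obtain ⟨κ, hκ2, hκ⟩ : ∃ κ : ℕ, 2 ≤ κ ∧ 1 ≤ κ * Ax.εP := by
    obtain ⟨k, hk⟩ := exists_nat_ge (1 / Ax.εP)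
    refine ⟨max 2 k, le_max_left _ _, ?_⟩
    have : (k : ℝ) ≤ (max 2 k : ℕ) := by exact_mod_cast le_max_right _ _
    have h2 := hk.trans this
    rwa [div_le_iff₀ Ax.εP_pos] at h2
  -- δ
  have hη := Ax.S2pos u hu
  set η₀ := eta d (P u) with hη₀
  have hcont : ContinuousAt (fun u => eta d (P u)) u :=
    Ax.S2cont.continuousAt (Ioo_mem_nhds hu.1 hu.2)
  obtain ⟨δ, hδ, hδ1, hm, hp, hem, hep⟩ : ∃ δ : ℝ, 0 < δ ∧ δ < 1 ∧ u * (1 - δ) ∈ Set.Ioo a b ∧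
      u * (1 + δ) ∈ Set.Ioo a b ∧ 9 * η₀ ≤ 10 * eta d (P (u * (1 - δ))) ∧
      10 * eta d (P (u * (1 + δ))) ≤ 11 * η₀ := by
    have hA : ∀ᶠ v in nhds u, v ∈ Set.Ioo a b ∧ 9 / 10 * η₀ < eta d (P v) ∧ eta d (P v) < 11 / 10 * η₀ := by
      have h1 := hcont.eventually (Ioo_mem_nhds (show 9 / 10 * η₀ < η₀ by linarith)
        (show η₀ < 11 / 10 * η₀ by linarith))
      filter_upwards [Ioo_mem_nhds hu.1 hu.2, h1] with v h1 h2
      exact ⟨h1, h2.1, h2.2⟩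
    have t1 : Tendsto (fun δ : ℝ => u * (1 - δ)) (nhds 0) (nhds u) := by
      have : Continuous (fun δ : ℝ => u * (1 - δ)) := by fun_prop
      simpa using this.tendsto 0
    have t2 : Tendsto (fun δ : ℝ => u * (1 + δ)) (nhds 0) (nhds u) := by
      have : Continuous (fun δ : ℝ => u * (1 + δ)) := by fun_prop
      simpa using this.tendsto 0
    have hB : ∀ᶠ δ in nhdsWithin (0 : ℝ) (Set.Ioi 0), 0 < δ ∧ δ < 1 ∧
        (u * (1 - δ) ∈ Set.Ioo a b ∧ 9 / 10 * η₀ < eta d (P (u * (1 - δ))) ∧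
          eta d (P (u * (1 - δ))) < 11 / 10 * η₀) ∧
        (u * (1 + δ) ∈ Set.Ioo a b ∧ 9 / 10 * η₀ < eta d (P (u * (1 + δ))) ∧
          eta d (P (u * (1 + δ))) < 11 / 10 * η₀) := by
      filter_upwards [self_mem_nhdsWithin, nhdsWithin_le_nhds (gt_mem_nhds (zero_lt_one' ℝ)),
        nhdsWithin_le_nhds (t1.eventually hA), nhdsWithin_le_nhds (t2.eventually hA)] with δ h1 h2 h3 h4
      exact ⟨h1, h2, h3, h4⟩
    obtain ⟨δ, h1, h2, h3, h4⟩ := hB.exists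
    exact ⟨δ, h1, h2, h3.1, h4.1, by linarith [h3.2.1], by linarith [h4.2.2]⟩
  -- n0
  obtain ⟨n0, hn0⟩ := eventually_atTop.1 ((numA d κ).and ((numB κ hκ2 Ax.χP_pos hδ).and
    ((numC κ).and ((eventually_ge_atTop Ax.RP).and (eventually_ge_atTop 5)))))
  have hn05 : 5 ≤ n0 := (hn0 n0 le_rfl).2.2.2.2
  -- L
  have hε : 0 < Real.exp (-(3 / 2 : ℝ) ^ n0) := Real.exp_pos _
  have s1 := seedInc hd (Ax.stat hm) hη hem (Ax.fS _) (fS_tendsto Ax hm)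
    (fun R hR => Ax.S1b _ hm R hR) hε
  have s2 := seedDec hd (Ax.stat hp) hη hep hε
  obtain ⟨L, hL1, hL2, hL3, hL4, hL5⟩ := (s1.and (s2.and ((eventually_ge_atTop Ax.LP).and
    ((eventually_ge_atTop 1).and (tendsto_natCast_atTop_atTop.eventually
      (eventually_ge_atTop (Real.exp ((n0 : ℝ) ^ κ)))))))).exists
  have hC : ∀ s ≥ n0, (s + 1) ^ κ ≤ 2 * s ^ κ := fun s hs => (hn0 s hs).2.2.1
  have hRP : ∀ s ≥ n0, Ax.RP ≤ 3 ^ (s ^ κ) := fun s hs => by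
    have h1 := (hn0 s hs).2.2.2.1
    have h2 : s ≤ s ^ κ := Nat.le_self_pow (by omega) s
    have h3 : s ^ κ < 3 ^ (s ^ κ) := Nat.lt_pow_self (by norm_num)
    omega
  refine ⟨κ, n0, L, η₀ * (L : ℝ) ^ d, hκ2, hn05, hL4, ?_, ?_, ?_, ?_⟩
  · have : (0 : ℝ) < L := by exact_mod_cast hL4
    positivity
  · exact log_lam_ge hL5 hC
  · exact hier_dec Ax hκ (by omega) hL5 hL3 hC (fun s hs => (hn0 s hs).1) hδ hδ1
      (fun s hs => (hn0 s hs).2.1) hRP _ hu0 hu hm hL1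
  · exact hier_inc Ax hκ (by omega) hL5 hL3 hC (fun s hs => (hn0 s hs).1) hδ hδ1
      (fun s hs => (hn0 s hs).2.1) hRP _ hu0 hu hp hL2

/-- upper bounds on the scales -/
theorem log_lam_le {κ n0 L : ℕ} (hL : 1 ≤ L) (n : ℕ) :
    Real.log ((L * lam (qq κ n0) n : ℕ) : ℝ) ≤ Real.log L + 3 * ((n + n0 : ℕ) : ℝ) ^ (κ + 1) := by
  have hLpos : (0 : ℝ) < L := by exact_mod_cast hL
  have h9 : Real.log 9 ≤ 3 := by
    have := Real.log_le_sub_one_of_pos (show (0 : ℝ) < 3 by norm_num)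
    have e : Real.log 9 = 2 * Real.log 3 := by
      rw [show (9 : ℝ) = 3 ^ 2 by norm_num, Real.log_pow]; norm_num
    have h3 : Real.log 3 ≤ 3 / 2 := by
      rw [Real.log_le_iff_le_exp (by norm_num)]
      have h1 : (5 / 2 : ℝ) ≤ Real.exp 1 := by have := Real.exp_one_gt_d9; linarith
      have h2 : (3 / 2 : ℝ) ≤ Real.exp (1 / 2) := by
        have := Real.add_one_le_exp (1 / 2 : ℝ); linarith
      have : Real.exp (3 / 2) = Real.exp 1 * Real.exp (1 / 2) := by rw [← Real.exp_add]; norm_num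
      rw [this]; nlinarith
    linarith
  have key : Real.log ((L * lam (qq κ n0) n : ℕ) : ℝ) ≤
      Real.log L + 3 * (n * ((n + n0 : ℕ) : ℝ) ^ κ) := by
    induction n with
    | zero => simp [lam]
    | succ n ih =>
      have hl : (0 : ℝ) < lam (qq κ n0) n := by exact_mod_cast lam_pos (qq κ n0) n
      have e : Real.log ((L * lam (qq κ n0) (n + 1) : ℕ) : ℝ) =
          qq κ n0 n * Real.log 9 + Real.log ((L * lam (qq κ n0) n : ℕ) : ℝ) := by
        rw [lam]
        push_cast
        rw [Real.log_mul hLpos.ne' (by positivity), Real.log_mul (by positivity) (by positivity),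
          Real.log_pow, Real.log_mul hLpos.ne' hl.ne']
        ring
      rw [e]
      have h1 : (qq κ n0 n : ℝ) = ((n + n0 : ℕ) : ℝ) ^ κ := by unfold qq; push_cast; rfl
      have h2 : ((n + n0 : ℕ) : ℝ) ^ κ ≤ ((n + 1 + n0 : ℕ) : ℝ) ^ κ := by
        gcongr; omega
      have h3 : (0 : ℝ) ≤ ((n + n0 : ℕ) : ℝ) ^ κ := by positivity
      rw [h1]
      push_cast at *
      have h5 : ((n : ℝ) + n0) ^ κ * Real.log 9 ≤ 3 * ((n : ℝ) + 1 + n0) ^ κ := by nlinarith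
      have h6 : (n : ℝ) * ((n : ℝ) + n0) ^ κ ≤ n * ((n : ℝ) + 1 + n0) ^ κ := by gcongr
      linarith
  refine key.trans ?_
  rw [pow_succ]
  have h1 : (n : ℝ) ≤ ((n + n0 : ℕ) : ℝ) := by push_cast; linarith [(Nat.cast_nonneg n0 : (0 : ℝ) ≤ n0)]
  have h3 : (0 : ℝ) ≤ ((n + n0 : ℕ) : ℝ) ^ κ := by positivity
  nlinarith

theorem log_lam_succ_le {κ n0 L : ℕ} (hL : 1 ≤ L) {n : ℕ}
    (h : ((n + n0 : ℕ) : ℝ) ^ κ ≤ Real.log ((L * lam (qq κ n0) n : ℕ) : ℝ)) :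
    Real.log ((L * lam (qq κ n0) (n + 1) : ℕ) : ℝ) ≤ 4 * Real.log ((L * lam (qq κ n0) n : ℕ) : ℝ) := by
  have hLpos : (0 : ℝ) < L := by exact_mod_cast hL
  have h9 : Real.log 9 ≤ 3 := by
    rw [Real.log_le_iff_le_exp (by norm_num)]
    have h1 : (5 / 2 : ℝ) ≤ Real.exp 1 := by have := Real.exp_one_gt_d9; linarith
    have : Real.exp 3 = Real.exp 1 * Real.exp 1 * Real.exp 1 := by
      rw [← Real.exp_add, ← Real.exp_add]; norm_num
    rw [this]
    nlinarith [mul_le_mul h1 h1 (by norm_num) (Real.exp_pos 1).le]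
  have hl : (0 : ℝ) < lam (qq κ n0) n := by exact_mod_cast lam_pos (qq κ n0) n
  have e : Real.log ((L * lam (qq κ n0) (n + 1) : ℕ) : ℝ) =
      qq κ n0 n * Real.log 9 + Real.log ((L * lam (qq κ n0) n : ℕ) : ℝ) := by
    rw [lam]
    push_cast
    rw [Real.log_mul hLpos.ne' (by positivity), Real.log_mul (by positivity) (by positivity),
      Real.log_pow, Real.log_mul hLpos.ne' hl.ne']
    ring
  rw [e]
  have h1 : (qq κ n0 n : ℝ) = ((n + n0 : ℕ) : ℝ) ^ κ := by unfold qq; push_cast; rfl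
  have h3 : (0 : ℝ) ≤ ((n + n0 : ℕ) : ℝ) ^ κ := by positivity
  rw [h1]
  nlinarith



/-! ### Borel–Cantelli -/

/-- the radius of the region controlled at level `N` -/
def MM (d κ n0 L m N : ℕ) : ℕ :=
  2 * (L * lam (qq κ n0) (N + 1)) ^ m + 5 * ((8 * 5 ^ d + 20) * (L * lam (qq κ n0) N))

theorem LL_mono {κ n0 L : ℕ} (N : ℕ) : L * lam (qq κ n0) N ≤ L * lam (qq κ n0) (N + 1) := by
  apply Nat.mul_le_mul_left
  rw [lam]
  exact Nat.le_mul_of_pos_left _ (by positivity)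

theorem MM_bound {κ n0 L m : ℕ} (hL : 1 ≤ L) (hm : 1 ≤ m) {N : ℕ}
    (h : ((N + n0 : ℕ) : ℝ) ^ κ ≤ Real.log ((L * lam (qq κ n0) N : ℕ) : ℝ)) :
    ((2 * MM d κ n0 L m N + 1 : ℕ) : ℝ) ^ d ≤
      Real.exp (d * Real.log ((5 + 10 * (8 * 5 ^ d + 20) : ℕ) : ℝ) +
        4 * m * d * Real.log ((L * lam (qq κ n0) N : ℕ) : ℝ)) := by
  have hpos : 1 ≤ L * lam (qq κ n0) (N + 1) := Nat.mul_pos hL (lam_pos _ _)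
  have h1 : 2 * MM d κ n0 L m N + 1 ≤ (5 + 10 * (8 * 5 ^ d + 20)) * (L * lam (qq κ n0) (N + 1)) ^ m := by
    unfold MM
    have h2 := LL_mono (κ := κ) (n0 := n0) (L := L) N
    have h3 : L * lam (qq κ n0) (N + 1) ≤ (L * lam (qq κ n0) (N + 1)) ^ m :=
      Nat.le_self_pow (by omega) _
    have h4 := Nat.mul_le_mul_left (8 * 5 ^ d + 20) (h2.trans h3)
    have h5 := hpos.trans h3
    generalize (8 * 5 ^ d + 20) = C at *
    generalize (L * lam (qq κ n0) (N + 1)) ^ m = X at *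
    generalize L * lam (qq κ n0) N = Y at *
    nlinarith
  have h2 : ((2 * MM d κ n0 L m N + 1 : ℕ) : ℝ) ≤
      Real.exp (Real.log ((5 + 10 * (8 * 5 ^ d + 20) : ℕ) : ℝ) +
        m * Real.log ((L * lam (qq κ n0) (N + 1) : ℕ) : ℝ)) := by
    rw [Real.exp_add, Real.exp_log (by positivity), ← Real.log_pow, Real.exp_log
      (by have : (0:ℝ) < ((L * lam (qq κ n0) (N + 1) : ℕ) : ℝ) := by exact_mod_cast hpos
          positivity)]
    exact_mod_cast h1
  refine (pow_le_pow_left₀ (by positivity) h2 d).trans ?_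
  rw [← Real.exp_nat_mul]
  apply Real.exp_le_exp.2
  have h3 := log_lam_succ_le hL h
  have h4 : (d : ℝ) * (m * Real.log ((L * lam (qq κ n0) (N + 1) : ℕ) : ℝ)) ≤
      d * (m * (4 * Real.log ((L * lam (qq κ n0) N : ℕ) : ℝ))) := by gcongr
  linarith

theorem bc {a b : ℝ} {P : ℝ → Measure (Config d)} (Ax : Axioms d a b P) {u : ℝ}
    (hu : u ∈ Set.Ioo a b) {κ n0 L m : ℕ} {h : ℝ} (hm : 1 ≤ m) (hκ : 2 ≤ κ) (hn0 : 5 ≤ n0) (hL : 1 ≤ L)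
    (hlog : ∀ n : ℕ, ((n + n0 : ℕ) : ℝ) ^ κ ≤ Real.log ((L * lam (qq κ n0) n : ℕ) : ℝ))
    (hI : ∀ (n : ℕ) (x : Pt d), (P u).real {ω | BadH (qq κ n0) {x | ¬ GoodInc ω L h x} n x} ≤
        Real.exp (-(3 / 2) ^ (n + n0)))
    (hD : ∀ (n : ℕ) (x : Pt d), (P u).real {ω | BadH (qq κ n0) {x | ¬ GoodDec ω L h x} n x} ≤
        Real.exp (-(3 / 2) ^ (n + n0))) :
    ∀ᵐ ω ∂(P u), ∃ N0, ∀ N ≥ N0, ∀ x ∈ ballF (0 : Pt d) (MM d κ n0 L m N),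
      ¬ BadH (qq κ n0) {x | ¬ GoodInc ω L h x} N x ∧
      ¬ BadH (qq κ n0) {x | ¬ GoodDec ω L h x} N x ∧
      shift (sc (L * lam (qq κ n0) N) x) ω ∈ locUniq2 d ((8 * 5 ^ d + 20) * (L * lam (qq κ n0) N)) := by
  have hst := Ax.stat hu
  have hprob := Ax.prob u hu
  set ℓ : ℕ → ℝ := fun n => Real.log ((L * lam (qq κ n0) n : ℕ) : ℝ) with hℓ
  set a' : ℝ := d * Real.log ((5 + 10 * (8 * 5 ^ d + 20) : ℕ) : ℝ) with ha'
  set b' : ℝ := 4 * m * d with hb'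
  have ha0 : 0 ≤ a' := by
    apply mul_nonneg (by positivity); apply Real.log_natCast_nonneg
  have hb0 : 0 ≤ b' := by positivity
  have hs : ∀ n : ℕ, (n : ℝ) ≤ ℓ n := fun n => by
    refine le_trans ?_ (hlog n)
    have : n ≤ (n + n0) ^ κ := (Nat.le_add_right n n0).trans (Nat.le_self_pow (by omega) _)
    exact_mod_cast this
  have hℓt : Tendsto ℓ atTop atTop := tendsto_atTop_mono hs tendsto_natCast_atTop_atTop
  set E : ℕ → Set (Config d) := fun N => ⋃ x ∈ ballF (0 : Pt d) (MM d κ n0 L m N),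
    ({ω | BadH (qq κ n0) {x | ¬ GoodInc ω L h x} N x} ∪
     {ω | BadH (qq κ n0) {x | ¬ GoodDec ω L h x} N x} ∪
     shift (sc (L * lam (qq κ n0) N) x) ⁻¹' (locUniq2 d ((8 * 5 ^ d + 20) * (L * lam (qq κ n0) N)))ᶜ) with hE
  have hEb : ∀ N, (P u).real (E N) ≤ ((2 * MM d κ n0 L m N + 1 : ℕ) : ℝ) ^ d *
      (2 * Real.exp (-(3 / 2) ^ (N + n0)) +
        Real.exp (-(Ax.fS u ((8 * 5 ^ d + 20) * (L * lam (qq κ n0) N))))) := by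
    intro N
    have hR1 : 1 ≤ (8 * 5 ^ d + 20) * (L * lam (qq κ n0) N) :=
      Nat.mul_pos (by positivity) (Nat.mul_pos hL (lam_pos _ _))
    refine (measureReal_biUnion_finset_le _ _).trans ?_
    refine (Finset.sum_le_card_nsmul _ _ (2 * Real.exp (-(3 / 2) ^ (N + n0)) +
        Real.exp (-(Ax.fS u ((8 * 5 ^ d + 20) * (L * lam (qq κ n0) N))))) ?_).trans ?_
    · intro x _
      refine (measureReal_union_le _ _).trans ?_
      have h1 := measureReal_union_le (μ := P u) {ω | BadH (qq κ n0) {x | ¬ GoodInc ω L h x} N x}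
        {ω | BadH (qq κ n0) {x | ¬ GoodDec ω L h x} N x}
      have h2 := hst.real_preimage (sc (L * lam (qq κ n0) N) x)
        (meas_locUniq2 (d := d) ((8 * 5 ^ d + 20) * (L * lam (qq κ n0) N))).compl
      have h3 := Ax.S1b u hu _ hR1
      have h4 := probReal_compl_eq_one_sub (μ := P u)
        (meas_locUniq2 (d := d) ((8 * 5 ^ d + 20) * (L * lam (qq κ n0) N)))
      have h5 : (P u).real (locUniq2 d ((8 * 5 ^ d + 20) * (L * lam (qq κ n0) N))) =
        ((P u) (locUniq2 d ((8 * 5 ^ d + 20) * (L * lam (qq κ n0) N)))).toReal := rfl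
      have := hI N x
      have := hD N x
      rw [h2, h4, h5]
      linarith
    · rw [card_ballF, nsmul_eq_mul]
      push_cast
      rfl
  -- eventual smallness
  have e1 : ∀ᶠ N : ℕ in atTop, ((2 * MM d κ n0 L m N + 1 : ℕ) : ℝ) ^ d * Real.exp (-(3 / 2) ^ (N + n0)) ≤
      Real.exp (-(N : ℝ)) := by
    have := (tendsto_add_atTop_nat n0).eventually
      (poly_exp (a' + b' * Real.log L) (3 * b' + 1) (κ + 1) (zero_lt_one' ℝ))
    filter_upwards [this] with N hN
    refine (mul_le_mul_of_nonneg_right (MM_bound hL hm (hlog N)) (Real.exp_pos _).le).trans ?_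
    rw [← Real.exp_add]
    apply Real.exp_le_exp.2
    have h1 := mul_le_mul_of_nonneg_left (log_lam_le (κ := κ) (n0 := n0) hL N) hb0
    have h2 : (N : ℝ) ≤ ((N + n0 : ℕ) : ℝ) ^ (κ + 1) := by
      have : N ≤ (N + n0) ^ (κ + 1) := (Nat.le_add_right N n0).trans (Nat.le_self_pow (by omega) _)
      exact_mod_cast this
    nlinarith
  have e2 : ∀ᶠ N : ℕ in atTop, ((2 * MM d κ n0 L m N + 1 : ℕ) : ℝ) ^ d *
      Real.exp (-(Ax.fS u ((8 * 5 ^ d + 20) * (L * lam (qq κ n0) N)))) ≤ Real.exp (-(N : ℝ)) := by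
    have hΔ := Ax.ΔS_pos u hu
    have t1 := ((tendsto_rpow_atTop hΔ).comp hℓt).eventually (eventually_ge_atTop (a' + b' + 1))
    filter_upwards [t1, hℓt.eventually (eventually_ge_atTop 1), eventually_ge_atTop (Ax.RS u)] with N h1 h2 h3
    refine (mul_le_mul_of_nonneg_right (MM_bound hL hm (hlog N)) (Real.exp_pos _).le).trans ?_
    rw [← Real.exp_add]
    apply Real.exp_le_exp.2
    have hp : 0 < L * lam (qq κ n0) N := Nat.mul_pos hL (lam_pos _ _)
    have hpR : (0 : ℝ) < ((L * lam (qq κ n0) N : ℕ) : ℝ) := by exact_mod_cast hp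
    have hle : L * lam (qq κ n0) N ≤ (8 * 5 ^ d + 20) * (L * lam (qq κ n0) N) :=
      Nat.le_mul_of_pos_left _ (by positivity)
    have hNL : N ≤ L * lam (qq κ n0) N := by
      have h5 : (N : ℝ) ≤ ((L * lam (qq κ n0) N : ℕ) : ℝ) :=
        (hs N).trans ((Real.log_le_sub_one_of_pos hpR).trans (by linarith))
      exact_mod_cast h5
    have h4 := Ax.fS_lb u hu _ (h3.trans (hNL.trans hle))
    have h5 : ℓ N ≤ Real.log (((8 * 5 ^ d + 20) * (L * lam (qq κ n0) N) : ℕ) : ℝ) :=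
      Real.log_le_log hpR (by exact_mod_cast hle)
    have h6 := Real.rpow_le_rpow (by linarith) h5 (show 0 ≤ 1 + Ax.ΔS u by linarith)
    have h7 : ℓ N ^ (1 + Ax.ΔS u) = ℓ N * ℓ N ^ Ax.ΔS u := by
      rw [Real.rpow_add (by linarith), Real.rpow_one]
    have h1' : a' + b' + 1 ≤ ℓ N ^ Ax.ΔS u := h1
    have h8 := mul_le_mul_of_nonneg_left h1' (show 0 ≤ ℓ N by linarith)
    have h9 := hs N
    have h10 : a' ≤ a' * ℓ N := le_mul_of_one_le_right ha0 h2
    have h11 : ℓ N = Real.log ((L * lam (qq κ n0) N : ℕ) : ℝ) := rfl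
    rw [← h11]
    nlinarith
  obtain ⟨N1, hN1⟩ := eventually_atTop.1 (e1.and e2)
  have hE3 : ∀ n, (P u) (E (n + N1)) ≤ ENNReal.ofReal (3 * Real.exp (-(n : ℝ))) := by
    intro n
    rw [← ofReal_measureReal (measure_ne_top _ _)]
    apply ENNReal.ofReal_le_ofReal
    have h1 := hEb (n + N1)
    obtain ⟨h2, h3⟩ := hN1 (n + N1) (by omega)
    have h4 : Real.exp (-((n + N1 : ℕ) : ℝ)) ≤ Real.exp (-(n : ℝ)) := by
      apply Real.exp_le_exp.2; push_cast; linarith [(Nat.cast_nonneg N1 : (0:ℝ) ≤ N1)]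
    linarith
  have hsum : ∑' n, (P u) (E (n + N1)) ≠ ⊤ := by
    have hs' : Summable (fun n : ℕ => 3 * Real.exp (-(n : ℝ))) := by
      apply Summable.mul_left
      exact Real.summable_exp_neg_nat
    have := hs'.tsum_ofReal_ne_top
    exact ne_top_of_le_ne_top this (ENNReal.tsum_le_tsum hE3)
  filter_upwards [ae_eventually_notMem hsum] with ω hω
  obtain ⟨N2, hN2⟩ := eventually_atTop.1 hω
  refine ⟨N1 + N2, fun N hN x hx => ?_⟩
  have h1 := hN2 (N - N1) (by omega)
  rw [Nat.sub_add_cancel (by omega)] at h1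
  simp only [hE, Set.mem_iUnion, not_exists] at h1
  have h2 := h1 x hx
  refine ⟨fun hc => h2 (Or.inl (Or.inl hc)), fun hc => h2 (Or.inl (Or.inr hc)), ?_⟩
  by_contra hc
  exact h2 (Or.inr hc)



/-! ### Conclusion -/

theorem chemBall_sub (ω : Config d) (R : ℕ) : chemBall ω (0 : Pt d) R ⊆ ballZ 0 R := by
  intro y hy
  have hy' : chemDist (SS ω) 0 y ≤ (R : ℕ∞) := hy
  have hlt : chemDist (SS ω) 0 y < ((R + 1 : ℕ) : ℕ∞) := lt_of_le_of_lt hy' (by exact_mod_cast Nat.lt_succ_self R)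
  unfold chemDist at hlt
  obtain ⟨n, ⟨m, rfl, p, h0, hm, -, hadj⟩, hn⟩ := sInf_lt_iff.1 hlt
  have hmR : m ≤ R := by
    have : m < R + 1 := by exact_mod_cast hn
    omega
  have key : ∀ j, j ≤ m → distInf 0 (p j) ≤ j := by
    intro j
    induction j with
    | zero => intro _; rw [h0, distInf_self]
    | succ j ih =>
      intro hj
      have h1 := ih (by omega)
      have h2 := adj_distInf (hadj j (by omega))
      have h3 := distInf_triangle 0 (p j) (p (j + 1))
      omega
  have := key m le_rfl
  rw [hm] at this
  show distInf 0 y ≤ R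
  omega

theorem Cp_bound {κ n0 : ℕ} (hκ : 2 ≤ κ) (hn0 : 5 ≤ n0) (c : ℝ) (hc : 0 ≤ c) (e N : ℕ) :
    ∏ n ∈ Finset.range N, (1 + c / ((qq κ n0 n : ℝ) - 4)) ^ e ≤
      Real.exp (e * (c * ∑' n : ℕ, 1 / ((n : ℝ) + 1) ^ 2)) := by
  have hsum : Summable (fun n : ℕ => 1 / ((n : ℝ) + 1) ^ 2) := by
    have := (summable_nat_add_iff 1).2 (Real.summable_one_div_nat_pow.2 (show 1 < 2 by norm_num))
    simpa using this
  have hq : ∀ n : ℕ, ((n : ℝ) + 1) ^ 2 ≤ (qq κ n0 n : ℝ) - 4 := by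
    intro n
    have h1 : (n + 5) ^ 2 ≤ qq κ n0 n := by
      unfold qq
      exact (Nat.pow_le_pow_left (by omega) 2).trans (Nat.pow_le_pow_right (by omega) hκ)
    have h2 : ((n : ℝ) + 5) ^ 2 ≤ qq κ n0 n := by exact_mod_cast h1
    nlinarith [(Nat.cast_nonneg n : (0:ℝ) ≤ n)]
  calc ∏ n ∈ Finset.range N, (1 + c / ((qq κ n0 n : ℝ) - 4)) ^ e
      ≤ ∏ n ∈ Finset.range N, Real.exp (e * (c * (1 / ((n : ℝ) + 1) ^ 2))) := by
        apply Finset.prod_le_prod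
        · intro n _
          have : 0 < (qq κ n0 n : ℝ) - 4 := lt_of_lt_of_le (by positivity) (hq n)
          positivity
        · intro n _
          have h4 : 0 < (qq κ n0 n : ℝ) - 4 := lt_of_lt_of_le (by positivity) (hq n)
          rw [Real.exp_nat_mul]
          apply pow_le_pow_left₀ (by positivity)
          have h1 : c / ((qq κ n0 n : ℝ) - 4) ≤ c * (1 / ((n : ℝ) + 1) ^ 2) := by
            rw [mul_one_div]
            exact div_le_div_of_nonneg_left hc (by positivity) (hq n)
          have := Real.add_one_le_exp (c * (1 / ((n : ℝ) + 1) ^ 2))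
          linarith
    _ = Real.exp (e * (c * ∑ n ∈ Finset.range N, 1 / ((n : ℝ) + 1) ^ 2)) := by
        rw [← Real.exp_sum, Finset.mul_sum, Finset.mul_sum]
    _ ≤ _ := by
        apply Real.exp_le_exp.2
        have := hsum.sum_le_tsum (Finset.range N) (fun n _ => by positivity)
        gcongr

theorem edge_pos {ω : Config d} {A : Set (Pt d)} (hA : A ⊆ Sinf ω) (hf : A.Finite) (hne : A.Nonempty) :
    1 ≤ (edgeBd (SS ω) A).ncard := by
  obtain ⟨x, hx⟩ := hne
  have hinf := (hA hx).2
  obtain ⟨y, hy, hyA⟩ := hinf.exists_notMem_finite hf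
  obtain ⟨u, v, h1, h2, h3, -, h5⟩ := connIn_exit hy hx hyA
  exact (Set.ncard_pos (edgeBd_finite _ hf)).2 ⟨(u, v), h1, h2, h5, h3⟩

theorem num1 (hd : 2 ≤ d) {α : ℝ} (hα : 1 ≤ α) {c e l : ℝ} (hl : l ≤ α ^ ((1 : ℝ) / d)) (hc : 0 ≤ c)
    (he : 0 ≤ e) (h : α ≤ c * l * e) : α ^ (((d : ℝ) - 1) / d) ≤ c * e := by
  have hd0 : (d : ℝ) ≠ 0 := by positivity
  have hα0 : 0 < α := by linarith
  have hp : 0 < α ^ ((1 : ℝ) / d) := Real.rpow_pos_of_pos hα0 _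
  have e1 : α ^ (((d : ℝ) - 1) / d) * α ^ ((1 : ℝ) / d) = α := by
    rw [← Real.rpow_add hα0, ← add_div, sub_add_cancel, div_self hd0, Real.rpow_one]
  have h2 : c * l * e ≤ c * e * α ^ ((1 : ℝ) / d) := by
    have := mul_le_mul_of_nonneg_left hl (mul_nonneg hc he)
    linarith
  have h3 : α ^ (((d : ℝ) - 1) / d) * α ^ ((1 : ℝ) / d) ≤ c * e * α ^ ((1 : ℝ) / d) := by
    rw [e1]; exact h.trans h2
  exact le_of_mul_le_mul_right h3 hp

theorem num2 (hd : 2 ≤ d) {n : ℕ} (hn : 1 ≤ n) {α c e D : ℝ} (hα : 0 ≤ α) (hD : 1 ≤ D) (hαn : α ≤ D * n)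
    (hc : 0 ≤ c) (he : 0 ≤ e)
    (h : ∀ t : ℕ, 1 ≤ t → 2 * n ≤ t ^ d → (n : ℝ) ≤ c * t * e) :
    α ^ (((d : ℝ) - 1) / d) ≤ D * (4 * c) * e := by
  have hd0 : (d : ℝ) ≠ 0 := by positivity
  have hd2 : (2 : ℝ) ≤ d := by exact_mod_cast hd
  have hn1 : (1 : ℝ) ≤ n := by exact_mod_cast hn
  set r : ℝ := (2 * (n : ℝ)) ^ ((1 : ℝ) / d) with hr
  have hr1 : 1 ≤ r := Real.one_le_rpow (by linarith) (by positivity)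
  have hrd : r ^ d = 2 * n := by
    rw [hr, ← Real.rpow_natCast, ← Real.rpow_mul (by positivity), one_div_mul_cancel hd0, Real.rpow_one]
  have hr2 : r ≤ 2 * (n : ℝ) ^ ((1 : ℝ) / d) := by
    rw [hr, Real.mul_rpow (by norm_num) (by positivity)]
    have : (2 : ℝ) ^ ((1 : ℝ) / d) ≤ 2 ^ (1 : ℝ) :=
      Real.rpow_le_rpow_of_exponent_le (by norm_num) (by rw [div_le_one (by positivity)]; linarith)
    rw [Real.rpow_one] at this
    gcongr
  have ht := Nat.le_ceil r
  have ht2 := Nat.ceil_lt_add_one (show 0 ≤ r by linarith)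
  have h1 := h ⌈r⌉₊ (by
      have : (1 : ℝ) ≤ ⌈r⌉₊ := by linarith
      exact_mod_cast this) (by
      have : (2 : ℝ) * n ≤ (⌈r⌉₊ : ℝ) ^ d := by
        rw [← hrd]; exact pow_le_pow_left₀ (by linarith) ht d
      exact_mod_cast this)
  have h2 : (n : ℝ) ≤ (4 * c) * (n : ℝ) ^ ((1 : ℝ) / d) * e := by
    refine h1.trans ?_
    have : (⌈r⌉₊ : ℝ) ≤ 4 * (n : ℝ) ^ ((1 : ℝ) / d) := by linarith
    calc c * (⌈r⌉₊ : ℝ) * e ≤ c * (4 * (n : ℝ) ^ ((1 : ℝ) / d)) * e := by gcongr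
      _ = _ := by ring
  have h3 := num1 hd hn1 (le_refl _) (by positivity) he h2
  have hx0 : 0 ≤ ((d : ℝ) - 1) / d := by apply div_nonneg <;> linarith
  have hx1 : ((d : ℝ) - 1) / d ≤ 1 := by rw [div_le_one (by linarith)]; linarith
  calc α ^ (((d : ℝ) - 1) / d) ≤ (D * n) ^ (((d : ℝ) - 1) / d) := Real.rpow_le_rpow hα hαn hx0
    _ = D ^ (((d : ℝ) - 1) / d) * (n : ℝ) ^ (((d : ℝ) - 1) / d) := Real.mul_rpow (by linarith) (by positivity)
    _ ≤ D ^ (1 : ℝ) * (4 * c * e) := by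
        apply mul_le_mul _ h3 (by positivity) (by positivity)
        exact Real.rpow_le_rpow_of_exponent_le hD hx1
    _ = _ := by rw [Real.rpow_one]; ring

theorem LL_ge {κ n0 L : ℕ} (hκ : 2 ≤ κ) (hn0 : 5 ≤ n0) (hL : 1 ≤ L) (N : ℕ) :
    N + 1 ≤ L * lam (qq κ n0) N := by
  induction N with
  | zero => simpa [lam] using hL
  | succ N ih =>
    rw [lam]
    have h1 : 1 ≤ qq κ n0 N := Nat.one_le_pow _ _ (by omega)
    have h2 : 9 ≤ 9 ^ qq κ n0 N := Nat.le_self_pow (by omega) 9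
    have : L * (9 ^ qq κ n0 N * lam (qq κ n0) N) = 9 ^ qq κ n0 N * (L * lam (qq κ n0) N) := by ring
    rw [this]
    nlinarith

theorem final_det (hd : 2 ≤ d) {κ n0 L : ℕ} {h : ℝ} (hκ : 2 ≤ κ) (hn0 : 5 ≤ n0) (hL : 1 ≤ L) (hh : 0 < h)
    (ω : Config d)
    (hω : ∃ N0, ∀ N ≥ N0, ∀ x ∈ ballF (0 : Pt d) (MM d κ n0 L (3 * d ^ 2) N),
      ¬ BadH (qq κ n0) {x | ¬ GoodInc ω L h x} N x ∧
      ¬ BadH (qq κ n0) {x | ¬ GoodDec ω L h x} N x ∧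
      shift (sc (L * lam (qq κ n0) N) x) ω ∈ locUniq2 d ((8 * 5 ^ d + 20) * (L * lam (qq κ n0) N))) :
    ∃ ι > (0:ℝ), ∀ k : ℕ, 1 ≤ k →
          ∀ A : Set (Pt d), A ⊆ Sinf ω ∩ chemBall ω (0 : Pt d) (2*k) →
            (k : ℝ) ^ ((1 : ℝ)/3) ≤ A.ncard →
            ι * (A.ncard : ℝ) ^ (((d : ℝ) - 1) / d) ≤ (edgeBd (SS ω) A).ncard := by
  obtain ⟨N0, hN0⟩ := hω
  set LL : ℕ → ℕ := fun N => L * lam (qq κ n0) N with hLL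
  set m := 3 * d ^ 2 with hm
  have hm1 : 1 ≤ m := Nat.mul_pos (by norm_num) (Nat.pow_pos (by omega))
  have hLL1 : ∀ N, 1 ≤ LL N := fun N => Nat.mul_pos hL (lam_pos _ _)
  set k0 := LL N0 ^ m with hk0
  set Cp : ℝ := Real.exp ((5 ^ d : ℕ) * ((C2 d : ℝ) * ∑' n : ℕ, 1 / ((n : ℝ) + 1) ^ 2)) with hCp
  have hCp0 : 0 < Cp := Real.exp_pos _
  set c0 : ℝ := ((4 * k0 + 1 : ℕ) : ℝ) ^ d with hc0
  set c1 : ℝ := 2 * (4 * (8 * 5 ^ d + 20) + 3) ^ d with hc1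
  set c2 : ℝ := (2 * L ^ d) * (4 * (2 * 2 ^ d * 3 ^ (d + 1) * (Cp * (13 ^ d * d)))) with hc2
  have hc0p : 0 < c0 := by positivity
  have hc1p : 0 < c1 := by positivity
  have hc2p : 0 ≤ c2 := by positivity
  suffices H : ∀ k : ℕ, 1 ≤ k →
          ∀ A : Set (Pt d), A ⊆ Sinf ω ∩ chemBall ω (0 : Pt d) (2*k) →
            (k : ℝ) ^ ((1 : ℝ)/3) ≤ A.ncard →
            (A.ncard : ℝ) ^ (((d : ℝ) - 1) / d) ≤ (c0 + c1 + c2) * (edgeBd (SS ω) A).ncard by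
    refine ⟨(c0 + c1 + c2)⁻¹, by positivity, fun k hk A hA hkA => ?_⟩
    rw [inv_mul_le_iff₀ (by positivity)]
    exact H k hk A hA hkA
  intro k hk A hA hkA
  have hAS : A ⊆ Sinf ω := fun x hx => (hA hx).1
  have hAB : A ⊆ ballZ 0 (2 * k) := fun x hx => chemBall_sub ω _ (hA hx).2
  have hAf : A.Finite := (ballZ_finite _ _).subset hAB
  have hk1 : (1 : ℝ) ≤ k := by exact_mod_cast hk
  have hα1 : (1 : ℝ) ≤ A.ncard := (Real.one_le_rpow hk1 (by norm_num)).trans hkA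
  have hα1' : 1 ≤ A.ncard := by exact_mod_cast hα1
  have hAne : A.Nonempty := (Set.ncard_pos hAf).1 hα1'
  have he1 := edge_pos hAS hAf hAne
  have he1' : (1 : ℝ) ≤ (edgeBd (SS ω) A).ncard := by exact_mod_cast he1
  set e : ℝ := (((edgeBd (SS ω) A).ncard : ℕ) : ℝ) with he
  have hd2 : (2 : ℝ) ≤ d := by exact_mod_cast hd
  rcases lt_or_ge k k0 with hkk | hkk
  · -- small `k`
    have h1 : A.ncard ≤ (4 * k0 + 1) ^ d := by
      have h2 : A ⊆ (ballF (0 : Pt d) (2 * k) : Set (Pt d)) := fun x hx => by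
        exact Finset.mem_coe.2 (mem_ballF.2 (hAB hx))
      have h3 := Set.ncard_le_ncard h2 (Finset.finite_toSet _)
      rw [Set.ncard_coe_finset, card_ballF] at h3
      exact h3.trans (Nat.pow_le_pow_left (by omega) d)
    have h2 : (A.ncard : ℝ) ≤ c0 := by rw [hc0]; exact_mod_cast h1
    have h3 : (A.ncard : ℝ) ^ (((d : ℝ) - 1) / d) ≤ (A.ncard : ℝ) ^ (1 : ℝ) :=
      Real.rpow_le_rpow_of_exponent_le hα1 (by rw [div_le_one (by linarith)]; linarith)
    rw [Real.rpow_one] at h3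
    nlinarith
  · -- large `k`
    obtain ⟨N, hN, hNk, hkN⟩ : ∃ N ≥ N0, LL N ^ m ≤ k ∧ k < LL (N + 1) ^ m := by
      have hex : ∃ j, k < LL (N0 + j) ^ m := by
        refine ⟨k, ?_⟩
        have h1 := LL_ge hκ hn0 hL (N0 + k)
        have h2 : LL (N0 + k) ≤ LL (N0 + k) ^ m := Nat.le_self_pow (by omega) _
        simp only [hLL] at h2 ⊢
        omega
      classical
      have hs := Nat.find_spec hex
      have hmin := fun j => Nat.find_min hex (m := j)
      set j := Nat.find hex
      cases hj : j with
      | zero => rw [hj] at hs; simp at hs; omega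
      | succ i =>
        refine ⟨N0 + i, by omega, ?_, ?_⟩
        · have := hmin i (by omega); omega
        · rw [hj] at hs; exact hs
    have hreg : ∀ x : Pt d, distInf 0 (sc (LL N) x) ≤ 2 * k + 5 * ((8 * 5 ^ d + 20) * LL N) →
        x ∈ ballF (0 : Pt d) (MM d κ n0 L m N) := by
      intro x hx
      rw [mem_ballF]
      have h0 : sc (LL N) (0 : Pt d) = 0 := by ext i; simp [sc]
      rw [← h0, distInf_sc] at hx
      have h1 : distInf 0 x ≤ LL N * distInf 0 x := Nat.le_mul_of_pos_left _ (hLL1 N)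
      have h2 : 2 * k + 5 * ((8 * 5 ^ d + 20) * LL N) ≤ MM d κ n0 L m N := by
        unfold MM
        simp only [hLL] at hkN ⊢
        omega
      omega
    have hq5 : ∀ n, 5 ≤ qq κ n0 n := fun n => by
      unfold qq
      exact (show 5 ≤ n + n0 by omega).trans (Nat.le_self_pow (by omega) _)
    have hasm := assembly hd ω L h hL hh (qq κ n0) hq5 N (2 * k) ((8 * 5 ^ d + 20) * LL N) (LL N) rfl rfl
      A hAS hAB Cp (Cp_bound hκ hn0 _ (by positivity) _ N)
      (fun x hx => ⟨(hN0 N hN x (hreg x hx)).1, (hN0 N hN x (hreg x hx)).2.1⟩)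
      (fun x hx => locUniq2_shift (hN0 N hN x (hreg x hx)).2.2)
    rcases hasm with h1 | ⟨n, hn1, hn2⟩
    · have h2 : (A.ncard : ℝ) ≤ c1 * ((LL N : ℝ) ^ d) * e := by
        rw [hc1, he]; exact_mod_cast h1
      have h3 : (LL N : ℝ) ^ d ≤ (A.ncard : ℝ) ^ ((1 : ℝ) / d) := by
        have h4 : (k : ℝ) ≤ (A.ncard : ℝ) ^ 3 := by
          have := pow_le_pow_left₀ (by positivity) hkA 3
          rw [← Real.rpow_natCast, ← Real.rpow_mul (by positivity)] at this
          norm_num at this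
          exact this
        have h5 : ((LL N : ℝ) ^ (d ^ 2)) ^ 3 ≤ (A.ncard : ℝ) ^ 3 := by
          refine le_trans ?_ h4
          rw [← pow_mul, mul_comm, ← hm]
          exact_mod_cast hNk
        have h6 : (LL N : ℝ) ^ (d ^ 2) ≤ A.ncard := le_of_pow_le_pow_left₀ (by norm_num) (by positivity) h5
        rw [show d ^ 2 = d * d by ring, pow_mul] at h6
        have h7 := Real.rpow_le_rpow (by positivity) h6 (show 0 ≤ (1 : ℝ) / d by positivity)
        rwa [one_div, Real.pow_rpow_inv_natCast (by positivity) (by omega), ← one_div] at h7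
      have h4 := num1 hd hα1 h3 hc1p.le (by linarith) h2
      nlinarith
    · have hnpos : 1 ≤ n := by
        rcases Nat.eq_zero_or_pos n with h0 | h0
        · rw [h0] at hn1; omega
        · exact h0
      have hLd : (1 : ℝ) ≤ (L : ℝ) ^ d := one_le_pow₀ (by exact_mod_cast hL)
      have h4 := num2 (α := A.ncard) (c := 2 * 2 ^ d * 3 ^ (d + 1) * (Cp * (13 ^ d * d))) (e := e)
        (D := 2 * (L : ℝ) ^ d) hd hnpos (by positivity) (by linarith) (by exact_mod_cast hn1)
        (by positivity) (by linarith) (fun t ht1 ht2 => by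
          refine (hn2 t ht1 ht2).trans (le_of_eq ?_)
          rw [he]; ring)
      rw [← hc2] at h4
      nlinarith


/-- Under P1–P3 and S1–S2, each `P^u` satisfies assumption A5: conditionally
on `0 ∈ S_∞`, almost surely the isoperimetric ratios
`|∂_S A|/|A|^{(d−1)/d}` over all `k ≥ 1` and all `A ⊆ S_∞ ∩ B_S(0,2k)` with `|A| ≥ k^{1/3}`
are bounded away from `0`. -/
theorem stmt16 (d : ℕ) (hd : 2 ≤ d) (a b : ℝ) (ha : 0 ≤ a) (hab : a < b)
    (P : ℝ → Measure (Config d)) (Ax : Axioms d a b P) :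
    ∀ u ∈ Set.Ioo a b,
      ∀ᵐ ω ∂(ProbabilityTheory.cond (P u) {ω | (0 : Pt d) ∈ Sinf ω}),
        ∃ ι > (0:ℝ), ∀ k : ℕ, 1 ≤ k →
          ∀ A : Set (Pt d), A ⊆ Sinf ω ∩ chemBall ω (0 : Pt d) (2*k) →
            (k : ℝ) ^ ((1 : ℝ)/3) ≤ A.ncard →
            ι * (A.ncard : ℝ) ^ (((d : ℝ) - 1) / d) ≤ (edgeBd (SS ω) A).ncard := by
  intro u hu
  obtain ⟨κ, n0, L, h, hκ, hn0, hL, hh, hlog, hI, hD⟩ := setup hd ha Ax hu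
  have hbc := bc Ax hu (m := 3 * d ^ 2) (h := h)
    (Nat.mul_pos (by norm_num) (Nat.pow_pos (by omega))) hκ hn0 hL hlog hI hD
  have hac : ProbabilityTheory.cond (P u) {ω | (0 : Pt d) ∈ Sinf ω} ≪ P u :=
    ProbabilityTheory.cond_absolutelyContinuous
  filter_upwards [hac.ae_le hbc] with ω hω
  exact final_det hd hκ hn0 hL hh ω hω

end Perco
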